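/- arXiv:0806.3926 — 2 statements merged into one kernel-verified Lean document; each statement's English description precedes it below -/
import Mathlib

section
/- Every transcendent leaf of the Ramanujan foliation contains at most one algebraic point: fix (c₂,c₄) ∈ ℂ² ∖ {(0,0)} and for z ∈ ℍ with w(z) := c₄z − c₂ ≠ 0 set u(z) := (g₁(z)w(z)² + c₄w(z), g₂(z)w(z)⁴, g₃(z)w(z)⁶) ∈ ℂ³; these sets are exactly the leaves of ℱ(Ra) in T = ℂ³ ∖ {27t₃² = t₂³}. If z, z′ ∈ ℍ with w(z) ≠ 0 ≠ w(z′) and all three coordinates of u(z) and of u(z′) are algebraic numbers, then u(z) = u(z′). -/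
open Complex

/-- `σ_j(n) = Σ_{d ∣ n} d^j`, as a complex number. -/
noncomputable def sigmaC (j n : ℕ) : ℂ :=
  ∑ d ∈ Nat.divisors n, (d : ℂ) ^ j

/-- The normalized Eisenstein series `g₁` of weight 2. -/
noncomputable def eisG₁ (z : ℂ) : ℂ :=
  (2 * Real.pi * I / 12) *
    (1 + (-1) ^ 1 * (4 * 1 / (1 / 6 : ℂ)) *
      ∑' n : ℕ+, sigmaC 1 n * Complex.exp (2 * Real.pi * I * n * z))

/-- The normalized Eisenstein series `g₂` of weight 4. -/
noncomputable def eisG₂ (z : ℂ) : ℂ :=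
  (12 * (2 * Real.pi * I / 12) ^ 2) *
    (1 + (-1) ^ 2 * (4 * 2 / (1 / 30 : ℂ)) *
      ∑' n : ℕ+, sigmaC 3 n * Complex.exp (2 * Real.pi * I * n * z))

/-- The normalized Eisenstein series `g₃` of weight 6. -/
noncomputable def eisG₃ (z : ℂ) : ℂ :=
  (8 * (2 * Real.pi * I / 12) ^ 3) *
    (1 + (-1) ^ 3 * (4 * 3 / (1 / 42 : ℂ)) *
      ∑' n : ℕ+, sigmaC 5 n * Complex.exp (2 * Real.pi * I * n * z))

/-- The parameterization of the leaf of the Ramanujan foliation `ℱ(Ra)` determined by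
`(c₂,c₄)`: `u(z) = (g₁(z)w² + c₄w, g₂(z)w⁴, g₃(z)w⁶)` with `w = c₄z − c₂`. -/
noncomputable def leafParam (c₂ c₄ z : ℂ) : ℂ × ℂ × ℂ :=
  (eisG₁ z * (c₄ * z - c₂) ^ 2 + c₄ * (c₄ * z - c₂),
   eisG₂ z * (c₄ * z - c₂) ^ 4,
   eisG₃ z * (c₄ * z - c₂) ^ 6)

open scoped Topology ContDiff
open NumberField

theorem exists_entire_eq_pow_mul {f : ℂ → ℂ} (hf : Differentiable ℂ f) (a : ℂ) (n : ℕ)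
    (h : (n : ℕ∞) ≤ analyticOrderAt f a) :
    ∃ g : ℂ → ℂ, Differentiable ℂ g ∧ ∀ z, f z = (z - a) ^ n * g z := by
  induction n generalizing f with
  | zero => exact ⟨f, hf, by simp⟩
  | succ n ih =>
    have hfa : f a = 0 := by
      by_contra h0
      rw [(hf.analyticAt a).analyticOrderAt_eq_zero.2 h0] at h
      simp at h
    have hg : Differentiable ℂ (dslope f a) := fun z =>
      ((differentiableOn_dslope Filter.univ_mem).2 hf.differentiableOn).differentiableAt
        Filter.univ_mem
    have hfg : ∀ z, f z = (z - a) * dslope f a z := fun z => by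
      have := sub_smul_dslope f a z
      simp [hfa] at this
      exact this.symm
    have ho : analyticOrderAt f a = 1 + analyticOrderAt (dslope f a) a := by
      have h1 : analyticOrderAt (fun z : ℂ => z - a) a = 1 := by
        have : ((1 : ℕ) : ℕ∞) = analyticOrderAt (fun z : ℂ => z - a) a := by
          symm
          rw [(by fun_prop : AnalyticAt ℂ (fun z : ℂ => z - a) a).analyticOrderAt_eq_natCast]
          exact ⟨fun _ => 1, analyticAt_const, one_ne_zero, by simp⟩
        exact this.symm.trans Nat.cast_one
      have h2 : f = (fun z : ℂ => z - a) * dslope f a := funext hfg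
      conv_lhs => rw [h2]
      rw [analyticOrderAt_mul (by fun_prop) (hg.analyticAt a), h1]
    rw [ho, Nat.cast_succ, add_comm] at h
    obtain ⟨g, hg1, hg2⟩ := ih hg ((ENat.add_le_add_iff_left (by simp)).1 h)
    exact ⟨g, hg1, fun z => by rw [hfg, hg2]; ring⟩

theorem exists_entire_eq_prod_pow_mul {f : ℂ → ℂ} (hf : Differentiable ℂ f) (S : Finset ℤ) (n : ℕ)
    (h : ∀ m ∈ S, (n : ℕ∞) ≤ analyticOrderAt f (m : ℂ)) :
    ∃ g : ℂ → ℂ, Differentiable ℂ g ∧ ∀ z, f z = (∏ m ∈ S, (z - m) ^ n) * g z := by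
  classical
  induction S using Finset.induction_on generalizing f with
  | empty => exact ⟨f, hf, by simp⟩
  | insert a S ha ih =>
    obtain ⟨g, hg, hfg⟩ := exists_entire_eq_pow_mul hf a n (h a (Finset.mem_insert_self _ _))
    have : ∀ m ∈ S, (n : ℕ∞) ≤ analyticOrderAt g (m : ℂ) := fun m hm => by
      have h1 := h m (Finset.mem_insert_of_mem hm)
      have h2 : f = (fun z : ℂ => (z - a) ^ n) * g := funext hfg
      have h3 : AnalyticAt ℂ (fun z : ℂ => (z - a) ^ n) m := by fun_prop
      rw [h2, analyticOrderAt_mul h3 (hg.analyticAt m)] at h1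
      have h4 : analyticOrderAt (fun z : ℂ => (z - a) ^ n) (m : ℂ) = 0 := by
        rw [h3.analyticOrderAt_eq_zero]
        apply pow_ne_zero
        rw [sub_ne_zero]
        intro h5
        rw [Int.cast_injective h5] at hm
        exact ha hm
      rwa [h4, zero_add] at h1
    obtain ⟨q, hq, hgq⟩ := ih hg this
    exact ⟨q, hq, fun z => by rw [hfg, hgq, Finset.prod_insert ha]; ring⟩

/-- Schwarz lemma for an entire function with zeros of high order at the integers in
`[-R, R]`. -/

theorem norm_iteratedDeriv_le_of_zeros {f : ℂ → ℂ} (hf : Differentiable ℂ f) {R : ℕ} (hR : 1 ≤ R)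
    (n : ℕ) (h : ∀ m : ℤ, |m| ≤ R → ∀ k < n, iteratedDeriv k f m = 0) {B : ℝ}
    (hB : ∀ z : ℂ, ‖z‖ ≤ 3 * R → ‖f z‖ ≤ B) :
    ‖iteratedDeriv n f 0‖ ≤ n.factorial * (B / 2 ^ (2 * R * n)) := by
  classical
  have hR0 : (1 : ℝ) ≤ R := by exact_mod_cast hR
  have hB0 : 0 ≤ B := (norm_nonneg _).trans (hB 0 (by simp))
  obtain ⟨g, hg, hfg⟩ := exists_entire_eq_prod_pow_mul hf (Finset.Icc (-R : ℤ) R) n fun m hm => by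
    rw [natCast_le_analyticOrderAt_iff_iteratedDeriv_eq_zero (hf.analyticAt _)]
    exact h m (abs_le.2 (Finset.mem_Icc.1 hm))
  have hg0 : ‖g 0‖ ≤ B / ((2 * R : ℝ) ^ n) ^ (2 * R + 1) := by
    refine Complex.norm_le_of_forall_mem_frontier_norm_le (U := Metric.ball 0 (3 * R : ℝ))
      Metric.isBounded_ball hg.diffContOnCl ?_ (subset_closure (by simp; linarith))
    intro z hz
    rw [frontier_ball _ (by positivity : (3 * R : ℝ) ≠ 0)] at hz
    have hz' : ‖z‖ = 3 * R := by simpa using hz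
    have h1 : ((2 * R : ℝ) ^ n) ^ (2 * R + 1) ≤ ‖∏ m ∈ Finset.Icc (-R : ℤ) R, (z - m) ^ n‖ := by
      rw [norm_prod]
      calc _ = ∏ m ∈ Finset.Icc (-R : ℤ) R, (2 * R : ℝ) ^ n := by
            rw [Finset.prod_const, Int.card_Icc]; congr 1; omega
        _ ≤ _ := by
            refine Finset.prod_le_prod (fun _ _ => by positivity) fun m hm => ?_
            rw [norm_pow]
            gcongr
            have h2 : |(m : ℝ)| ≤ R := by exact_mod_cast abs_le.2 (Finset.mem_Icc.1 hm)
            have h3 := norm_sub_norm_le z (m : ℂ)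
            rw [hz', Complex.norm_intCast] at h3
            linarith
    rw [le_div_iff₀ (by positivity)]
    have h2 := hB z hz'.le
    rw [hfg, norm_mul, mul_comm] at h2
    exact (mul_le_mul_of_nonneg_left h1 (norm_nonneg _)).trans h2
  set S := (Finset.Icc (-R : ℤ) R).erase 0
  have h0S : (0 : ℤ) ∈ Finset.Icc (-R : ℤ) R := by simp
  set H : ℂ → ℂ := fun z => (∏ m ∈ S, (z - m) ^ n) * g z
  have hH : Differentiable ℂ H := by
    refine Differentiable.mul ?_ hg
    fun_prop
  have hfH : f = fun z => z ^ n * H z := by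
    ext z
    rw [hfg, ← Finset.mul_prod_erase _ _ h0S]
    simp [H, S]
    ring
  have h1 : iteratedDeriv n f 0 = n.factorial * H 0 := by
    rw [hfH, iteratedDeriv_fun_mul (by fun_prop) hH.contDiff.contDiffAt,
      Finset.sum_eq_single_of_mem n (by simp)]
    · rw [iteratedDeriv_fun_pow_zero]; simp
    · intro i _ hi
      rw [iteratedDeriv_fun_pow_zero]; simp [hi]
  have hcard : S.card = 2 * R := by
    rw [Finset.card_erase_of_mem h0S, Int.card_Icc]; omega
  have h2 : ‖∏ m ∈ S, ((0 : ℂ) - m) ^ n‖ ≤ ((R : ℝ) ^ n) ^ (2 * R) := by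
    rw [norm_prod, ← hcard, ← Finset.prod_const]
    refine Finset.prod_le_prod (fun _ _ => norm_nonneg _) fun m hm => ?_
    rw [norm_pow]
    gcongr
    rw [zero_sub, norm_neg, Complex.norm_intCast]
    exact_mod_cast abs_le.2 (Finset.mem_Icc.1 (Finset.mem_of_mem_erase hm))
  rw [h1, norm_mul, Complex.norm_natCast]
  gcongr
  rw [norm_mul]
  calc _ ≤ ((R : ℝ) ^ n) ^ (2 * R) * (B / ((2 * R : ℝ) ^ n) ^ (2 * R + 1)) := by gcongr
    _ ≤ ((R : ℝ) ^ n) ^ (2 * R) * (B / ((2 * R : ℝ) ^ n) ^ (2 * R)) := by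
        gcongr
        · exact one_le_pow₀ (by linarith)
        · exact Nat.le_succ _
    _ = _ := by
        rw [mul_pow, mul_pow, ← pow_mul, ← pow_mul, show n * (2 * R) = 2 * R * n by ring]
        have : (R : ℝ) ^ (2 * R * n) ≠ 0 := by positivity
        field_simp

/-- The derivative of a function on `ℂ²` in the direction `v`. -/
noncomputable def dirDeriv (v : ℂ × ℂ) (f : ℂ × ℂ → ℂ) : ℂ × ℂ → ℂ := fun x => fderiv ℂ f x v

theorem ContDiff.dirDeriv {f : ℂ × ℂ → ℂ} (hf : ContDiff ℂ ∞ f) (v : ℂ × ℂ) :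
    ContDiff ℂ ∞ (dirDeriv v f) :=
  (hf.fderiv_right (m := ∞) (by simp)).clm_apply contDiff_const

theorem ContDiff.iterate_dirDeriv {f : ℂ × ℂ → ℂ} (hf : ContDiff ℂ ∞ f) (v : ℂ × ℂ) (n : ℕ) :
    ContDiff ℂ ∞ ((_root_.dirDeriv v)^[n] f) := by
  induction n with
  | zero => exact hf
  | succ n ih => rw [Function.iterate_succ_apply']; exact ih.dirDeriv v

theorem dirDeriv_comm {f : ℂ × ℂ → ℂ} (hf : ContDiff ℂ ∞ f) (v w : ℂ × ℂ) :
    dirDeriv v (dirDeriv w f) = dirDeriv w (dirDeriv v f) := by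
  ext x
  have hd : DifferentiableAt ℂ (fderiv ℂ f) x :=
    ((hf.fderiv_right (m := 1) (by norm_cast)).differentiable (by norm_num)).differentiableAt
  have h (a b : ℂ × ℂ) : dirDeriv a (dirDeriv b f) x = fderiv ℂ (fderiv ℂ f) x a b := by
    unfold dirDeriv
    rw [fderiv_clm_apply hd (differentiableAt_const b)]
    simp
  rw [h, h]
  exact (hf.contDiffAt.isSymmSndFDerivAt
    (by simpa using (WithTop.coe_le_coe.2 (le_top : (2 : ℕ∞) ≤ ⊤)))).eq v w

theorem dirDeriv_iterate_comm {f : ℂ × ℂ → ℂ} (hf : ContDiff ℂ ∞ f) (v w : ℂ × ℂ) (n : ℕ) :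
    dirDeriv v ((dirDeriv w)^[n] f) = (dirDeriv w)^[n] (dirDeriv v f) := by
  induction n with
  | zero => rfl
  | succ n ih =>
    rw [Function.iterate_succ_apply', Function.iterate_succ_apply',
      dirDeriv_comm (hf.iterate_dirDeriv w n), ih]

theorem iterate_dirDeriv_iterate_comm {f : ℂ × ℂ → ℂ} (hf : ContDiff ℂ ∞ f) (v w : ℂ × ℂ)
    (m n : ℕ) : (dirDeriv v)^[m] ((dirDeriv w)^[n] f) = (dirDeriv w)^[n] ((dirDeriv v)^[m] f) := by
  induction m with
  | zero => rfl
  | succ m ih =>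
    rw [Function.iterate_succ_apply', Function.iterate_succ_apply', ih,
      dirDeriv_iterate_comm (hf.iterate_dirDeriv v m)]

theorem dirDeriv_linear (a b : ℂ) (v w : ℂ × ℂ) (f : ℂ × ℂ → ℂ) :
    dirDeriv (a • v + b • w) f = a • dirDeriv v f + b • dirDeriv w f := by
  ext x
  simp [dirDeriv]

theorem dirDeriv_comb {f g : ℂ × ℂ → ℂ} (hf : ContDiff ℂ ∞ f) (hg : ContDiff ℂ ∞ g) (a b : ℂ)
    (v : ℂ × ℂ) : dirDeriv v (a • f + b • g) = a • dirDeriv v f + b • dirDeriv v g := by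
  ext x
  have h1 : DifferentiableAt ℂ f x := (hf.differentiable (by simp)).differentiableAt
  have h2 : DifferentiableAt ℂ g x := (hg.differentiable (by simp)).differentiableAt
  simp only [dirDeriv]
  rw [fderiv_add (h1.const_smul a) (h2.const_smul b), fderiv_const_smul h1, fderiv_const_smul h2]
  simp [dirDeriv]

theorem iterate_dirDeriv_comb {f g : ℂ × ℂ → ℂ} (hf : ContDiff ℂ ∞ f) (hg : ContDiff ℂ ∞ g)
    (a b : ℂ) (v : ℂ × ℂ) (n : ℕ) :
    (dirDeriv v)^[n] (a • f + b • g) = a • (dirDeriv v)^[n] f + b • (dirDeriv v)^[n] g := by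
  induction n with
  | zero => rfl
  | succ n ih =>
    simp only [Function.iterate_succ_apply', ih]
    exact dirDeriv_comb (hf.iterate_dirDeriv v n) (hg.iterate_dirDeriv v n) a b v

theorem dirDeriv_mul {f g : ℂ × ℂ → ℂ} (hf : ContDiff ℂ ∞ f) (hg : ContDiff ℂ ∞ g) (v : ℂ × ℂ) :
    dirDeriv v (f * g) = f * dirDeriv v g + g * dirDeriv v f := by
  ext x
  have h1 : DifferentiableAt ℂ f x := (hf.differentiable (by simp)).differentiableAt
  have h2 : DifferentiableAt ℂ g x := (hg.differentiable (by simp)).differentiableAt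
  simp only [dirDeriv]
  rw [fderiv_mul h1 h2]
  simp [dirDeriv]

theorem dirDeriv_comp_add (f : ℂ × ℂ → ℂ) (p v : ℂ × ℂ) :
    dirDeriv v (fun x => f (x + p)) = fun x => dirDeriv v f (x + p) := by
  ext x
  simp only [dirDeriv]
  rw [fderiv_comp_add_right]

theorem iterate_dirDeriv_comp_add (f : ℂ × ℂ → ℂ) (p v : ℂ × ℂ) (n : ℕ) :
    (dirDeriv v)^[n] (fun x => f (x + p)) = fun x => (dirDeriv v)^[n] f (x + p) := by
  induction n with
  | zero => rfl
  | succ n ih => simp only [Function.iterate_succ_apply', ih, dirDeriv_comp_add]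

theorem iteratedDeriv_comp_line {f : ℂ × ℂ → ℂ} (hf : ContDiff ℂ ∞ f) (x v : ℂ × ℂ) (n : ℕ) :
    iteratedDeriv n (fun t : ℂ => f (x + t • v)) = fun t => (dirDeriv v)^[n] f (x + t • v) := by
  induction n with
  | zero => simp
  | succ n ih =>
    rw [iteratedDeriv_succ, ih]
    ext t
    rw [Function.iterate_succ_apply']
    have h1 : DifferentiableAt ℂ ((dirDeriv v)^[n] f) (x + t • v) :=
      ((hf.iterate_dirDeriv v n).differentiable (by simp)).differentiableAt
    have h2 : HasDerivAt (fun t : ℂ => x + t • v) v t := by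
      simpa using ((hasDerivAt_id t).smul_const v).const_add x
    exact (h1.hasFDerivAt.comp_hasDerivAt t h2).deriv

/-- Bounds for mixed derivatives of order `n` transfer to another pair of directions. -/

theorem norm_iterate_dirDeriv_le {v w e e' : ℂ × ℂ} {a b c d : ℂ} (he : e = a • v + b • w)
    (he' : e' = c • v + d • w) {A : ℝ} (hA : ‖a‖ + ‖b‖ ≤ A) (hA' : ‖c‖ + ‖d‖ ≤ A)
    (x : ℂ × ℂ) (n : ℕ) {f : ℂ × ℂ → ℂ} (hf : ContDiff ℂ ∞ f) {M : ℝ}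
    (h : ∀ i j, i + j = n → ‖(dirDeriv v)^[i] ((dirDeriv w)^[j] f) x‖ ≤ M) {k l : ℕ}
    (hkl : k + l = n) : ‖(dirDeriv e)^[k] ((dirDeriv e')^[l] f) x‖ ≤ A ^ n * M := by
  induction n generalizing f M k l with
  | zero =>
    obtain ⟨rfl, rfl⟩ : k = 0 ∧ l = 0 := by omega
    simpa using h 0 0 rfl
  | succ n ih =>
    have step (a b : ℂ) (hA : ‖a‖ + ‖b‖ ≤ A) (i j : ℕ) (hij : i + j = n) :
        ‖(dirDeriv v)^[i] ((dirDeriv w)^[j] (dirDeriv (a • v + b • w) f)) x‖ ≤ A * M := by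
      have h1 := h (i + 1) j (by omega)
      have h2 := h i (j + 1) (by omega)
      have hM : 0 ≤ M := (norm_nonneg _).trans h1
      rw [Function.iterate_succ_apply, dirDeriv_iterate_comm hf] at h1
      rw [Function.iterate_succ_apply] at h2
      rw [dirDeriv_linear, iterate_dirDeriv_comb (hf.dirDeriv v) (hf.dirDeriv w),
        iterate_dirDeriv_comb ((hf.dirDeriv v).iterate_dirDeriv w j)
          ((hf.dirDeriv w).iterate_dirDeriv w j)]
      refine (norm_add_le _ _).trans ?_
      simp only [Pi.smul_apply, norm_smul]
      calc _ ≤ ‖a‖ * M + ‖b‖ * M := by gcongr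
        _ = (‖a‖ + ‖b‖) * M := by ring
        _ ≤ A * M := by gcongr
    rw [pow_succ, mul_assoc]
    rcases k with _ | k
    · obtain ⟨rfl⟩ : l = n + 1 := by omega
      have := ih (hf.dirDeriv e') (M := A * M) (by rw [he']; exact step c d hA')
        (k := 0) (l := n) (by omega)
      simpa [Function.iterate_succ_apply] using this
    · have := ih (hf.dirDeriv e) (M := A * M) (by rw [he]; exact step a b hA)
        (k := k) (l := l) (by omega)
      rwa [Function.iterate_succ_apply, dirDeriv_iterate_comm hf]

/-- All mixed derivatives of `f` of order `< n` in the directions `v`, `w` vanish at `x`. -/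
def VanishTo (v w : ℂ × ℂ) (n : ℕ) (f : ℂ × ℂ → ℂ) (x : ℂ × ℂ) : Prop :=
  ∀ i j, i + j < n → (dirDeriv v)^[i] ((dirDeriv w)^[j] f) x = 0

namespace VanishTo

theorem mono {v w : ℂ × ℂ} {m n : ℕ} {f : ℂ × ℂ → ℂ} {x : ℂ × ℂ} (h : VanishTo v w n f x)
    (hmn : m ≤ n) : VanishTo v w m f x := fun i j hij => h i j (by omega)

theorem succ_iff {v w : ℂ × ℂ} {n : ℕ} {f : ℂ × ℂ → ℂ} (hf : ContDiff ℂ ∞ f) {x : ℂ × ℂ} :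
    VanishTo v w (n + 1) f x ↔
      f x = 0 ∧ VanishTo v w n (dirDeriv v f) x ∧ VanishTo v w n (dirDeriv w f) x := by
  constructor
  · intro h
    refine ⟨h 0 0 (by omega), fun i j hij => ?_, fun i j hij => ?_⟩
    · rw [← dirDeriv_iterate_comm hf]
      exact h (i + 1) j (by omega)
    · exact h i (j + 1) (by omega)
  · rintro ⟨h0, h1, h2⟩ i j hij
    rcases j with _ | j
    · rcases i with _ | i
      · exact h0
      · exact h1 i 0 (by omega)
    · exact h2 i j (by omega)

theorem comb {v w : ℂ × ℂ} {n : ℕ} {f g : ℂ × ℂ → ℂ} (hf : ContDiff ℂ ∞ f) (hg : ContDiff ℂ ∞ g)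
    {x : ℂ × ℂ} (h : VanishTo v w n f x) (h' : VanishTo v w n g x) :
    VanishTo v w n (f + g) x := fun i j hij => by
  have : f + g = (1 : ℂ) • f + (1 : ℂ) • g := by simp
  rw [this, iterate_dirDeriv_comb hf hg, iterate_dirDeriv_comb (hf.iterate_dirDeriv w j)
    (hg.iterate_dirDeriv w j)]
  simp [h i j hij, h' i j hij]

theorem mul {v w : ℂ × ℂ} {n : ℕ} {f E : ℂ × ℂ → ℂ} (hE : ContDiff ℂ ∞ E) (hf : ContDiff ℂ ∞ f)
    {x : ℂ × ℂ} (h : VanishTo v w n f x) : VanishTo v w n (E * f) x := by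
  induction n generalizing E f with
  | zero => intro i j hij; omega
  | succ n ih =>
    have h' := (succ_iff hf).1 h
    rw [succ_iff (f := E * f) (hE.mul hf)]
    refine ⟨by simp [h'.1], ?_, ?_⟩
    · rw [dirDeriv_mul hE hf]
      exact comb (f := E * dirDeriv v f) (g := f * dirDeriv v E) (hE.mul (hf.dirDeriv v)) (hf.mul (hE.dirDeriv v))
        (ih hE (hf.dirDeriv v) h'.2.1)
        (mul_comm (dirDeriv v E) f ▸ ih (hE.dirDeriv v) hf (h.mono (Nat.le_succ n)))
    · rw [dirDeriv_mul hE hf]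
      exact comb (f := E * dirDeriv w f) (g := f * dirDeriv w E) (hE.mul (hf.dirDeriv w)) (hf.mul (hE.dirDeriv w))
        (ih hE (hf.dirDeriv w) h'.2.2)
        (mul_comm (dirDeriv w E) f ▸ ih (hE.dirDeriv w) hf (h.mono (Nat.le_succ n)))

theorem translate {v w : ℂ × ℂ} {n : ℕ} {f E : ℂ × ℂ → ℂ} (hE : ContDiff ℂ ∞ E)
    (hf : ContDiff ℂ ∞ f) {x p : ℂ × ℂ} (hp : ∀ x, f (x + p) = E x * f x)
    (h : VanishTo v w n f x) : VanishTo v w n f (x + p) := fun i j hij => by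
  have h1 := h.mul hE hf i j hij
  have h2 : E * f = fun x => f (x + p) := by ext x; simp [hp]
  rw [h2, iterate_dirDeriv_comp_add, iterate_dirDeriv_comp_add] at h1
  exact h1

theorem swap {v w : ℂ × ℂ} {n : ℕ} {f : ℂ × ℂ → ℂ} (hf : ContDiff ℂ ∞ f) {x : ℂ × ℂ}
    (h : VanishTo v w n f x) : VanishTo w v n f x := fun i j hij => by
  rw [iterate_dirDeriv_iterate_comm hf]
  exact h j i (by omega)

theorem change {v w e e' : ℂ × ℂ} {a b c d : ℂ} (he : e = a • v + b • w)
    (he' : e' = c • v + d • w) {n : ℕ} {f : ℂ × ℂ → ℂ} (hf : ContDiff ℂ ∞ f) {x : ℂ × ℂ}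
    (h : VanishTo v w n f x) : VanishTo e e' n f x := fun i j hij => by
  have := norm_iterate_dirDeriv_le he he' (le_max_left _ (‖c‖ + ‖d‖)) (le_max_right _ _) x (i + j)
    hf (M := 0) (fun k l hkl => by rw [h k l (by omega), norm_zero]) rfl
  rw [mul_zero] at this
  exact norm_le_zero_iff.1 this

theorem int_translate {v w : ℂ × ℂ} {n : ℕ} {f : ℂ × ℂ → ℂ} (hf : ContDiff ℂ ∞ f) {p : ℂ × ℂ}
    (hp : ∃ α β γ : ℂ, ∀ x, f (x + p) = exp (α * x.1 + β * x.2 + γ) * f x)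
    {x : ℂ × ℂ} (h : VanishTo v w n f x) (m : ℤ) : VanishTo v w n f (x + (m : ℂ) • p) := by
  obtain ⟨α, β, γ, hp⟩ := hp
  have hs (α β γ : ℂ) : ContDiff ℂ ∞ fun x : ℂ × ℂ => exp (α * x.1 + β * x.2 + γ) := by
    have : ContDiff ℂ ∞ Complex.exp := Complex.contDiff_exp
    fun_prop
  have hp' : ∀ x, f (x + -p) = exp (-α * x.1 + -β * x.2 + (α * p.1 + β * p.2 - γ)) * f x := by
    intro x
    have h1 := hp (x + -p)
    rw [neg_add_cancel_right] at h1
    rw [h1, ← mul_assoc, ← Complex.exp_add]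
    simp only [Prod.fst_add, Prod.snd_add, Prod.fst_neg, Prod.snd_neg]
    ring_nf
    simp
  induction m using Int.induction_on with
  | zero => simpa using h
  | succ m ih =>
    have := ih.translate (hs _ _ _) hf hp
    convert this using 1
    push_cast
    rw [add_smul, one_smul, add_assoc]
  | pred m ih =>
    have := ih.translate (hs _ _ _) hf hp'
    convert this using 1
    push_cast
    rw [sub_smul, one_smul, add_assoc, sub_eq_add_neg]

end VanishTo

theorem norm_iterate_dirDeriv_le_of_translate {v w : ℂ × ℂ} {Φ : ℂ × ℂ → ℂ} (hΦ : ContDiff ℂ ∞ Φ)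
    (hp : ∃ α β γ : ℂ, ∀ x, Φ (x + v) = exp (α * x.1 + β * x.2 + γ) * Φ x)
    {i j : ℕ} (h : VanishTo v w (i + j) Φ 0) {R : ℕ} (hR : 1 ≤ R) {B : ℝ}
    (hB : ∀ t r : ℂ, ‖t‖ ≤ 3 * R → ‖r‖ ≤ 1 → ‖Φ (t • v + r • w)‖ ≤ B) :
    ‖(dirDeriv v)^[i] ((dirDeriv w)^[j] Φ) 0‖ ≤
      i.factorial * (j.factorial * B / 2 ^ (2 * R * i)) := by
  have hw := hΦ.iterate_dirDeriv w j
  have hG : Differentiable ℂ (fun t : ℂ => (dirDeriv w)^[j] Φ (0 + t • v)) :=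
    (hw.differentiable (by simp)).comp (by fun_prop)
  have key := norm_iteratedDeriv_le_of_zeros hG hR i (B := j.factorial * B) ?_ ?_
  · rw [iteratedDeriv_comp_line hw] at key
    simpa using key
  · intro m _ k hk
    rw [iteratedDeriv_comp_line hw]
    exact h.int_translate hΦ hp m k j (by omega)
  · intro z hz
    have h1 := congrFun (iteratedDeriv_comp_line hΦ (0 + z • v) w j) 0
    simp only [zero_smul, add_zero] at h1
    rw [← h1]
    have h2 : Differentiable ℂ fun t : ℂ => Φ (0 + z • v + t • w) :=
      (hΦ.differentiable (by simp)).comp (by fun_prop)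
    have := norm_iteratedDeriv_le_of_forall_mem_sphere_norm_le (n := j) (c := (0 : ℂ)) one_pos
      h2.diffContOnCl (C := B) fun r hr => by
        simpa using hB z r hz (by simpa using (mem_sphere_zero_iff_norm.1 hr).le)
    simpa using this

/-- The analytic upper estimate: if `Φ` is quasi-periodic with respect to the basis `v`, `w` of
`ℂ²` and vanishes to order `T` at the origin, its derivatives of order `T` there are small. -/

theorem norm_iterate_dirDeriv_le_of_quasiPeriodic {v w : ℂ × ℂ} {a b c d : ℂ}
    (he : ((1, 0) : ℂ × ℂ) = a • v + b • w) (he' : ((0, 1) : ℂ × ℂ) = c • v + d • w) {A : ℝ}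
    (hA : ‖a‖ + ‖b‖ ≤ A) (hA' : ‖c‖ + ‖d‖ ≤ A) {Φ : ℂ × ℂ → ℂ} (hΦ : ContDiff ℂ ∞ Φ)
    (hv : ∃ α β γ : ℂ, ∀ x, Φ (x + v) = exp (α * x.1 + β * x.2 + γ) * Φ x)
    (hw : ∃ α β γ : ℂ, ∀ x, Φ (x + w) = exp (α * x.1 + β * x.2 + γ) * Φ x)
    {T : ℕ} (h : VanishTo (1, 0) (0, 1) T Φ 0) {R : ℕ} (hR : 1 ≤ R) {B : ℝ}
    (hB : ∀ t r : ℂ, ‖t‖ ≤ 3 * R → ‖r‖ ≤ 3 * R → ‖Φ (t • v + r • w)‖ ≤ B)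
    {k l : ℕ} (hkl : k + l = T) :
    ‖(dirDeriv (1, 0))^[k] ((dirDeriv (0, 1))^[l] Φ) 0‖ ≤
      A ^ T * (T.factorial * (B / 2 ^ (R * T))) := by
  have hB0 : 0 ≤ B := (norm_nonneg _).trans (hB 0 0 (by simp) (by simp))
  have hR1 : (1 : ℝ) ≤ 3 * R := by
    have : (1 : ℝ) ≤ R := by exact_mod_cast hR
    linarith
  have hvan : VanishTo v w T Φ 0 := h.change (a := v.1) (b := v.2) (c := w.1) (d := w.2)
    (by ext <;> simp) (by ext <;> simp) hΦ
  refine norm_iterate_dirDeriv_le he he' hA hA' 0 T hΦ (fun i j hij => ?_) hkl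
  have aux (i j : ℕ) (hij : i + j = T) (hi : T ≤ 2 * i) :
      (i.factorial : ℝ) * (j.factorial * B / 2 ^ (2 * R * i)) ≤
        T.factorial * (B / 2 ^ (R * T)) := by
    have h1 : (i.factorial : ℝ) * j.factorial ≤ T.factorial := by
      have := Nat.le_of_dvd (Nat.factorial_pos _) (Nat.factorial_mul_factorial_dvd_factorial_add i j)
      rw [hij] at this
      exact_mod_cast this
    calc _ = ((i.factorial : ℝ) * j.factorial) * (B / 2 ^ (2 * R * i)) := by ring
      _ ≤ T.factorial * (B / 2 ^ (R * T)) := by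
        have h2 : R * T ≤ 2 * R * i := by nlinarith
        gcongr
        norm_num
  rcases le_total T (2 * i) with hi | hi
  · refine le_trans ?_ (aux i j hij hi)
    subst hij
    exact norm_iterate_dirDeriv_le_of_translate hΦ hv hvan hR
      fun t r ht hr => hB t r ht (hr.trans hR1)
  · refine le_trans ?_ (aux j i (by omega) (by omega))
    rw [iterate_dirDeriv_iterate_comm hΦ]
    refine norm_iterate_dirDeriv_le_of_translate hΦ hw ?_ hR
      fun t r ht hr => by rw [add_comm]; exact hB r t (hr.trans hR1) ht
    rw [add_comm, hij]
    exact hvan.swap hΦ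

/-- Mixed partial derivatives of a sum of products of functions of one variable. -/

theorem iterate_dirDeriv_sum_mul {ι : Type*} (S : Finset ι) (q : ι → ℂ) {f g : ι → ℂ → ℂ}
    (hf : ∀ i, Differentiable ℂ (f i)) (hg : ∀ i, Differentiable ℂ (g i)) (k l : ℕ) :
    (dirDeriv (1, 0))^[k] ((dirDeriv (0, 1))^[l] fun x => ∑ i ∈ S, q i * (f i x.1 * g i x.2)) =
      fun x => ∑ i ∈ S, q i * (iteratedDeriv k (f i) x.1 * iteratedDeriv l (g i) x.2) := by
  have hd {f : ℂ → ℂ} (hf : Differentiable ℂ f) (n : ℕ) : Differentiable ℂ (iteratedDeriv n f) :=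
    (hf.contDiff (n := ⊤)).differentiable_iteratedDeriv n (by
      exact_mod_cast WithTop.coe_lt_top _)
  have step {f g : ι → ℂ → ℂ} (hf : ∀ i, Differentiable ℂ (f i)) (hg : ∀ i, Differentiable ℂ (g i))
      (v : ℂ × ℂ) (x : ℂ × ℂ) : dirDeriv v (fun x => ∑ i ∈ S, q i * (f i x.1 * g i x.2)) x =
      ∑ i ∈ S, q i * (v.1 * (deriv (f i) x.1 * g i x.2) + v.2 * (f i x.1 * deriv (g i) x.2)) := by
    have h1 (i : ι) : HasFDerivAt (fun x : ℂ × ℂ => f i x.1)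
        (deriv (f i) x.1 • ContinuousLinearMap.fst ℂ ℂ ℂ) x :=
      ((hf i) x.1).hasDerivAt.comp_hasFDerivAt x hasFDerivAt_fst
    have h2 (i : ι) : HasFDerivAt (fun x : ℂ × ℂ => g i x.2)
        (deriv (g i) x.2 • ContinuousLinearMap.snd ℂ ℂ ℂ) x :=
      ((hg i) x.2).hasDerivAt.comp_hasFDerivAt x hasFDerivAt_snd
    have h3 := HasFDerivAt.fun_sum (u := S) fun i _ => ((h1 i).mul (h2 i)).const_mul (q i)
    unfold dirDeriv
    simp only [Pi.mul_apply] at h3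
    rw [h3.fderiv, sum_apply]
    refine Finset.sum_congr rfl fun i _ => ?_
    simp
    ring
  have hl : ((dirDeriv (0, 1))^[l] fun x => ∑ i ∈ S, q i * (f i x.1 * g i x.2)) =
      fun x => ∑ i ∈ S, q i * (f i x.1 * iteratedDeriv l (g i) x.2) := by
    induction l with
    | zero => simp
    | succ l ih =>
      rw [Function.iterate_succ_apply', ih]
      ext x
      rw [step hf (fun i => hd (hg i) l)]
      simp [iteratedDeriv_succ]
  rw [hl]
  induction k with
  | zero => simp
  | succ k ih =>
    rw [Function.iterate_succ_apply', ih]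
    ext x
    rw [step (fun i => hd (hf i) k) (fun i => hd (hg i) l)]
    simp [iteratedDeriv_succ]

/-- Siegel's lemma for twice as many unknowns as equations. -/

theorem exists_siegel_vector (K : Type) [Field K] [NumberField K] :
    ∃ c : ℝ, 1 ≤ c ∧ ∀ (α β : Type) [Fintype α] [Fintype β] (a : Matrix α β (𝓞 K)) (A : ℝ),
      1 ≤ A → 0 < Fintype.card α → Fintype.card β = 2 * Fintype.card α →
      (∀ k l, house (a k l : K) ≤ A) →
      ∃ ξ : β → 𝓞 K, ξ ≠ 0 ∧ (∀ k, ∑ l, a k l * ξ l = 0) ∧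
        ∀ l, house (ξ l : K) ≤ c * Fintype.card β * A := by
  classical
  obtain ⟨c₁, h⟩ : ∃ c₁ : ℝ, ∀ (α β : Type) [Fintype α] [Fintype β] (a : Matrix α β (𝓞 K))
      (A : ℝ) (_ : a ≠ 0) (p q : ℕ), (∀ k l, house (a k l : K) ≤ A) → p < q → 0 < p →
      Fintype.card α = p → Fintype.card β = q →
      ∃ ξ : β → 𝓞 K, ξ ≠ 0 ∧ a.mulVec ξ = 0 ∧
        ∀ l, house (ξ l).1 ≤ c₁ * ((c₁ * q * A) ^ ((p : ℝ) / (q - p))) :=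
    ⟨_, fun α β _ _ a A ha p q hA hpq hp hα hβ =>
      house.exists_ne_zero_int_vec_house_le K a ha hp hpq hβ hA hα⟩
  refine ⟨max 1 (c₁ * c₁), le_max_left _ _, ?_⟩
  intro α β _ _ a A hA hα hβ hb
  by_cases ha : a = 0
  · have : Nonempty β := Fintype.card_pos_iff.1 (by omega)
    refine ⟨1, one_ne_zero, fun k => by simp [ha], fun l => ?_⟩
    have h1 : house ((1 : β → 𝓞 K) l : K) ≤ 1 := by
      have := house_intCast (K := K) 1
      simp at this
      simp [this]
    refine h1.trans ?_
    have h2 : (1 : ℝ) ≤ Fintype.card β := by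
      have : 1 ≤ Fintype.card β := by omega
      exact_mod_cast this
    have h3 := le_max_left 1 (c₁ * c₁)
    have := mul_le_mul h3 h2 zero_le_one (by positivity)
    nlinarith
  · obtain ⟨ξ, h0, h1, h2⟩ := h α β a A ha _ _ hb (by omega) hα rfl rfl
    refine ⟨ξ, h0, fun k => congrFun h1 k, fun l => (h2 l).trans ?_⟩
    have hp : ((Fintype.card α : ℝ) / ((Fintype.card β : ℕ) - Fintype.card α : ℝ)) = 1 := by
      rw [hβ]
      push_cast
      have : (Fintype.card α : ℝ) ≠ 0 := by exact_mod_cast hα.ne'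
      field_simp
      ring
    rw [hp, Real.rpow_one]
    have : c₁ * (c₁ * (Fintype.card β) * A) = (c₁ * c₁) * Fintype.card β * A := by ring
    rw [this]
    gcongr
    exact le_max_right _ _

/-- The Liouville inequality for algebraic integers. -/

theorem one_le_norm_mul_house_pow {K : Type} [Field K] [NumberField K] (φ : K →+* ℂ) (α : 𝓞 K)
    (hα : α ≠ 0) : 1 ≤ ‖φ α‖ * house (α : K) ^ (Module.finrank ℚ K - 1) := by
  refine le_trans ?_ (norm_norm_le_norm_mul_house_pow (α : K) φ)
  have h1 : Algebra.norm ℤ α ≠ 0 := Algebra.norm_ne_zero_iff.2 hα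
  have h2 : (Algebra.norm ℚ (α : K)) = ((Algebra.norm ℤ α : ℤ) : ℚ) := by
    rw [← Algebra.coe_norm_int]
  rw [h2, Int.norm_cast_rat, Int.norm_eq_abs]
  exact_mod_cast Int.one_le_abs h1

/-- The derivatives of `f` at `0` are the images under `φ` of algebraic integers whose houses
are at most `A * k! * ρ ^ k`. -/
def IntegralTaylor {K : Type} [Field K] [NumberField K] (φ : K →+* ℂ) (f : ℂ → ℂ) (A ρ : ℝ) :
    Prop :=
  ∀ k : ℕ, ∃ u : 𝓞 K, φ u = iteratedDeriv k f 0 ∧ house (u : K) ≤ A * k.factorial * ρ ^ k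

namespace IntegralTaylor

variable {K : Type} [Field K] [NumberField K] {φ : K →+* ℂ}

theorem mono {f : ℂ → ℂ} {A ρ B σ : ℝ} (hf : IntegralTaylor φ f A ρ) (hA : 0 ≤ A) (hρ : 0 ≤ ρ)
    (hAB : A ≤ B) (hρσ : ρ ≤ σ) : IntegralTaylor φ f B σ := fun k => by
  obtain ⟨u, h1, h2⟩ := hf k
  refine ⟨u, h1, h2.trans ?_⟩
  have : 0 ≤ B := hA.trans hAB
  gcongr

theorem one {ρ : ℝ} (hρ : 0 ≤ ρ) : IntegralTaylor φ (fun _ => 1) 1 ρ := fun k => by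
  rcases k with _ | k
  · refine ⟨1, by simp, ?_⟩
    have := house_intCast (K := K) 1
    simp at this
    simp [this]
  · refine ⟨0, by simp [iteratedDeriv_const], ?_⟩
    simp only [map_zero]
    have : house (0 : K) = 0 := by simp [house]
    rw [this]
    positivity

theorem mul {f g : ℂ → ℂ} {A B ρ : ℝ} (hf : IntegralTaylor φ f A (2 * ρ))
    (hg : IntegralTaylor φ g B ρ) (hA : 0 ≤ A) (hB : 0 ≤ B) (hρ : 0 ≤ ρ) (af : AnalyticAt ℂ f 0)
    (ag : AnalyticAt ℂ g 0) : IntegralTaylor φ (fun s => f s * g s) (2 * B * A) (2 * ρ) := by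
  intro k
  choose u hu hu' using hf
  choose v hv hv' using hg
  refine ⟨∑ i ∈ Finset.range (k + 1), (k.choose i : 𝓞 K) * u i * v (k - i), ?_, ?_⟩
  · rw [iteratedDeriv_fun_mul af.contDiffAt ag.contDiffAt]
    simp [hu, hv]
  · push_cast
    refine (house_sum_le_sum_house _ _).trans ?_
    calc _ ≤ ∑ i ∈ Finset.range (k + 1), (B * A * k.factorial * ρ ^ k) * 2 ^ i := by
          refine Finset.sum_le_sum fun i hi => ?_
          have hik : i ≤ k := by simpa [Nat.lt_succ_iff] using hi
          have h1 : house ((k.choose i : K) * (u i : K) * (v (k - i) : K)) ≤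
              k.choose i * (A * i.factorial * (2 * ρ) ^ i) *
                (B * (k - i).factorial * ρ ^ (k - i)) := by
            refine (house_mul_le _ _).trans ?_
            refine mul_le_mul ?_ (hv' _) (house_nonneg _) (by positivity)
            rw [house_nat_mul]
            gcongr
            exact hu' i
          refine h1.trans (le_of_eq ?_)
          have h2 : ((k.choose i : ℝ) * i.factorial * (k - i).factorial) = k.factorial := by
            exact_mod_cast Nat.choose_mul_factorial_mul_factorial hik
          have h3 : ρ ^ k = ρ ^ i * ρ ^ (k - i) := by
            rw [← pow_add]; congr 1; omega
          rw [← h2, h3]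
          ring
      _ ≤ _ := by
          rw [← Finset.mul_sum]
          have h4 : ∑ i ∈ Finset.range (k + 1), (2 : ℝ) ^ i ≤ 2 * 2 ^ k := by
            have := geom_sum_eq (x := (2 : ℝ)) (by norm_num) (k + 1)
            rw [this]
            norm_num
            linarith [pow_succ (2 : ℝ) k]
          calc _ ≤ (B * A * k.factorial * ρ ^ k) * (2 * 2 ^ k) := by gcongr
            _ = _ := by ring

theorem mul_pow {f g : ℂ → ℂ} {A B ρ : ℝ} (hf : IntegralTaylor φ f A (2 * ρ))
    (hg : IntegralTaylor φ g B ρ) (hA : 0 ≤ A) (hB : 0 ≤ B) (hρ : 0 ≤ ρ) (af : AnalyticAt ℂ f 0)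
    (ag : AnalyticAt ℂ g 0) (j : ℕ) :
    IntegralTaylor φ (fun s => f s * g s ^ j) ((2 * B) ^ j * A) (2 * ρ) := by
  induction j with
  | zero => simpa using hf
  | succ j ih =>
    have := ih.mul hg (by positivity) hB hρ (af.mul (ag.pow j)) ag
    convert this using 1
    · ext s; ring
    · ring

theorem pow_mul_pow {f g : ℂ → ℂ} {B ρ : ℝ} (hf : IntegralTaylor φ f B ρ)
    (hg : IntegralTaylor φ g B ρ) (hB : 0 ≤ B) (hρ : 0 ≤ ρ) (af : AnalyticAt ℂ f 0)
    (ag : AnalyticAt ℂ g 0) (i j : ℕ) :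
    IntegralTaylor φ (fun s => f s ^ i * g s ^ j) ((2 * B) ^ (i + j)) (2 * ρ) := by
  have h1 := (one (φ := φ) (ρ := 2 * ρ) (by positivity)).mul_pow hf zero_le_one hB hρ
    analyticAt_const af i
  simp only [one_mul] at h1
  have h2 := h1.mul_pow hg (by positivity) hB hρ (af.pow i) ag j
  convert h2 using 1
  ring

end IntegralTaylor

theorem sum_succ_mul_sub (k : ℕ) :
    ∑ i ∈ Finset.range (k + 1), ((i : ℝ) + 1) * ((k - i : ℕ) + 1) =
      (k + 1) * (k + 2) * (k + 3) / 6 := by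
  have h (c : ℝ) (n : ℕ) : ∑ i ∈ Finset.range (n + 1), ((i : ℝ) + 1) * (c - i + 1) =
      (n + 1) * (n + 2) * (3 * c - 2 * n + 3) / 6 := by
    induction n with
    | zero => simp; ring
    | succ n ih => rw [Finset.sum_range_succ, ih]; push_cast; ring
  have := h k k
  rw [show ((k : ℝ) + 1) * (k + 2) * (k + 3) / 6 = (k + 1) * (k + 2) * (3 * k - 2 * k + 3) / 6 by
    ring, ← this]
  refine Finset.sum_congr rfl fun i hi => ?_
  rw [Nat.cast_sub (by simpa [Nat.lt_succ_iff] using hi)]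

/-- Taylor coefficients of a solution of `X'' = 6X² - g` with integral initial data. -/

theorem IntegralTaylor.of_ode {K : Type} [Field K] [NumberField K] {φ : K →+* ℂ} {X : ℂ → ℂ}
    (aX : AnalyticAt ℂ X 0) {g e y : 𝓞 K} (he : X 0 = φ e) (hy : deriv X 0 = φ y)
    (hX : ∀ᶠ s in 𝓝 0, deriv (deriv X) s = 6 * X s ^ 2 - φ g) :
    ∃ C ρ : ℝ, 1 ≤ C ∧ 1 ≤ ρ ∧ IntegralTaylor φ X C ρ := by
  set G : ℝ := house (g : K)
  have hG : 0 ≤ G := house_nonneg _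
  obtain ⟨C, hC⟩ : ∃ C : ℝ, C = 1 + house (e : K) + house (y : K) := ⟨_, rfl⟩
  obtain ⟨r, hr⟩ : ∃ r : ℝ, r = 1 + C + G := ⟨_, rfl⟩
  have he0 := house_nonneg (e : K)
  have hy0 := house_nonneg (y : K)
  have hC1 : 1 ≤ C := by linarith
  have hr1 : 1 ≤ r := by linarith
  have key : ∀ k : ℕ, ∃ u : 𝓞 K, φ u = iteratedDeriv k X 0 ∧
      house (u : K) ≤ C * k.factorial * (k + 1) * r ^ k := by
    intro k
    induction k using Nat.strong_induction_on with
    | _ k ih =>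
      rcases k with _ | _ | k
      · exact ⟨e, by simp [he], by simp; linarith⟩
      · refine ⟨y, by simp [iteratedDeriv_one, hy], ?_⟩
        simp
        nlinarith
      · have ih' : ∀ i, ∃ u : 𝓞 K, i < k + 2 → φ u = iteratedDeriv i X 0 ∧
            house (u : K) ≤ C * i.factorial * (i + 1) * r ^ i := fun i => by
          by_cases h : i < k + 2
          · obtain ⟨u, hu⟩ := ih i h
            exact ⟨u, fun _ => hu⟩
          · exact ⟨0, fun h' => absurd h' h⟩
        choose u hu using ih'
        refine ⟨6 * ∑ i ∈ Finset.range (k + 1), (k.choose i : 𝓞 K) * u i * u (k - i) -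
          if k = 0 then g else 0, ?_, ?_⟩
        · have h1 : iteratedDeriv (k + 2) X 0 = iteratedDeriv k (fun s => 6 * X s ^ 2 - φ g) 0 := by
            rw [iteratedDeriv_succ', iteratedDeriv_succ']
            exact Filter.EventuallyEq.iteratedDeriv_eq k hX
          have h2 : iteratedDeriv k (fun s => 6 * X s ^ 2 - φ g) 0 =
              6 * iteratedDeriv k (fun s => X s * X s) 0 - if k = 0 then φ g else 0 := by
            rw [iteratedDeriv_fun_sub, iteratedDeriv_const_mul_field, iteratedDeriv_const]
            · simp only [pow_two]
            · exact (analyticAt_const.mul (aX.pow 2)).contDiffAt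
            · exact contDiffAt_const
          rw [h1, h2, iteratedDeriv_fun_mul aX.contDiffAt aX.contDiffAt]
          have h3 : φ ((if k = 0 then g else 0 : 𝓞 K) : K) = if k = 0 then φ g else 0 := by
            split_ifs <;> simp
          push_cast
          rw [map_sub, h3, map_mul, map_sum]
          congr 2
          · exact (congrArg _ (map_ofNat (algebraMap (𝓞 K) K) 6)).trans (map_ofNat _ 6)
          · refine Finset.sum_congr rfl fun i hi => ?_
            have hik : i ≤ k := by simpa [Nat.lt_succ_iff] using hi
            rw [map_mul, map_mul, (hu i (by omega)).1, (hu (k - i) (by omega)).1, map_natCast]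
        · push_cast
          have h1 : house (6 * ∑ i ∈ Finset.range (k + 1), (k.choose i : K) * u i * u (k - i)) ≤
              6 * ∑ i ∈ Finset.range (k + 1), C ^ 2 * k.factorial * r ^ k *
                (((i : ℝ) + 1) * ((k - i : ℕ) + 1)) := by
            have : (6 : K) = ((6 : ℕ) : K) := by norm_num
            rw [this, house_nat_mul, Nat.cast_ofNat]
            gcongr
            refine (house_sum_le_sum_house _ _).trans ?_
            refine Finset.sum_le_sum fun i hi => ?_
            have hik : i ≤ k := by simpa [Nat.lt_succ_iff] using hi
            have h1 : house ((k.choose i : K) * (u i : K) * (u (k - i) : K)) ≤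
                k.choose i * (C * i.factorial * (i + 1) * r ^ i) *
                  (C * (k - i).factorial * ((k - i : ℕ) + 1) * r ^ (k - i)) := by
              refine (house_mul_le _ _).trans ?_
              refine mul_le_mul ?_ (hu _ (by omega)).2 (house_nonneg _) (by positivity)
              rw [house_nat_mul]
              gcongr
              exact (hu i (by omega)).2
            refine h1.trans (le_of_eq ?_)
            have h2 : ((k.choose i : ℝ) * i.factorial * (k - i).factorial) = k.factorial := by
              exact_mod_cast Nat.choose_mul_factorial_mul_factorial hik
            have h3 : r ^ k = r ^ i * r ^ (k - i) := by
              rw [← pow_add]; congr 1; omega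
            rw [← h2, h3]
            ring
          rw [← Finset.mul_sum, sum_succ_mul_sub] at h1
          have h2 : house (-((if k = 0 then g else 0 : 𝓞 K) : K)) ≤ G := by
            split_ifs
            · simp [house, G]
            · simpa [house] using hG
          have h3 := (house_add_le (6 * ∑ i ∈ Finset.range (k + 1),
            (k.choose i : K) * u i * u (k - i)) (-((if k = 0 then g else 0 : 𝓞 K) : K)))
          rw [sub_eq_add_neg]
          refine h3.trans ((add_le_add h1 h2).trans ?_)
          have hf : ((k + 2).factorial : ℝ) = (k + 2) * ((k + 1) * k.factorial) := by
            rw [Nat.factorial_succ, Nat.factorial_succ]; push_cast; ring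
          obtain ⟨F, hF⟩ : ∃ F : ℝ, F = ((k + 2).factorial : ℝ) * (k + 3) := ⟨_, rfl⟩
          have hF1 : 1 ≤ F := by
            have : (1 : ℝ) ≤ (k + 2).factorial := by exact_mod_cast Nat.factorial_pos _
            have h0 : (0 : ℝ) ≤ k := by positivity
            nlinarith
          have h4 : 6 * (C ^ 2 * k.factorial * r ^ k * ((k + 1) * (k + 2) * (k + 3) / 6)) =
              F * C ^ 2 * r ^ k := by rw [hF, hf]; ring
          have h5 : C * (k + 2).factorial * (((k + 2 : ℕ) : ℝ) + 1) * r ^ (k + 2) =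
              F * C * r ^ k * r ^ 2 := by rw [hF]; push_cast; ring
          have h6 : (1 : ℝ) ≤ r ^ k := one_le_pow₀ hr1
          have h7 : C + G ≤ r ^ 2 := by nlinarith
          have h8 : G ≤ F * C * r ^ k * G := by
            have : 1 ≤ F * C * r ^ k := one_le_mul_of_one_le_of_one_le
              (one_le_mul_of_one_le_of_one_le hF1 hC1) h6
            nlinarith
          have h9 : F * C * r ^ k * (C + G) ≤ F * C * r ^ k * r ^ 2 := by gcongr
          have h10 : (((k + 1 + 1 : ℕ) : ℝ) + 1) = (k : ℝ) + 1 + 1 + 1 := by push_cast; ring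
          rw [← h10]
          refine le_trans ?_ h5.ge
          rw [h4]
          nlinarith
  refine ⟨C, 2 * r, hC1, by linarith, fun k => ?_⟩
  obtain ⟨u, h1, h2⟩ := key k
  refine ⟨u, h1, h2.trans ?_⟩
  have : (k : ℝ) + 1 ≤ 2 ^ k := by
    exact_mod_cast Nat.lt_two_pow_self (n := k)
  rw [_root_.mul_pow]
  calc _ ≤ C * k.factorial * 2 ^ k * r ^ k := by gcongr
    _ = _ := by ring

theorem IntegralTaylor.of_deriv {K : Type} [Field K] [NumberField K] {φ : K →+* ℂ} {X Z : ℂ → ℂ}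
    {C ρ : ℝ} (hX : IntegralTaylor φ X C ρ) (hC : 1 ≤ C) (hρ : 1 ≤ ρ)
    (aX : AnalyticAt ℂ X 0) {t : 𝓞 K} (hZ0 : Z 0 = 0)
    (hZ : ∀ᶠ s in 𝓝 0, deriv Z s = φ t - X s) :
    IntegralTaylor φ Z (house (t : K) + C) ρ := by
  have ht := house_nonneg (t : K)
  intro k
  rcases k with _ | k
  · refine ⟨0, by simp [hZ0], ?_⟩
    have : house (0 : K) = 0 := by simp [house]
    simp only [map_zero, this]
    positivity
  · obtain ⟨u, h1, h2⟩ := hX k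
    refine ⟨(if k = 0 then t else 0) - u, ?_, ?_⟩
    · rw [iteratedDeriv_succ', Filter.EventuallyEq.iteratedDeriv_eq k hZ, iteratedDeriv_fun_sub
        contDiffAt_const aX.contDiffAt, iteratedDeriv_const]
      push_cast
      rw [map_sub, h1]
      split_ifs <;> simp
    · push_cast
      rw [sub_eq_add_neg]
      refine (house_add_le _ _).trans ?_
      have h3 : house (-(u : K)) ≤ C * k.factorial * ρ ^ k := by simpa [house] using h2
      have h4 : house ((if k = 0 then t else 0 : 𝓞 K) : K) ≤ house (t : K) := by
        split_ifs
        · exact le_rfl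
        · simp [house]
      have h5 : (k.factorial : ℝ) ≤ (k + 1).factorial := by
        exact_mod_cast Nat.factorial_le (Nat.le_succ k)
      have h6 : ρ ^ k ≤ ρ ^ (k + 1) := pow_le_pow_right₀ hρ (Nat.le_succ k)
      have h7 : 1 ≤ ((k + 1).factorial : ℝ) * ρ ^ (k + 1) := one_le_mul_of_one_le_of_one_le
        (by exact_mod_cast Nat.factorial_pos _) (one_le_pow₀ hρ)
      have h8 : C * k.factorial * ρ ^ k ≤ C * (k + 1).factorial * ρ ^ (k + 1) := by gcongr
      nlinarith

/-- Entire functions `T`, `U`, `V` such that `X = U / T` and `Z = V / T` solve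
`X'' = 6X² - g`, `Z' = t - X`, `X` is doubly periodic with periods `ϖ i` and `Z` is quasi-periodic
with quasi-periods `κ i`. -/
structure LeafCurve (T U V : ℂ → ℂ) (ϖ κ : Fin 2 → ℂ) (g t e y : ℂ) : Prop where
  differentiable_T : Differentiable ℂ T
  differentiable_U : Differentiable ℂ U
  differentiable_V : Differentiable ℂ V
  T_zero : T 0 ≠ 0
  translate : ∀ i, ∃ a b : ℂ, ∀ s, T (s + ϖ i) = exp (a * s + b) * T s ∧
    U (s + ϖ i) = exp (a * s + b) * U s ∧
    V (s + ϖ i) = exp (a * s + b) * (V s + κ i * T s)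
  growth : ∃ C : ℝ, ∀ s, ‖T s‖ ≤ Real.exp (C * (1 + ‖s‖ ^ 2)) ∧
    ‖U s‖ ≤ Real.exp (C * (1 + ‖s‖ ^ 2)) ∧ ‖V s‖ ≤ Real.exp (C * (1 + ‖s‖ ^ 2))
  V_zero : V 0 = 0
  X_zero : U 0 / T 0 = e
  deriv_X_zero : deriv (fun s => U s / T s) 0 = y
  deriv_deriv_X : ∀ᶠ s in 𝓝 0,
    deriv (deriv fun s => U s / T s) s = 6 * (U s / T s) ^ 2 - g
  deriv_Z : ∀ᶠ s in 𝓝 0, deriv (fun s => V s / T s) s = t - U s / T s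

/-- The entire function `T ^ (2L) X ^ a Z ^ j`. -/
def auxMon (T U V : ℂ → ℂ) (L a j : ℕ) (s : ℂ) : ℂ := U s ^ a * V s ^ j * T s ^ (2 * L - a - j)

/-- The entire function `(T T') ^ (2L) ∑ p_{abc} X ^ a X' ^ b (Z - Z') ^ c`, expanded as a sum of
products of functions of one variable. -/
noncomputable def auxFun (T U V T' U' V' : ℂ → ℂ) (L : ℕ) (p : Fin L × Fin L × Fin L → ℂ)
    (x : ℂ × ℂ) : ℂ :=
  ∑ i ∈ (Finset.univ : Finset (Fin L × Fin L × Fin L)) ×ˢ Finset.range L,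
    (p i.1 * ((i.1.2.2 : ℕ).choose i.2 * (-1) ^ ((i.1.2.2 : ℕ) - i.2))) *
      (auxMon T U V L i.1.1 i.2 x.1 * auxMon T' U' V' L i.1.2.1 (i.1.2.2 - i.2) x.2)

section

variable {T U V T' U' V' : ℂ → ℂ} {ϖ κ ϖ' : Fin 2 → ℂ} {g t e y g' t' e' y' : ℂ}

theorem sum_choose_mul (L c : ℕ) (hc : c < L) (u v : ℂ) :
    ∑ j ∈ Finset.range L, ((c.choose j : ℂ) * (-1) ^ (c - j)) * (u ^ j * v ^ (c - j)) =
      (u - v) ^ c := by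
  rw [sub_eq_add_neg, add_pow]
  rw [← Finset.sum_subset (Finset.range_mono (by omega : c + 1 ≤ L))]
  · refine Finset.sum_congr rfl fun j _ => ?_
    rw [neg_pow v]
    ring
  · intro j _ hj
    rw [Nat.choose_eq_zero_of_lt (by simpa using hj)]
    simp

theorem auxFun_eq (L : ℕ) (p : Fin L × Fin L × Fin L → ℂ) (x : ℂ × ℂ) :
    auxFun T U V T' U' V' L p x = ∑ l : Fin L × Fin L × Fin L,
      p l * (U x.1 ^ (l.1 : ℕ) * U' x.2 ^ (l.2.1 : ℕ) *
        (V x.1 * T' x.2 - V' x.2 * T x.1) ^ (l.2.2 : ℕ) * T x.1 ^ (2 * L - l.1 - l.2.2) *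
        T' x.2 ^ (2 * L - l.2.1 - l.2.2)) := by
  unfold auxFun
  rw [Finset.sum_product]
  refine Finset.sum_congr rfl fun l _ => ?_
  obtain ⟨⟨a, ha⟩, ⟨b, hb⟩, c, hc⟩ := l
  simp only
  rw [← sum_choose_mul L c hc, Finset.mul_sum, Finset.sum_mul, Finset.sum_mul, Finset.mul_sum]
  refine Finset.sum_congr rfl fun j _ => ?_
  by_cases hj : j ≤ c
  · unfold auxMon
    rw [show 2 * L - a - j = (c - j) + (2 * L - a - c) by omega,
      show 2 * L - b - (c - j) = j + (2 * L - b - c) by omega]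
    ring
  · rw [Nat.choose_eq_zero_of_lt (by omega)]
    simp

theorem LeafCurve.differentiable_auxMon (h : LeafCurve T U V ϖ κ g t e y) (L a j : ℕ) :
    Differentiable ℂ (auxMon T U V L a j) :=
  ((h.differentiable_U.pow a).mul (h.differentiable_V.pow j)).mul (h.differentiable_T.pow _)

theorem contDiff_auxFun (h : LeafCurve T U V ϖ κ g t e y) (h' : LeafCurve T' U' V' ϖ' κ g' t' e' y')
    (L : ℕ) (p : Fin L × Fin L × Fin L → ℂ) : ContDiff ℂ ∞ (auxFun T U V T' U' V' L p) := by
  unfold auxFun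
  refine ContDiff.sum fun i _ => contDiff_const.mul (ContDiff.mul ?_ ?_)
  · exact (h.differentiable_auxMon _ _ _).contDiff.comp contDiff_fst
  · exact (h'.differentiable_auxMon _ _ _).contDiff.comp contDiff_snd

theorem auxFun_translate (h : LeafCurve T U V ϖ κ g t e y)
    (h' : LeafCurve T' U' V' ϖ' κ g' t' e' y') (L : ℕ) (p : Fin L × Fin L × Fin L → ℂ) (i : Fin 2) :
    ∃ α β γ : ℂ, ∀ x, auxFun T U V T' U' V' L p (x + (ϖ i, ϖ' i)) =
      exp (α * x.1 + β * x.2 + γ) * auxFun T U V T' U' V' L p x := by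
  obtain ⟨a, b, hab⟩ := h.translate i
  obtain ⟨a', b', hab'⟩ := h'.translate i
  refine ⟨(2 * L : ℕ) * a, (2 * L : ℕ) * a', (2 * L : ℕ) * (b + b'), fun x => ?_⟩
  have hE : exp ((2 * L : ℕ) * a * x.1 + (2 * L : ℕ) * a' * x.2 + (2 * L : ℕ) * (b + b')) =
      exp (a * x.1 + b) ^ (2 * L) * exp (a' * x.2 + b') ^ (2 * L) := by
    rw [← Complex.exp_nat_mul, ← Complex.exp_nat_mul, ← Complex.exp_add]
    congr 1
    ring
  rw [hE, auxFun_eq, auxFun_eq, Finset.mul_sum]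
  refine Finset.sum_congr rfl fun l _ => ?_
  obtain ⟨⟨a, ha⟩, ⟨b, hb⟩, c, hc⟩ := l
  simp only [Prod.fst_add, Prod.snd_add, hab, hab']
  generalize exp _ = E
  generalize exp _ = E'
  have h1 : E ^ (2 * L) = E ^ a * E ^ c * E ^ (2 * L - a - c) := by
    rw [← pow_add, ← pow_add]; congr 1; omega
  have h2 : E' ^ (2 * L) = E' ^ b * E' ^ c * E' ^ (2 * L - b - c) := by
    rw [← pow_add, ← pow_add]; congr 1; omega
  have h3 : E * (V x.1 + κ i * T x.1) * (E' * T' x.2) -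
      E' * (V' x.2 + κ i * T' x.2) * (E * T x.1) =
      E * E' * (V x.1 * T' x.2 - V' x.2 * T x.1) := by ring
  rw [h3, h1, h2]
  simp only [mul_pow]
  ring

theorem norm_auxFun_le (L : ℕ) (p : Fin L × Fin L × Fin L → ℂ) {P M : ℝ} (hp : ∀ l, ‖p l‖ ≤ P)
    (hM : 1 ≤ M) {x : ℂ × ℂ} (hT : ‖T x.1‖ ≤ M) (hU : ‖U x.1‖ ≤ M) (hV : ‖V x.1‖ ≤ M)
    (hT' : ‖T' x.2‖ ≤ M) (hU' : ‖U' x.2‖ ≤ M) (hV' : ‖V' x.2‖ ≤ M) :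
    ‖auxFun T U V T' U' V' L p x‖ ≤ L ^ 3 * (P * (2 ^ L * M ^ (4 * L))) := by
  rw [auxFun_eq]
  refine (norm_sum_le _ _).trans ?_
  calc _ ≤ ∑ l : Fin L × Fin L × Fin L, P * (2 ^ L * M ^ (4 * L)) := by
        refine Finset.sum_le_sum fun l _ => ?_
        obtain ⟨⟨a, ha⟩, ⟨b, hb⟩, c, hc⟩ := l
        simp only [norm_mul, norm_pow]
        have hW : ‖V x.1 * T' x.2 - V' x.2 * T x.1‖ ≤ 2 * (M * M) := by
          refine (norm_sub_le _ _).trans ?_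
          rw [norm_mul, norm_mul, two_mul]
          gcongr
        have hP : 0 ≤ P := (norm_nonneg _).trans (hp (⟨a, ha⟩, ⟨b, hb⟩, ⟨c, hc⟩))
        refine mul_le_mul (hp _) ?_ (by positivity) hP
        calc _ ≤ M ^ a * M ^ b * (2 * (M * M)) ^ c * M ^ (2 * L - a - c) * M ^ (2 * L - b - c) := by
              gcongr
          _ = 2 ^ c * M ^ (4 * L) := by
              rw [show 4 * L = a + b + (c + c) + (2 * L - a - c) + (2 * L - b - c) by omega]
              simp only [pow_add, mul_pow]
              ring
          _ ≤ 2 ^ L * M ^ (4 * L) := by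
              gcongr
              norm_num
    _ = _ := by
        simp only [Finset.sum_const, Finset.card_univ, Fintype.card_prod, Fintype.card_fin,
          nsmul_eq_mul]
        push_cast
        ring

end

theorem eq_zero_of_sum_mul_pow_eq_zero {L : ℕ} {q : Fin L → ℂ} {S : Set ℂ} (hS : S.Infinite)
    (h : ∀ x ∈ S, ∑ a, q a * x ^ (a : ℕ) = 0) (a : Fin L) : q a = 0 := by
  set P : Polynomial ℂ := ∑ a : Fin L, Polynomial.monomial (a : ℕ) (q a) with hP
  have hP0 : P = 0 := by
    refine Polynomial.eq_zero_of_infinite_isRoot P (hS.mono fun x hx => ?_)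
    simpa [hP, Polynomial.eval_finsetSum, Polynomial.IsRoot.def] using h x hx
  have h1 : P.coeff a = q a := by
    rw [hP, Polynomial.finsetSum_coeff]
    simp [Polynomial.coeff_monomial, Fin.val_inj]
  rw [← h1, hP0, Polynomial.coeff_zero]

section

variable {T U V T' U' V' : ℂ → ℂ} {ϖ κ ϖ' : Fin 2 → ℂ} {g t e y g' t' e' y' : ℂ}

theorem LeafCurve.translate_nat (h : LeafCurve T U V ϖ κ g t e y) (i : Fin 2) (s : ℂ) (m : ℕ) :
    ∃ E : ℂ, E ≠ 0 ∧ T (s + m * ϖ i) = E * T s ∧ U (s + m * ϖ i) = E * U s ∧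
      V (s + m * ϖ i) = E * (V s + m * κ i * T s) := by
  obtain ⟨a, b, hab⟩ := h.translate i
  induction m with
  | zero => exact ⟨1, one_ne_zero, by simp⟩
  | succ m ih =>
    obtain ⟨E, hE, h1, h2, h3⟩ := ih
    refine ⟨exp (a * (s + m * ϖ i) + b) * E, mul_ne_zero (exp_ne_zero _) hE, ?_, ?_, ?_⟩ <;>
      rw [show s + ((m + 1 : ℕ) : ℂ) * ϖ i = (s + m * ϖ i) + ϖ i by push_cast; ring]
    · rw [(hab _).1, h1]; ring
    · rw [(hab _).2.1, h2]; ring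
    · rw [(hab _).2.2, h3, h1]; push_cast; ring

theorem LeafCurve.eventually_T_ne_zero (h : LeafCurve T U V ϖ κ g t e y) :
    ∀ᶠ s in 𝓝 0, T s ≠ 0 :=
  h.differentiable_T.continuous.continuousAt.eventually_ne h.T_zero

theorem LeafCurve.analyticAt_X (h : LeafCurve T U V ϖ κ g t e y) :
    AnalyticAt ℂ (fun s => U s / T s) 0 :=
  (h.differentiable_U.analyticAt 0).div (h.differentiable_T.analyticAt 0) h.T_zero

theorem LeafCurve.analyticAt_Z (h : LeafCurve T U V ϖ κ g t e y) :
    AnalyticAt ℂ (fun s => V s / T s) 0 :=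
  (h.differentiable_V.analyticAt 0).div (h.differentiable_T.analyticAt 0) h.T_zero

theorem LeafCurve.infinite_X (h : LeafCurve T U V ϖ κ g t e y) (hy : y ≠ 0) :
    {x : ℂ | ∃ s, T s ≠ 0 ∧ U s / T s = x}.Infinite := by
  have h1 : HasStrictDerivAt (fun s => U s / T s) y 0 := by
    have := h.analyticAt_X.hasStrictDerivAt
    rwa [h.deriv_X_zero] at this
  have h2 := h1.map_nhds_eq hy
  have h3 : {x : ℂ | ∃ s, T s ≠ 0 ∧ U s / T s = x} ∈ 𝓝 (U 0 / T 0) := by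
    rw [← h2, Filter.mem_map]
    filter_upwards [h.eventually_T_ne_zero] with s hs
    exact ⟨s, hs, rfl⟩
  exact infinite_of_mem_nhds _ h3

theorem eq_zero_of_auxFun_eq_zero (h : LeafCurve T U V ϖ κ g t e y)
    (h' : LeafCurve T' U' V' ϖ' κ g' t' e' y') (hy : y ≠ 0) (hy' : y' ≠ 0) (hκ : κ ≠ 0) {L : ℕ}
    {p : Fin L × Fin L × Fin L → ℂ} (hp : ∀ x, auxFun T U V T' U' V' L p x = 0) : p = 0 := by
  obtain ⟨i, hi⟩ := Function.ne_iff.mp hκ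
  rw [Pi.zero_apply] at hi
  have key : ∀ s s', T s ≠ 0 → T' s' ≠ 0 → ∀ m : ℕ,
      ∑ c : Fin L, (∑ a : Fin L, (∑ b : Fin L, p (a, b, c) * (U' s' / T' s') ^ (b : ℕ)) *
        (U s / T s) ^ (a : ℕ)) * (V s / T s - V' s' / T' s' + m * κ i) ^ (c : ℕ) = 0 := by
    intro s s' hs hs' m
    obtain ⟨E, hE, h1, h2, h3⟩ := h.translate_nat i s m
    have h4 := hp (s + m * ϖ i, s')
    rw [auxFun_eq] at h4
    simp only [h1, h2, h3] at h4
    have h5 : (E * T s) ^ (2 * L) * T' s' ^ (2 * L) * ∑ c : Fin L, (∑ a : Fin L,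
        (∑ b : Fin L, p (a, b, c) * (U' s' / T' s') ^ (b : ℕ)) *
        (U s / T s) ^ (a : ℕ)) * (V s / T s - V' s' / T' s' + m * κ i) ^ (c : ℕ) = 0 := by
      rw [← h4, Fintype.sum_prod_type]
      simp only [Fintype.sum_prod_type, Finset.sum_mul]
      rw [Finset.sum_comm, Finset.mul_sum]
      refine Finset.sum_congr rfl fun a _ => ?_
      rw [Finset.sum_comm, Finset.mul_sum]
      refine Finset.sum_congr rfl fun b _ => ?_
      rw [Finset.mul_sum]
      refine Finset.sum_congr rfl fun c _ => ?_
      have ha := a.2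
      have hb := b.2
      have hc := c.2
      rw [show E * (V s + m * κ i * T s) * T' s' - V' s' * (E * T s) =
        E * T s * T' s' * (V s / T s - V' s' / T' s' + m * κ i) by
          field_simp
          ring,
        show E * U s = E * T s * (U s / T s) by field_simp,
        show U' s' = T' s' * (U' s' / T' s') by field_simp]
      have h1 : (E * T s) ^ (2 * L) = (E * T s) ^ (a : ℕ) * (E * T s) ^ (c : ℕ) *
          (E * T s) ^ (2 * L - a - c) := by
        rw [← pow_add, ← pow_add]; congr 1; omega
      have h2 : T' s' ^ (2 * L) = T' s' ^ (b : ℕ) * T' s' ^ (c : ℕ) *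
          T' s' ^ (2 * L - b - c) := by
        rw [← pow_add, ← pow_add]; congr 1; omega
      rw [h1, h2, mul_div_cancel_left₀ _ hs']
      generalize V s / T s - V' s' / T' s' + m * κ i = Q
      generalize U s / T s = x
      generalize U' s' / T' s' = x'
      simp only [mul_pow]
      ring
    exact (mul_eq_zero.mp h5).resolve_left
      (mul_ne_zero (pow_ne_zero _ (mul_ne_zero hE hs)) (pow_ne_zero _ hs'))
  funext ⟨a, b, c⟩
  refine eq_zero_of_sum_mul_pow_eq_zero (q := fun b => p (a, b, c)) (h'.infinite_X hy') ?_ b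
  rintro _ ⟨s', hs', rfl⟩
  refine eq_zero_of_sum_mul_pow_eq_zero (q := fun a => ∑ b : Fin L, p (a, b, c) *
    (U' s' / T' s') ^ (b : ℕ)) (h.infinite_X hy) ?_ a
  rintro _ ⟨s, hs, rfl⟩
  refine eq_zero_of_sum_mul_pow_eq_zero (S := Set.range fun m : ℕ =>
    V s / T s - V' s' / T' s' + m * κ i) (q := fun c => ∑ a : Fin L, (∑ b : Fin L, p (a, b, c) *
    (U' s' / T' s') ^ (b : ℕ)) * (U s / T s) ^ (a : ℕ)) (Set.infinite_range_of_injective ?_) ?_ c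
  · intro m n hmn
    simpa [hi] using hmn
  · rintro _ ⟨m, rfl⟩
    exact key s s' hs hs' m

end

section

variable {T U V T' U' V' : ℂ → ℂ} {ϖ κ ϖ' : Fin 2 → ℂ} {K : Type} [Field K] [NumberField K]
  {φ : K →+* ℂ}

theorem LeafCurve.exists_integralTaylor {g t e y : 𝓞 K}
    (h : LeafCurve T U V ϖ κ (φ g) (φ t) (φ e) (φ y)) :
    ∃ C ρ : ℝ, 1 ≤ C ∧ 1 ≤ ρ ∧ IntegralTaylor φ (fun s => U s / T s) C ρ ∧
      IntegralTaylor φ (fun s => V s / T s) C ρ := by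
  obtain ⟨C, ρ, hC, hρ, hX⟩ := IntegralTaylor.of_ode h.analyticAt_X h.X_zero h.deriv_X_zero
    h.deriv_deriv_X
  have hZ := IntegralTaylor.of_deriv hX hC hρ h.analyticAt_X (Z := fun s => V s / T s)
    (by simp [h.V_zero]) h.deriv_Z
  have ht := house_nonneg (t : K)
  exact ⟨house (t : K) + C, ρ, by linarith, hρ,
    hX.mono (by linarith) (by linarith) (by linarith) le_rfl, hZ⟩

/-- Taylor coefficients of the monomials `X ^ a * Z ^ j`, as algebraic integers of controlled
house. -/
def IsTaylorTable (φ : K →+* ℂ) (T U V : ℂ → ℂ) (C ρ : ℝ) (α : ℕ → ℕ → ℕ → 𝓞 K) : Prop :=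
  ∀ a j k, φ (α a j k) = iteratedDeriv k (fun s => (U s / T s) ^ a * (V s / T s) ^ j) 0 ∧
    house (α a j k : K) ≤ C ^ (a + j) * k.factorial * ρ ^ k

theorem LeafCurve.exists_isTaylorTable {g t e y g' t' e' y' : 𝓞 K}
    (h : LeafCurve T U V ϖ κ (φ g) (φ t) (φ e) (φ y))
    (h' : LeafCurve T' U' V' ϖ' κ (φ g') (φ t') (φ e') (φ y')) :
    ∃ C ρ : ℝ, 1 ≤ C ∧ 1 ≤ ρ ∧ ∃ α β, IsTaylorTable φ T U V C ρ α ∧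
      IsTaylorTable φ T' U' V' C ρ β := by
  obtain ⟨C, ρ, hC, hρ, hX, hZ⟩ := h.exists_integralTaylor
  obtain ⟨C', ρ', hC', hρ', hX', hZ'⟩ := h'.exists_integralTaylor
  have h1 : 0 ≤ C := by linarith
  have h2 : 0 ≤ C' := by linarith
  have h3 : 0 ≤ ρ := by linarith
  have h4 : 0 ≤ ρ' := by linarith
  have hM := fun a j => (hX.mono h1 h3 (by linarith : C ≤ C + C')
    (by linarith : ρ ≤ ρ + ρ')).pow_mul_pow (hZ.mono h1 h3 (by linarith : C ≤ C + C')
    (by linarith : ρ ≤ ρ + ρ')) (by linarith) (by linarith) h.analyticAt_X h.analyticAt_Z a j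
  have hM' := fun a j => (hX'.mono h2 h4 (by linarith : C' ≤ C + C')
    (by linarith : ρ' ≤ ρ + ρ')).pow_mul_pow (hZ'.mono h2 h4 (by linarith : C' ≤ C + C')
    (by linarith : ρ' ≤ ρ + ρ')) (by linarith) (by linarith) h'.analyticAt_X h'.analyticAt_Z a j
  choose α hα using hM
  choose β hβ using hM'
  exact ⟨2 * (C + C'), 2 * (ρ + ρ'), by linarith, by linarith, α, β, hα, hβ⟩

/-- The coefficient of the `l`-th unknown in the `(k, k')`-th derivative at the origin of
`∑ p_{abc} X ^ a X' ^ b (Z - Z') ^ c`. -/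
def siegelEntry (α β : ℕ → ℕ → ℕ → 𝓞 K) (L k k' : ℕ) (l : Fin L × Fin L × Fin L) : 𝓞 K :=
  ∑ j ∈ Finset.range L, ((l.2.2 : ℕ).choose j * (-1) ^ ((l.2.2 : ℕ) - j)) *
    (α l.1 j k * β l.2.1 (l.2.2 - j) k')

theorem house_siegelEntry_le {C ρ : ℝ} {α β : ℕ → ℕ → ℕ → 𝓞 K} (hC : 1 ≤ C) (hρ : 1 ≤ ρ)
    (hα : IsTaylorTable φ T U V C ρ α) (hβ : IsTaylorTable φ T' U' V' C ρ β) {L k k' N : ℕ}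
    (hN : k + k' ≤ N) (l : Fin L × Fin L × Fin L) :
    house (siegelEntry α β L k k' l : K) ≤ L * (2 ^ L * (C ^ (4 * L) * N.factorial * ρ ^ N)) := by
  obtain ⟨⟨a, ha⟩, ⟨b, hb⟩, c, hc⟩ := l
  unfold siegelEntry
  push_cast
  refine (house_sum_le_sum_house _ _).trans ?_
  calc _ ≤ ∑ j ∈ Finset.range L, 2 ^ L * (C ^ (4 * L) * N.factorial * ρ ^ N) := by
        refine Finset.sum_le_sum fun j hj => ?_
        have hj := Finset.mem_range.mp hj
        have hsign : (-1 : K) ^ (c - j) * ((α a j k : K) * β b (c - j) k') =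
          (((-1 : ℤ) ^ (c - j) : ℤ) : K) * ((α a j k : K) * β b (c - j) k') := by push_cast; rfl
        rw [mul_assoc, house_nat_mul, hsign]
        have h1 : house ((((-1 : ℤ) ^ (c - j) : ℤ) : K)) = 1 := by
          rw [house_intCast]; simp
        have h2 : ((c.choose j : ℕ) : ℝ) ≤ 2 ^ L := by
          have := (Nat.choose_le_two_pow c j).trans (Nat.pow_le_pow_right two_pos hc.le)
          exact_mod_cast this
        have h3 : k.factorial * k'.factorial ≤ N.factorial :=
          (Nat.le_of_dvd (Nat.factorial_pos _) (Nat.factorial_mul_factorial_dvd_factorial_add k k')).trans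
            (Nat.factorial_le hN)
        have h3' : (k.factorial * k'.factorial : ℝ) ≤ N.factorial := by exact_mod_cast h3
        refine mul_le_mul h2 ?_ (house_nonneg _) (by positivity)
        refine (house_mul_le _ _).trans ?_
        rw [h1, one_mul]
        refine (house_mul_le _ _).trans ?_
        calc _ ≤ (C ^ (a + j) * k.factorial * ρ ^ k) *
              (C ^ (b + (c - j)) * k'.factorial * ρ ^ k') :=
              mul_le_mul (hα _ _ _).2 (hβ _ _ _).2 (house_nonneg _) (by positivity)
          _ = C ^ (a + j + (b + (c - j))) * (k.factorial * k'.factorial) * ρ ^ (k + k') := by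
              rw [pow_add C, pow_add ρ]; ring
          _ ≤ _ := by
              have : a + j + (b + (c - j)) ≤ 4 * L := by omega
              gcongr
    _ = _ := by simp

theorem LeafCurve.iteratedDeriv_auxMon {g t e y : ℂ} (h : LeafCurve T U V ϖ κ g t e y)
    {C ρ : ℝ} {α : ℕ → ℕ → ℕ → 𝓞 K} (hα : IsTaylorTable φ T U V C ρ α) {L a j : ℕ}
    (haj : a + j ≤ 2 * L) (k : ℕ) : iteratedDeriv k (auxMon T U V L a j) 0 =
      ∑ i ∈ Finset.range (k + 1), k.choose i * iteratedDeriv i (fun s => T s ^ (2 * L)) 0 *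
        φ (α a j (k - i)) := by
  have h1 : auxMon T U V L a j =ᶠ[𝓝 0]
      fun s => T s ^ (2 * L) * ((U s / T s) ^ a * (V s / T s) ^ j) := by
    filter_upwards [h.eventually_T_ne_zero] with s hs
    unfold auxMon
    rw [show 2 * L = a + j + (2 * L - a - j) by omega, pow_add, pow_add,
      show a + j + (2 * L - a - j) - a - j = 2 * L - a - j by omega, div_pow, div_pow]
    field_simp
  rw [h1.iteratedDeriv_eq k, iteratedDeriv_fun_mul]
  · exact Finset.sum_congr rfl fun i _ => by rw [(hα a j (k - i)).1]
  · exact (h.differentiable_T.pow _).contDiff.contDiffAt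
  · exact ((h.analyticAt_X.pow a).mul (h.analyticAt_Z.pow j)).contDiffAt

theorem iterate_dirDeriv_auxFun {g t e y g' t' e' y' : ℂ} (h : LeafCurve T U V ϖ κ g t e y)
    (h' : LeafCurve T' U' V' ϖ' κ g' t' e' y') {C ρ : ℝ} {α β : ℕ → ℕ → ℕ → 𝓞 K}
    (hα : IsTaylorTable φ T U V C ρ α) (hβ : IsTaylorTable φ T' U' V' C ρ β) {L : ℕ}
    (ξ : Fin L × Fin L × Fin L → 𝓞 K) (k k' : ℕ) :
    (dirDeriv (1, 0))^[k] ((dirDeriv (0, 1))^[k']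
      (auxFun T U V T' U' V' L fun l => φ (ξ l))) 0 =
    ∑ i ∈ Finset.range (k + 1), ∑ i' ∈ Finset.range (k' + 1),
      (k.choose i * iteratedDeriv i (fun s => T s ^ (2 * L)) 0) *
      (k'.choose i' * iteratedDeriv i' (fun s => T' s ^ (2 * L)) 0) *
      φ (∑ l, siegelEntry α β L (k - i) (k' - i') l * ξ l : 𝓞 K) := by
  unfold auxFun
  rw [iterate_dirDeriv_sum_mul (ι := (Fin L × Fin L × Fin L) × ℕ)
    (f := fun i => auxMon T U V L i.1.1 i.2)
    (g := fun i => auxMon T' U' V' L i.1.2.1 (i.1.2.2 - i.2))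
    (q := fun i => φ (ξ i.1) * ((i.1.2.2 : ℕ).choose i.2 * (-1) ^ ((i.1.2.2 : ℕ) - i.2)))
    _ (fun i => h.differentiable_auxMon _ _ _)
    (fun i => h'.differentiable_auxMon _ _ _)]
  simp only [Prod.fst_zero, Prod.snd_zero, siegelEntry]
  push_cast
  simp only [map_sum, map_mul, map_pow, map_neg, map_one, map_natCast, Finset.mul_sum,
    Finset.sum_mul]
  rw [Finset.sum_product]
  rw [Finset.sum_congr rfl fun l _ => Finset.sum_congr rfl fun j hj => by
    rw [h.iteratedDeriv_auxMon hα (by have := Finset.mem_range.mp hj; omega),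
      h'.iteratedDeriv_auxMon hβ (by omega), Finset.sum_mul_sum, Finset.mul_sum]]
  simp only [Finset.mul_sum]
  rw [Finset.sum_congr rfl fun l _ => Finset.sum_comm, Finset.sum_comm]
  refine Finset.sum_congr rfl fun i _ => ?_
  rw [Finset.sum_congr rfl fun l _ => Finset.sum_comm, Finset.sum_comm]
  refine Finset.sum_congr rfl fun i' _ => Finset.sum_congr rfl fun l _ =>
    Finset.sum_congr rfl fun j _ => ?_
  ring

end

theorem exists_forall_pow_lt_two_pow (Q : ℕ) : ∃ R₀ : ℕ, ∀ R ≥ R₀, ((R : ℝ) + 2) ^ Q < 2 ^ R := by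
  have h1 := (tendsto_pow_const_div_const_pow_of_one_lt Q (one_lt_two (α := ℝ))).eventually_lt_const
    (show (0 : ℝ) < 1 / 4 by norm_num)
  obtain ⟨N, hN⟩ := Filter.eventually_atTop.mp h1
  refine ⟨N, fun R hR => ?_⟩
  have h2 := hN (R + 2) (by omega)
  rw [div_lt_iff₀ (by positivity)] at h2
  push_cast at h2
  rw [pow_add] at h2
  linarith

/-- Bound for the houses of the entries of the linear system. -/
noncomputable def entryBound (C ρ : ℝ) (L N : ℕ) : ℝ :=
  L * (2 ^ L * (C ^ (4 * L) * N.factorial * ρ ^ N))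

theorem exists_two_pow_lt (c C ρ A δ μ : ℝ) : ∃ k : ℕ, c ≤ 2 ^ k ∧ C ≤ 2 ^ k ∧ ρ ≤ 2 ^ k ∧
    A ≤ 2 ^ k ∧ δ ≤ 2 ^ k ∧ μ ≤ 2 ^ k := by
  have h := fun x : ℝ => ((tendsto_pow_atTop_atTop_of_one_lt (one_lt_two (α := ℝ))).eventually_ge_atTop
    x)
  exact ((h c).and <| (h C).and <| (h ρ).and <| (h A).and <| (h δ).and (h μ)).exists

theorem exists_parameters {c C ρ A δ μ : ℝ} (hc : 0 ≤ c) (hC : 0 ≤ C) (hρ : 0 ≤ ρ) (hA : 0 ≤ A)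
    (hδ : 0 < δ) (h : ℕ) : ∃ n : ℕ, 1 ≤ n ∧ ∀ T : ℕ, 2 * n ^ 3 ≤ T → ∃ R : ℕ, 1 ≤ R ∧
      ∀ L : ℕ, L = 2 * n ^ 2 → ∀ P, P = c * L ^ 3 * entryBound C ρ L (4 * n ^ 3) →
      (L ^ 3 * (entryBound C ρ L T * P)) ^ h *
        (A ^ T * (T.factorial * (L ^ 3 * (P * (2 ^ L * Real.exp (μ * R ^ 2) ^ (4 * L)))))) <
      δ ^ (2 * L) * 2 ^ (R * T) := by
  obtain ⟨k, hkc, hkC, hkρ, hkA, hkδ, hkμ⟩ := exists_two_pow_lt c C ρ A δ⁻¹ (Real.exp μ)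
  obtain ⟨R₀, hR₀⟩ := exists_forall_pow_lt_two_pow
    (7 * (h * (12 * k + 15) + (14 * k + 14)))
  refine ⟨(R₀ + 1) ^ 2, Nat.one_le_pow _ _ (by omega), fun T hT => ?_⟩
  set n := (R₀ + 1) ^ 2 with hn
  have hn1 : 1 ≤ n := Nat.one_le_pow _ _ (by omega)
  obtain ⟨m, hm⟩ : ∃ m, m = Nat.findGreatest (fun m => 2 * m ^ 3 ≤ T) T := ⟨_, rfl⟩
  have hnT : n ≤ T := by nlinarith [Nat.le_self_pow (n := 3) (by norm_num) n]
  have hmn : n ≤ m := hm ▸ Nat.le_findGreatest hnT hT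
  have hm1 : 2 * m ^ 3 ≤ T := by
    rw [hm]; exact Nat.findGreatest_spec (P := fun m => 2 * m ^ 3 ≤ T) hnT hT
  have hm2 : T < 2 * (m + 1) ^ 3 := by
    by_contra! hlt
    have h1 : m + 1 ≤ T := by nlinarith [Nat.le_self_pow (n := 3) (by norm_num) (m + 1)]
    have := Nat.le_findGreatest (P := fun m => 2 * m ^ 3 ≤ T) h1 hlt
    omega
  set R := Nat.sqrt m with hR
  have hRR : R₀ + 1 ≤ R := Nat.le_sqrt'.mpr (by rw [← hn]; exact hmn)
  refine ⟨R, by omega, ?_⟩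
  rintro L hL P rfl
  have hRm : R ^ 2 ≤ m := Nat.sqrt_le' m
  have hmR : m + 1 ≤ (R + 1) ^ 2 := Nat.lt_succ_sqrt' m
  have hLR : L * R ^ 2 ≤ T := by
    calc L * R ^ 2 ≤ 2 * m ^ 2 * m := by rw [hL]; gcongr
      _ = 2 * m ^ 3 := by ring
      _ ≤ T := hm1
  have hLT : L ≤ T := (Nat.le_mul_of_pos_right L (pow_pos (by omega) 2)).trans hLR
  have hT2 : 2 ≤ T := by nlinarith [Nat.one_le_pow 3 n hn1]
  have hT2' : (2 : ℝ) ≤ T := by exact_mod_cast hT2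
  set E : ℝ := (T : ℝ) ^ T with hE
  have h2E : (2 : ℝ) ^ T ≤ E := pow_le_pow_left₀ (by norm_num) hT2' T
  have hE1 : 1 ≤ E := one_le_pow₀ (by linarith)
  have hTE : (T : ℝ) ≤ E := le_self_pow₀ (by linarith) (by omega)
  have hLE : (L : ℝ) ≤ E := le_trans (by exact_mod_cast hLT) hTE
  have hcst : ∀ {x : ℝ} (q j : ℕ), 0 ≤ x → x ≤ 2 ^ k → j ≤ q * T → x ^ j ≤ E ^ (q * k) := by
    intro x q j hx0 hx hj
    calc x ^ j ≤ (2 ^ k) ^ j := pow_le_pow_left₀ hx0 hx j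
      _ ≤ (2 ^ k) ^ (q * T) := pow_le_pow_right₀ (one_le_pow₀ (by norm_num)) hj
      _ = (2 ^ T) ^ (q * k) := by rw [← pow_mul, ← pow_mul]; ring_nf
      _ ≤ E ^ (q * k) := pow_le_pow_left₀ (by positivity) h2E _
  have hc' : c ≤ E ^ (1 * k) := by simpa using hcst 1 1 hc hkc (by omega)
  have h2L : (2 : ℝ) ^ L ≤ E := (pow_le_pow_right₀ (by norm_num) hLT).trans h2E
  have hCL : C ^ (4 * L) ≤ E ^ (4 * k) := hcst 4 _ hC hkC (by omega)
  have h4n : 4 * n ^ 3 ≤ 2 * T := by omega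
  have hf : ((4 * n ^ 3).factorial : ℝ) ≤ E ^ 4 := by
    calc ((4 * n ^ 3).factorial : ℝ) ≤ (2 * T).factorial := by
          exact_mod_cast Nat.factorial_le h4n
      _ ≤ ((2 * T : ℕ) : ℝ) ^ (2 * T) := by exact_mod_cast Nat.factorial_le_pow _
      _ ≤ ((T : ℝ) ^ 2) ^ (2 * T) := by
          refine pow_le_pow_left₀ (by positivity) ?_ _
          push_cast; nlinarith
      _ = E ^ 4 := by rw [hE, ← pow_mul, ← pow_mul]; ring_nf
  have hfT : (T.factorial : ℝ) ≤ E := by rw [hE]; exact_mod_cast Nat.factorial_le_pow _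
  have hρn : ρ ^ (4 * n ^ 3) ≤ E ^ (2 * k) := hcst 2 _ hρ hkρ h4n
  have hρT : ρ ^ T ≤ E ^ (1 * k) := hcst 1 _ hρ hkρ (by omega)
  have hAT : A ^ T ≤ E ^ (1 * k) := hcst 1 _ hA hkA (by omega)
  have hδL : δ⁻¹ ^ (2 * L) ≤ E ^ (2 * k) := hcst 2 _ (by positivity) hkδ (by omega)
  have hμ : Real.exp (μ * R ^ 2) ^ (4 * L) ≤ E ^ (4 * k) := by
    have : Real.exp (μ * R ^ 2) ^ (4 * L) = Real.exp μ ^ (4 * (L * R ^ 2)) := by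
      rw [← Real.exp_nat_mul, ← Real.exp_nat_mul]
      push_cast
      ring_nf
    rw [this]
    exact hcst 4 _ (by positivity) hkμ (by omega)
  have hP : c * L ^ 3 * entryBound C ρ L (4 * n ^ 3) ≤ E ^ (7 * k + 9) := by
    unfold entryBound
    calc _ ≤ E ^ (1 * k) * E ^ 3 * (E * (E * (E ^ (4 * k) * E ^ 4 * E ^ (2 * k)))) := by gcongr
      _ = _ := by ring
  have hH : entryBound C ρ L T ≤ E ^ (5 * k + 3) := by
    unfold entryBound
    calc _ ≤ E * (E * (E ^ (4 * k) * E * E ^ (1 * k))) := by gcongr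
      _ = _ := by ring
  have hH0 : ∀ N, 0 ≤ entryBound C ρ L N := fun N => by unfold entryBound; positivity
  have hP0 : 0 ≤ c * L ^ 3 * entryBound C ρ L (4 * n ^ 3) := mul_nonneg (by positivity) (hH0 _)
  have hH0' := hH0 T
  generalize c * (L : ℝ) ^ 3 * entryBound C ρ L (4 * n ^ 3) = P at hP hP0 ⊢
  generalize entryBound C ρ L T = H at hH hH0' ⊢
  have hmain : δ⁻¹ ^ (2 * L) * ((L ^ 3 * (H * P)) ^ h *
        (A ^ T * (T.factorial * (L ^ 3 * (P * (2 ^ L * Real.exp (μ * R ^ 2) ^ (4 * L))))))) <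
      2 ^ (R * T) := by
    calc _ ≤ E ^ (2 * k) * ((E ^ 3 * (E ^ (5 * k + 3) * E ^ (7 * k + 9))) ^ h *
          (E ^ (1 * k) * (E * (E ^ 3 * (E ^ (7 * k + 9) * (E * E ^ (4 * k))))))) := by
            gcongr
      _ = E ^ (h * (12 * k + 15) + (14 * k + 14)) := by
          rw [← pow_add, ← pow_add, ← pow_mul]
          ring
      _ = ((T : ℝ) ^ (h * (12 * k + 15) + (14 * k + 14))) ^ T := by
          rw [hE, ← pow_mul, ← pow_mul, mul_comm]
      _ ≤ ((((R : ℝ) + 2) ^ 7) ^ (h * (12 * k + 15) + (14 * k + 14))) ^ T := by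
          gcongr
          have h1 : T ≤ (R + 2) ^ 7 := by
            calc T ≤ 2 * (m + 1) ^ 3 := hm2.le
              _ ≤ 2 * ((R + 1) ^ 2) ^ 3 := by gcongr
              _ ≤ (R + 2) * ((R + 2) ^ 2) ^ 3 := by gcongr <;> omega
              _ = _ := by ring
          exact_mod_cast h1
      _ < (2 ^ R) ^ T := by
          rw [← pow_mul _ 7]
          exact pow_lt_pow_left₀ (hR₀ R (by omega)) (by positivity) (by omega)
      _ = _ := by rw [← pow_mul]
  rw [inv_pow, inv_mul_lt_iff₀ (by positivity)] at hmain
  exact hmain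

theorem Differentiable.eq_zero_of_iteratedDeriv_eq_zero {f : ℂ → ℂ} (hf : Differentiable ℂ f)
    (h : ∀ k, iteratedDeriv k f 0 = 0) (s : ℂ) : f s = 0 := by
  rw [← Complex.taylorSeries_eq_of_entire (c := 0) hf s]
  simp [h]

theorem sum_mul_eq_zero_of_iteratedDeriv {ι : Type*} (S : Finset ι) (q : ι → ℂ) {f g : ι → ℂ → ℂ}
    (hf : ∀ i, Differentiable ℂ (f i)) (hg : ∀ i, Differentiable ℂ (g i))
    (h : ∀ k l, ∑ i ∈ S, q i * (iteratedDeriv k (f i) 0 * iteratedDeriv l (g i) 0) = 0)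
    (s s' : ℂ) : ∑ i ∈ S, q i * (f i s * g i s') = 0 := by
  have key : ∀ {f : ι → ℂ → ℂ} (c : ι → ℂ), (∀ i, Differentiable ℂ (f i)) →
      (∀ k, ∑ i ∈ S, c i * iteratedDeriv k (f i) 0 = 0) → ∀ s, ∑ i ∈ S, c i * f i s = 0 := by
    intro f c hf hk s
    have hd : Differentiable ℂ fun s => ∑ i ∈ S, c i * f i s :=
      Differentiable.fun_sum fun i _ => (hf i).const_mul _
    refine hd.eq_zero_of_iteratedDeriv_eq_zero (fun k => ?_) s
    rw [iteratedDeriv_fun_sum]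
    · exact (Finset.sum_congr rfl fun i _ => by rw [iteratedDeriv_const_mul_field]).trans (hk k)
    · exact fun i _ => ((hf i).const_mul _).contDiff.contDiffAt
  have h1 : ∀ l, ∑ i ∈ S, (q i * f i s) * iteratedDeriv l (g i) 0 = 0 := by
    intro l
    have := key (fun i => q i * iteratedDeriv l (g i) 0) hf
      (fun k => (Finset.sum_congr rfl fun i _ => by ring).trans (h k l)) s
    exact (Finset.sum_congr rfl fun i _ => by ring).trans this
  exact (Finset.sum_congr rfl fun i _ => by ring).trans (key (fun i => q i * f i s) hg h1 s')

section

variable {T U V T' U' V' : ℂ → ℂ} {ϖ κ ϖ' : Fin 2 → ℂ} {K : Type} [Field K] [NumberField K]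
  {φ : K →+* ℂ}

theorem exists_siegelEntry_sum_ne_zero {g t e y g' t' e' y' : ℂ}
    (h : LeafCurve T U V ϖ κ g t e y) (h' : LeafCurve T' U' V' ϖ' κ g' t' e' y') {C ρ : ℝ}
    {α β : ℕ → ℕ → ℕ → 𝓞 K} (hα : IsTaylorTable φ T U V C ρ α)
    (hβ : IsTaylorTable φ T' U' V' C ρ β) (hκ : κ ≠ 0) (hy : y ≠ 0) (hy' : y' ≠ 0) {L : ℕ}
    {ξ : Fin L × Fin L × Fin L → 𝓞 K} (hξ : ξ ≠ 0) :
    ∃ k k', ∑ l, siegelEntry α β L k k' l * ξ l ≠ 0 := by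
  by_contra! hzero
  apply hξ
  have hΦ : ∀ x, auxFun T U V T' U' V' L (fun l => φ (ξ l)) x = 0 := by
    intro x
    refine sum_mul_eq_zero_of_iteratedDeriv _ (fun i : (Fin L × Fin L × Fin L) × ℕ =>
      φ (ξ i.1) * ((i.1.2.2 : ℕ).choose i.2 * (-1) ^ ((i.1.2.2 : ℕ) - i.2)))
      (f := fun i => auxMon T U V L i.1.1 i.2)
      (g := fun i => auxMon T' U' V' L i.1.2.1 (i.1.2.2 - i.2))
      (fun i => h.differentiable_auxMon _ _ _) (fun i => h'.differentiable_auxMon _ _ _)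
      (fun k k' => ?_) x.1 x.2
    have h1 := iterate_dirDeriv_auxFun h h' hα hβ ξ k k'
    simp only [hzero, map_zero, mul_zero, Finset.sum_const_zero] at h1
    unfold auxFun at h1
    rwa [iterate_dirDeriv_sum_mul (ι := (Fin L × Fin L × Fin L) × ℕ)
      (f := fun i => auxMon T U V L i.1.1 i.2)
      (g := fun i => auxMon T' U' V' L i.1.2.1 (i.1.2.2 - i.2))
      (q := fun i => φ (ξ i.1) * ((i.1.2.2 : ℕ).choose i.2 * (-1) ^ ((i.1.2.2 : ℕ) - i.2)))
      _ (fun i => h.differentiable_auxMon _ _ _)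
      (fun i => h'.differentiable_auxMon _ _ _)] at h1
  have h2 := eq_zero_of_auxFun_eq_zero h h' hy hy' hκ hΦ
  funext l
  have h3 := congrFun h2 l
  simpa using h3

/-- The first nonvanishing Taylor coefficient of the auxiliary function. -/

theorem exists_order {g t e y g' t' e' y' : ℂ}
    (h : LeafCurve T U V ϖ κ g t e y) (h' : LeafCurve T' U' V' ϖ' κ g' t' e' y') {C ρ : ℝ}
    {α β : ℕ → ℕ → ℕ → 𝓞 K} (hα : IsTaylorTable φ T U V C ρ α)
    (hβ : IsTaylorTable φ T' U' V' C ρ β) (hκ : κ ≠ 0) (hy : y ≠ 0) (hy' : y' ≠ 0) {L : ℕ}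
    {ξ : Fin L × Fin L × Fin L → 𝓞 K} (hξ : ξ ≠ 0) {N : ℕ}
    (hN : ∀ k < N, ∀ k' < N, ∑ l, siegelEntry α β L k k' l * ξ l = 0) :
    ∃ k k', N ≤ k + k' ∧ ∑ l, siegelEntry α β L k k' l * ξ l ≠ 0 ∧
      VanishTo (1, 0) (0, 1) (k + k') (auxFun T U V T' U' V' L fun l => φ (ξ l)) 0 ∧
      (dirDeriv (1, 0))^[k] ((dirDeriv (0, 1))^[k']
        (auxFun T U V T' U' V' L fun l => φ (ξ l))) 0 =
        T 0 ^ (2 * L) * T' 0 ^ (2 * L) * φ (∑ l, siegelEntry α β L k k' l * ξ l : 𝓞 K) := by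
  obtain ⟨k₀, k₀', h0⟩ := exists_siegelEntry_sum_ne_zero h h' hα hβ hκ hy hy' hξ
  have hex : ∃ n, ∃ k k', k + k' = n ∧ ∑ l, siegelEntry α β L k k' l * ξ l ≠ 0 :=
    ⟨_, k₀, k₀', rfl, h0⟩
  classical
  obtain ⟨k, k', hn, hne⟩ := Nat.find_spec hex
  have hmin : ∀ i i', i + i' < k + k' → ∑ l, siegelEntry α β L i i' l * ξ l = 0 := by
    intro i i' hi
    by_contra hcon
    exact Nat.find_min hex (hn ▸ hi) ⟨i, i', rfl, hcon⟩
  refine ⟨k, k', ?_, hne, fun i i' hi => ?_, ?_⟩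
  · by_contra! hlt
    exact hne (hN k (by omega) k' (by omega))
  · rw [iterate_dirDeriv_auxFun h h' hα hβ]
    refine Finset.sum_eq_zero fun j _ => Finset.sum_eq_zero fun j' _ => ?_
    rw [hmin (i - j) (i' - j') (by omega)]
    simp
  · rw [iterate_dirDeriv_auxFun h h' hα hβ, Finset.sum_eq_single 0, Finset.sum_eq_single 0]
    · simp
    · intro j hj hj0
      rw [hmin _ _ (by have := Finset.mem_range.mp hj; omega)]
      simp
    · simp
    · intro j hj hj0
      refine Finset.sum_eq_zero fun j' _ => ?_
      rw [hmin _ _ (by have := Finset.mem_range.mp hj; omega)]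
      simp
    · simp

end

section

variable {T U V T' U' V' : ℂ → ℂ} {ϖ κ ϖ' : Fin 2 → ℂ} {K : Type} [Field K] [NumberField K]
  {φ : K →+* ℂ}

theorem exists_auxiliary_vector (K : Type) [Field K] [NumberField K] : ∃ c : ℝ, 1 ≤ c ∧
    ∀ {T U V T' U' V' : ℂ → ℂ} {φ : K →+* ℂ} {C ρ : ℝ} {α β : ℕ → ℕ → ℕ → 𝓞 K}, 1 ≤ C → 1 ≤ ρ →
    IsTaylorTable φ T U V C ρ α → IsTaylorTable φ T' U' V' C ρ β → ∀ {n L : ℕ}, 1 ≤ n →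
    L = 2 * n ^ 2 → ∃ ξ : Fin L × Fin L × Fin L → 𝓞 K, ξ ≠ 0 ∧
      (∀ k < 2 * n ^ 3, ∀ k' < 2 * n ^ 3, ∑ l, siegelEntry α β L k k' l * ξ l = 0) ∧
      ∀ l, house (ξ l : K) ≤ c * L ^ 3 * entryBound C ρ L (4 * n ^ 3) := by
  obtain ⟨c, hc, H⟩ := exists_siegel_vector K
  refine ⟨c, hc, ?_⟩
  intro T U V T' U' V' φ C ρ α β hC hρ hα hβ n L hn hL
  have hL1 : (1 : ℝ) ≤ L := by
    have : 1 ≤ L := by rw [hL]; nlinarith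
    exact_mod_cast this
  have hf : (1 : ℝ) ≤ (4 * n ^ 3).factorial := by exact_mod_cast Nat.factorial_pos _
  have h2L : (1 : ℝ) ≤ 2 ^ L := one_le_pow₀ (by norm_num)
  have hA : 1 ≤ entryBound C ρ L (4 * n ^ 3) :=
    one_le_mul_of_one_le_of_one_le hL1 (one_le_mul_of_one_le_of_one_le h2L
      (one_le_mul_of_one_le_of_one_le (one_le_mul_of_one_le_of_one_le (one_le_pow₀ hC) hf)
        (one_le_pow₀ hρ)))
  obtain ⟨ξ, h0, h1, h2⟩ := H (Fin (2 * n ^ 3) × Fin (2 * n ^ 3)) (Fin L × Fin L × Fin L)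
    (fun k l => siegelEntry α β L k.1 k.2 l) (entryBound C ρ L (4 * n ^ 3)) hA
    (by simp only [Fintype.card_prod, Fintype.card_fin]; positivity)
    (by simp only [Fintype.card_prod, Fintype.card_fin, hL]; ring)
    (fun k l => house_siegelEntry_le hC hρ hα hβ (by omega) l)
  refine ⟨ξ, h0, fun k hk k' hk' => h1 (⟨k, hk⟩, ⟨k', hk'⟩), fun l => ?_⟩
  refine (h2 l).trans (le_of_eq ?_)
  simp only [Fintype.card_prod, Fintype.card_fin]
  push_cast
  ring

theorem house_siegelEntry_sum_le {C ρ : ℝ} {α β : ℕ → ℕ → ℕ → 𝓞 K} (hC : 1 ≤ C) (hρ : 1 ≤ ρ)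
    (hα : IsTaylorTable φ T U V C ρ α) (hβ : IsTaylorTable φ T' U' V' C ρ β) {L k k' : ℕ}
    {ξ : Fin L × Fin L × Fin L → 𝓞 K} {P : ℝ} (hξ : ∀ l, house (ξ l : K) ≤ P) :
    house ((∑ l, siegelEntry α β L k k' l * ξ l : 𝓞 K) : K) ≤
      L ^ 3 * (entryBound C ρ L (k + k') * P) := by
  push_cast
  refine (house_sum_le_sum_house _ _).trans ?_
  calc _ ≤ ∑ l : Fin L × Fin L × Fin L, entryBound C ρ L (k + k') * P := by
        refine Finset.sum_le_sum fun l _ => (house_mul_le _ _).trans ?_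
        have h1 := house_siegelEntry_le hC hρ hα hβ (le_refl (k + k')) l
        exact mul_le_mul h1 (hξ l) (house_nonneg _) ((house_nonneg _).trans h1)
    _ = _ := by
        simp only [Finset.sum_const, Finset.card_univ, Fintype.card_prod, Fintype.card_fin,
          nsmul_eq_mul]
        push_cast
        ring

theorem LeafCurve.exists_growth {g t e y : ℂ} (h : LeafCurve T U V ϖ κ g t e y) (W : ℝ) :
    ∃ μ : ℝ, 0 ≤ μ ∧ ∀ (R : ℕ), 1 ≤ R → ∀ s, ‖s‖ ≤ W * R → ‖T s‖ ≤ Real.exp (μ * R ^ 2) ∧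
      ‖U s‖ ≤ Real.exp (μ * R ^ 2) ∧ ‖V s‖ ≤ Real.exp (μ * R ^ 2) := by
  obtain ⟨C, hC⟩ := h.growth
  refine ⟨|C| * (1 + W ^ 2), by positivity, fun R hR s hs => ?_⟩
  have hR' : (1 : ℝ) ≤ R := by exact_mod_cast hR
  have h1 : ‖s‖ ^ 2 ≤ W ^ 2 * R ^ 2 := by
    rw [← mul_pow]; exact pow_le_pow_left₀ (norm_nonneg _) hs 2
  have h2 : Real.exp (C * (1 + ‖s‖ ^ 2)) ≤ Real.exp (|C| * (1 + W ^ 2) * R ^ 2) := by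
    refine Real.exp_le_exp.mpr ?_
    calc C * (1 + ‖s‖ ^ 2) ≤ |C| * (1 + ‖s‖ ^ 2) := by gcongr; exact le_abs_self C
      _ ≤ |C| * (R ^ 2 + W ^ 2 * R ^ 2) := by gcongr; nlinarith
      _ = _ := by ring
  exact ⟨(hC s).1.trans h2, (hC s).2.1.trans h2, (hC s).2.2.trans h2⟩

/-- Two algebraic leaf curves with the same quasi-periods have proportional periods. -/

theorem LeafCurve.periods_dependent {g t e y g' t' e' y' : 𝓞 K}
    (h : LeafCurve T U V ϖ κ (φ g) (φ t) (φ e) (φ y))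
    (h' : LeafCurve T' U' V' ϖ' κ (φ g') (φ t') (φ e') (φ y')) (hκ : κ ≠ 0)
    (hy : y ≠ 0) (hy' : y' ≠ 0) : ϖ 0 * ϖ' 1 = ϖ 1 * ϖ' 0 := by
  by_contra hD
  replace hD : ϖ 0 * ϖ' 1 - ϖ 1 * ϖ' 0 ≠ 0 := sub_ne_zero.mpr hD
  obtain ⟨D, hDdef⟩ : ∃ D, D = ϖ 0 * ϖ' 1 - ϖ 1 * ϖ' 0 := ⟨_, rfl⟩
  rw [← hDdef] at hD
  obtain ⟨C, ρ, hC, hρ, α, β, hα, hβ⟩ := h.exists_isTaylorTable h'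
  obtain ⟨c, hc, hsiegel⟩ := exists_auxiliary_vector K
  have hy1 : φ y ≠ 0 := by simpa using hy
  have hy1' : φ y' ≠ 0 := by simpa using hy'
  obtain ⟨W, hW⟩ : ∃ W, W = 3 * (‖ϖ 0‖ + ‖ϖ 1‖ + ‖ϖ' 0‖ + ‖ϖ' 1‖) := ⟨_, rfl⟩
  obtain ⟨μ, hμ0, hμ⟩ := h.exists_growth W
  obtain ⟨μ', hμ0', hμ'⟩ := h'.exists_growth W
  obtain ⟨A, hA⟩ : ∃ A, A = ‖ϖ' 1 / D‖ + ‖-ϖ' 0 / D‖ + (‖-ϖ 1 / D‖ + ‖ϖ 0 / D‖) := ⟨_, rfl⟩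
  have hA0 : 0 ≤ A := by rw [hA]; positivity
  have hδ : 0 < ‖T 0 * T' 0‖ := norm_pos_iff.mpr (mul_ne_zero h.T_zero h'.T_zero)
  obtain ⟨n, hn, hpar⟩ := exists_parameters (c := c) (C := C) (ρ := ρ) (A := A) (μ := μ + μ')
    (by linarith) (by linarith) (by linarith) hA0 hδ (Module.finrank ℚ K - 1)
  obtain ⟨L, hL⟩ : ∃ L, L = 2 * n ^ 2 := ⟨_, rfl⟩
  obtain ⟨P, hP⟩ : ∃ P, P = c * L ^ 3 * entryBound C ρ L (4 * n ^ 3) := ⟨_, rfl⟩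
  obtain ⟨ξ, hξ0, hξ1, hξ2⟩ := hsiegel hC hρ hα hβ hn hL
  rw [← hP] at hξ2
  obtain ⟨k, k', hN, hne, hvan, hval⟩ := exists_order h h' hα hβ hκ hy1 hy1' hξ0 hξ1
  obtain ⟨R, hR, hlt⟩ := hpar (k + k') hN
  refine absurd (hlt L hL P hP) (not_lt.mpr ?_)
  have hP0 : 0 ≤ P := by
    have : 0 < L := by rw [hL]; positivity
    exact (house_nonneg _).trans (hξ2 (⟨0, this⟩, ⟨0, this⟩, ⟨0, this⟩))
  have hup := norm_iterate_dirDeriv_le_of_quasiPeriodic (v := (ϖ 0, ϖ' 0)) (w := (ϖ 1, ϖ' 1))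
    (a := ϖ' 1 / D) (b := -ϖ' 0 / D) (c := -ϖ 1 / D) (d := ϖ 0 / D)
    (by ext <;> simp <;> field_simp <;> rw [hDdef] <;> ring)
    (by ext <;> simp <;> field_simp <;> rw [hDdef] <;> ring)
    (A := A) (by rw [hA]; linarith [norm_nonneg (-ϖ 1 / D), norm_nonneg (ϖ 0 / D)])
    (by rw [hA]; linarith [norm_nonneg (ϖ' 1 / D), norm_nonneg (-ϖ' 0 / D)])
    (contDiff_auxFun h h' L fun l => φ (ξ l)) (auxFun_translate h h' L _ 0)
    (auxFun_translate h h' L _ 1) hvan hR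
    (B := L ^ 3 * (P * (2 ^ L * Real.exp ((μ + μ') * R ^ 2) ^ (4 * L)))) ?_ rfl
  · rw [hval, norm_mul] at hup
    have hlow := one_le_norm_mul_house_pow φ _ hne
    have hhouse := house_siegelEntry_sum_le hC hρ hα hβ (k := k) (k' := k') hξ2
    set f := ∑ l, siegelEntry α β L k k' l * ξ l
    have hH0 : 0 ≤ L ^ 3 * (entryBound C ρ L (k + k') * P) := (house_nonneg _).trans hhouse
    have hlow' : 1 ≤ ‖φ f‖ * (L ^ 3 * (entryBound C ρ L (k + k') * P)) ^
        (Module.finrank ℚ K - 1) := by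
      refine hlow.trans ?_
      gcongr
      exact house_nonneg _
    rw [← mul_pow, norm_pow] at hup
    have h2 : (0 : ℝ) < 2 ^ (R * (k + k')) := by positivity
    rw [← mul_div_assoc, ← mul_div_assoc, le_div_iff₀ h2] at hup
    calc ‖T 0 * T' 0‖ ^ (2 * L) * 2 ^ (R * (k + k'))
        ≤ ‖T 0 * T' 0‖ ^ (2 * L) * 2 ^ (R * (k + k')) * (‖φ f‖ *
          (L ^ 3 * (entryBound C ρ L (k + k') * P)) ^ (Module.finrank ℚ K - 1)) :=
          le_mul_of_one_le_right (by positivity) hlow'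
      _ = (L ^ 3 * (entryBound C ρ L (k + k') * P)) ^ (Module.finrank ℚ K - 1) *
          (‖T 0 * T' 0‖ ^ (2 * L) * ‖φ f‖ * 2 ^ (R * (k + k'))) := by ring
      _ ≤ _ := by gcongr
  · intro t r ht hr
    have hx : ∀ u v : ℂ, 3 * (‖u‖ + ‖v‖) ≤ W → ‖t * u + r * v‖ ≤ W * R := by
      intro u v huv
      calc ‖t * u + r * v‖ ≤ ‖t‖ * ‖u‖ + ‖r‖ * ‖v‖ := by
            rw [← norm_mul, ← norm_mul]; exact norm_add_le _ _
        _ ≤ 3 * R * ‖u‖ + 3 * R * ‖v‖ := by gcongr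
        _ = 3 * (‖u‖ + ‖v‖) * R := by ring
        _ ≤ W * R := by gcongr
    have h1 := hμ R hR (t * ϖ 0 + r * ϖ 1)
      (hx _ _ (by rw [hW]; linarith [norm_nonneg (ϖ' 0), norm_nonneg (ϖ' 1)]))
    have h2 := hμ' R hR (t * ϖ' 0 + r * ϖ' 1)
      (hx _ _ (by rw [hW]; linarith [norm_nonneg (ϖ 0), norm_nonneg (ϖ 1)]))
    have e1 : Real.exp (μ * R ^ 2) ≤ Real.exp ((μ + μ') * R ^ 2) := by gcongr; linarith
    have e2 : Real.exp (μ' * R ^ 2) ≤ Real.exp ((μ + μ') * R ^ 2) := by gcongr; linarith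
    refine norm_auxFun_le L _ (fun l => (norm_embedding_le_house _ φ).trans (hξ2 l))
      (Real.one_le_exp (by positivity)) ?_ ?_ ?_ ?_ ?_ ?_
    · exact h1.1.trans e1
    · exact h1.2.1.trans e1
    · exact h1.2.2.trans e1
    · exact h2.1.trans e2
    · exact h2.2.1.trans e2
    · exact h2.2.2.trans e2

end

namespace PeriodPair

variable (L : PeriodPair)

/-- The Weierstrass `ζ` function with the `l₀`-term missing. -/
noncomputable def weierstrassZetaExcept (l₀ z : ℂ) : ℂ :=
  ∑' l : L.lattice, if l = l₀ then 0 else (1 / (z - l) + 1 / l + z / l ^ 2)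

/-- The Weierstrass `ζ` function. -/
noncomputable def weierstrassZeta (z : ℂ) : ℂ :=
  ∑' l : L.lattice, (1 / (z - l) + 1 / l + z / l ^ 2)

theorem weierstrassZeta_bound (r : ℝ) (hr : 0 < r) (s : ℂ) (hs : ‖s‖ < r) (l : ℂ)
    (h : 2 * r ≤ ‖l‖) : ‖1 / (s - l) + 1 / l + s / l ^ 2‖ ≤ 2 * r ^ 2 * ‖l‖ ^ (-3 : ℝ) := by
  have h1 : s - l ≠ 0 := sub_ne_zero.mpr (by rintro rfl; linarith)
  have h2 : 0 < ‖l‖ := by linarith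
  have h2' : l ≠ 0 := norm_pos_iff.mp h2
  have h3 : ‖l‖ / 2 ≤ ‖s - l‖ := by
    rw [norm_sub_rev]
    exact .trans (by linarith) (norm_sub_norm_le l s)
  have h4 : 1 / (s - l) + 1 / l + s / l ^ 2 = s ^ 2 / ((s - l) * l ^ 2) := by
    field_simp
    ring
  rw [h4, norm_div, norm_mul, norm_pow, norm_pow]
  calc ‖s‖ ^ 2 / (‖s - l‖ * ‖l‖ ^ 2) ≤ r ^ 2 / (‖l‖ / 2 * ‖l‖ ^ 2) := by gcongr
    _ = 2 * r ^ 2 / ‖l‖ ^ 3 := by field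
    _ = _ := by norm_cast

theorem hasSumLocallyUniformly_weierstrassZetaExcept (l₀ : ℂ) :
    HasSumLocallyUniformly
      (fun (l : L.lattice) (z : ℂ) ↦ if l.1 = l₀ then 0 else (1 / (z - l) + 1 / l + z / l ^ 2))
      (L.weierstrassZetaExcept l₀) := by
  refine L.hasSumLocallyUniformly_aux (u := (2 * · ^ 2 * ‖·‖ ^ (-3 : ℝ))) _
    (fun _ _ ↦ (ZLattice.summable_norm_rpow _ _ (by simp; norm_num)).mul_left _) fun r hr ↦
    Filter.eventually_atTop.mpr ⟨2 * r, ?_⟩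
  rintro _ h s hs l rfl
  split_ifs
  · simpa using! show 0 ≤ 2 * r ^ 2 * (‖↑l‖ ^ 3)⁻¹ by positivity
  · exact weierstrassZeta_bound r hr s hs l h

theorem weierstrassZetaExcept_add (l₀ : L.lattice) (z : ℂ) :
    L.weierstrassZetaExcept l₀ z + (1 / (z - l₀.1) + 1 / l₀.1 + z / l₀.1 ^ 2) =
      L.weierstrassZeta z := by
  trans L.weierstrassZetaExcept l₀ z +
    ∑' i : L.lattice, if i = l₀.1 then (1 / (z - l₀.1) + 1 / l₀.1 + z / l₀.1 ^ 2) else 0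
  · simp
  rw [weierstrassZetaExcept, ← Summable.tsum_add]
  · congr with w; split_ifs <;> simp only [zero_add, add_zero, *]
  · exact (L.hasSumLocallyUniformly_weierstrassZetaExcept l₀.1).hasSum.summable
  · exact summable_of_hasFiniteSupport ((Set.finite_singleton l₀).subset (by simp))

theorem weierstrassZetaExcept_of_notMem (l₀ : ℂ) (hl : l₀ ∉ L.lattice) :
    L.weierstrassZetaExcept l₀ = L.weierstrassZeta := by
  delta weierstrassZetaExcept weierstrassZeta
  congr! 3 with z l
  have : l.1 ≠ l₀ := by rintro rfl; simp at hl
  simp [this]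

theorem hasSum_weierstrassZeta (z : ℂ) :
    HasSum (fun l : L.lattice ↦ (1 / (z - l) + 1 / l + z / l ^ 2)) (L.weierstrassZeta z) := by
  have := (L.hasSumLocallyUniformly_weierstrassZetaExcept (L.ω₁ / 2)).hasSum (x := z)
  rw [L.weierstrassZetaExcept_of_notMem _ L.ω₁_div_two_notMem_lattice] at this
  convert! this using 2 with l
  rw [if_neg]; exact fun e ↦ L.ω₁_div_two_notMem_lattice (e ▸ l.2)

theorem differentiableOn_weierstrassZetaExcept (l₀ : ℂ) :
    DifferentiableOn ℂ (L.weierstrassZetaExcept l₀) (L.lattice \ {l₀})ᶜ := by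
  refine (L.hasSumLocallyUniformly_weierstrassZetaExcept
    l₀).hasSumLocallyUniformlyOn.differentiableOn
    (.of_forall fun s ↦ .fun_sum fun i hi ↦ ?_) L.isOpen_compl_lattice_sdiff
  split_ifs
  · simp
  · refine .add (.add (.div (by fun_prop) (by fun_prop) fun x hx => ?_) (by fun_prop)) (by fun_prop)
    have : x ≠ i := by rintro rfl; simp_all
    simpa [sub_eq_zero]

theorem eqOn_deriv_weierstrassZetaExcept (l₀ : ℂ) :
    Set.EqOn (deriv (L.weierstrassZetaExcept l₀)) (-L.weierstrassPExcept l₀)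
      (L.lattice \ {l₀})ᶜ := by
  refine ((L.hasSumLocallyUniformly_weierstrassZetaExcept l₀).tendstoLocallyUniformlyOn.deriv
    (.of_forall fun s ↦ ?_) L.isOpen_compl_lattice_sdiff).unique ?_
  · refine .fun_sum fun i hi ↦ ?_
    split_ifs
    · simp
    refine .add (.add (.div (by fun_prop) (by fun_prop) fun x hx => ?_) (by fun_prop)) (by fun_prop)
    have : x ≠ i := by rintro rfl; simp_all
    simpa [sub_eq_zero]
  · have h := (L.hasSumLocallyUniformly_weierstrassPExcept l₀).tendstoLocallyUniformlyOn
      (s := (L.lattice \ {l₀})ᶜ)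
    refine TendstoLocallyUniformlyOn.congr h.neg ?_
    intro s z hz
    have hd : ∀ x : L.lattice, x.1 ≠ l₀ → HasDerivAt
        (fun z : ℂ => 1 / (z - x) + 1 / x + z / x ^ 2) (-(1 / (z - x) ^ 2 - 1 / x ^ 2)) z := by
      intro x hx
      have hx' : z - x ≠ 0 := fun e => hx (by
        obtain rfl := sub_eq_zero.mp e
        simpa using hz)
      have h1 := ((((hasDerivAt_id z).sub_const (x : ℂ)).inv hx').add_const (1 / (x : ℂ))).add
        ((hasDerivAt_id z).div_const ((x : ℂ) ^ 2))
      convert! h1 using 1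
      · funext z; simp
      · simp only [id]; ring
    simp only [Function.comp_apply, Pi.neg_apply]
    rw [deriv_fun_sum, ← Finset.sum_neg_distrib]
    · refine Finset.sum_congr rfl fun x _ => ?_
      split_ifs with hx
      · simp
      · rw [(hd x hx).deriv]
    · intros x hxs
      split_ifs with hx
      · simp
      · exact (hd x hx).differentiableAt

theorem hasDerivAt_weierstrassZeta {z : ℂ} (hz : z ∉ L.lattice) :
    HasDerivAt L.weierstrassZeta (-L.weierstrassP z) z := by
  have h0 := L.ω₁_div_two_notMem_lattice
  have hz' : z ∈ ((L.lattice : Set ℂ) \ {L.ω₁ / 2})ᶜ := by simp [hz]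
  have h1 := L.eqOn_deriv_weierstrassZetaExcept (L.ω₁ / 2) hz'
  have h2 := (L.differentiableOn_weierstrassZetaExcept (L.ω₁ / 2)).differentiableAt
    (L.isOpen_compl_lattice_sdiff.mem_nhds hz')
  rw [L.weierstrassZetaExcept_of_notMem _ h0, L.weierstrassPExcept_of_notMem _ h0] at h1
  rw [L.weierstrassZetaExcept_of_notMem _ h0] at h2
  have h3 := h2.hasDerivAt
  rwa [h1] at h3

theorem analyticAt_weierstrassZetaExcept (l₀ : ℂ) :
    AnalyticAt ℂ (L.weierstrassZetaExcept l₀) l₀ :=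
  (L.differentiableOn_weierstrassZetaExcept l₀).analyticAt
    (L.compl_lattice_sdiff_singleton_mem_nhds l₀)

end PeriodPair

/-- A telescoping series over `ℤ` whose terms tend to zero contributes nothing. -/

theorem tsum_int_telescope_add {a b : ℤ → ℂ} (ha : Filter.Tendsto a Filter.cofinite (𝓝 0))
    (hb : Summable b) (hs : Summable fun n ↦ a n - a (n + 1) + b n) :
    ∑' n, (a n - a (n + 1) + b n) = ∑' n, b n := by
  have h1 : Summable fun n ↦ a n - a (n + 1) := by
    simpa using hs.sub hb
  rw [h1.tsum_add hb, add_eq_right]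
  have h2 : HasSum (fun n ↦ a n - a (n + 1)) 0 (SummationFilter.symmetricIco ℤ) := by
    rw [SummationFilter.hasSum_symmetricIco_int_iff]
    have hpos : Filter.Tendsto (fun N : ℕ ↦ a (N : ℤ)) Filter.atTop (𝓝 0) := by
      rw [← Nat.cofinite_eq_atTop]
      exact ha.comp (Nat.cast_injective.tendsto_cofinite)
    have hneg : Filter.Tendsto (fun N : ℕ ↦ a (-N : ℤ)) Filter.atTop (𝓝 0) := by
      rw [← Nat.cofinite_eq_atTop]
      exact ha.comp ((neg_injective.comp Nat.cast_injective).tendsto_cofinite)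
    have h3 := hneg.sub hpos
    rw [sub_zero] at h3
    exact h3.congr fun N ↦ (Finset.sum_Ico_int_sub N a).symm
  rw [← tsum_eq_of_summable_unconditional (L := SummationFilter.symmetricIco ℤ) h1]
  exact h2.tsum_eq

namespace PeriodPair

open UpperHalfPlane in
/-- The period pair `(1, τ)`. -/
noncomputable def ofUpperHalfPlane (τ : ℍ) : PeriodPair where
  ω₁ := 1
  ω₂ := τ
  indep := by
    rw [LinearIndependent.pair_iff]
    intro s t h
    have h1 := congrArg Complex.im h
    have h2 := congrArg Complex.re h
    have h3 : t = 0 := by simpa [τ.im_ne_zero] using h1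
    simp_all

variable (L : PeriodPair)

theorem tendsto_one_div_sub_lattice (u : ℂ) :
    Filter.Tendsto (fun l : L.lattice ↦ 1 / (u - l)) Filter.cofinite (𝓝 0) := by
  have h := L.lattice.toAddSubgroup.tendsto_coe_cofinite_of_discrete
    (isDiscrete_iff_discreteTopology.mpr (inferInstanceAs (DiscreteTopology L.lattice)))
  rw [← Metric.cobounded_eq_cocompact] at h
  simp only [one_div]
  exact (Filter.tendsto_inv₀_cobounded.comp (tendsto_const_sub_cobounded u)).comp h

theorem hasSum_weierstrassZeta_sub (u c : ℂ) :
    HasSum (fun p : ℤ × ℤ ↦ 1 / (u + c - (p.1 * L.ω₁ + p.2 * L.ω₂)) -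
      1 / (u - (p.1 * L.ω₁ + p.2 * L.ω₂)) + c / (p.1 * L.ω₁ + p.2 * L.ω₂) ^ 2)
      (L.weierstrassZeta (u + c) - L.weierstrassZeta u) := by
  have h := (L.hasSum_weierstrassZeta (u + c)).sub (L.hasSum_weierstrassZeta u)
  rw [← L.latticeEquivProd.symm.toEquiv.hasSum_iff] at h
  convert! h using 2 with p
  simp only [Function.comp, LinearEquiv.coe_toEquiv, latticeEquiv_symm_apply]
  ring

variable (τ : UpperHalfPlane)

theorem weierstrassZeta_add_one {u : ℂ} :
    (ofUpperHalfPlane τ).weierstrassZeta (u + 1) =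
      (ofUpperHalfPlane τ).weierstrassZeta u + EisensteinSeries.G2 τ := by
  set L := ofUpperHalfPlane τ
  have h := L.hasSum_weierstrassZeta_sub u 1
  rw [← (Equiv.prodComm ℤ ℤ).hasSum_iff] at h
  have hrow (m : ℤ) := h.summable.prod_factor m
  have hsum := h.prod_fiberwise fun m ↦ (hrow m).hasSum
  have hval (m : ℤ) : (∑' n : ℤ, ((fun p : ℤ × ℤ ↦ 1 / (u + 1 - (p.1 * L.ω₁ + p.2 * L.ω₂)) -
      1 / (u - (p.1 * L.ω₁ + p.2 * L.ω₂)) + 1 / (p.1 * L.ω₁ + p.2 * L.ω₂) ^ 2) ∘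
      Equiv.prodComm ℤ ℤ) (m, n)) = EisensteinSeries.e2Summand m τ := by
    have hterm (n : ℤ) : EisensteinSeries.eisSummand 2 ![m, n] τ =
        1 / (n * L.ω₁ + m * L.ω₂) ^ 2 := by
      simp [EisensteinSeries.eisSummand, L, ofUpperHalfPlane, zpow_neg]
      ring_nf
    have h1 := tsum_int_telescope_add (a := fun n : ℤ ↦ 1 / (u + 1 - (n * L.ω₁ + m * L.ω₂)))
      (b := fun n : ℤ ↦ 1 / (n * L.ω₁ + m * L.ω₂) ^ 2) ?_ ?_ ?_
    · rw [EisensteinSeries.e2Summand, tsum_congr hterm, ← h1]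
      refine tsum_congr fun n ↦ ?_
      simp [L, ofUpperHalfPlane]
      ring
    · have := (L.tendsto_one_div_sub_lattice (u + 1)).comp
        ((L.latticeEquivProd.symm.injective.comp
          (Prod.mk_left_injective m)).tendsto_cofinite)
      refine this.congr fun n ↦ ?_
      simp [latticeEquiv_symm_apply]
    · exact (EisensteinSeries.e2Summand_summable m τ).congr hterm
    · refine (hrow m).congr fun n ↦ ?_
      simp [L, ofUpperHalfPlane]
      ring
  have h2 : HasSum (fun m ↦ EisensteinSeries.e2Summand m τ)
      (L.weierstrassZeta (u + 1) - L.weierstrassZeta u) := by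
    simpa only [hval] using hsum
  have h3 : EisensteinSeries.G2 τ = L.weierstrassZeta (u + 1) - L.weierstrassZeta u := by
    rw [EisensteinSeries.G2, tsum_eq_of_summable_unconditional h2.summable,
      h2.tsum_eq]
  rw [h3]
  ring

theorem weierstrassZeta_add_tau {u : ℂ} :
    (ofUpperHalfPlane τ).weierstrassZeta (u + (τ : ℂ)) =
      (ofUpperHalfPlane τ).weierstrassZeta u +
        ((τ : ℂ) * EisensteinSeries.G2 τ - 2 * Real.pi * I) := by
  set L := ofUpperHalfPlane τ
  have h := L.hasSum_weierstrassZeta_sub u (τ : ℂ)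
  have hrow (n : ℤ) := h.summable.prod_factor n
  have hsum := h.prod_fiberwise fun n ↦ (hrow n).hasSum
  have hval (n : ℤ) : (∑' m : ℤ, (1 / (u + (τ : ℂ) - (n * L.ω₁ + m * L.ω₂)) -
      1 / (u - (n * L.ω₁ + m * L.ω₂)) + (τ : ℂ) / (n * L.ω₁ + m * L.ω₂) ^ 2)) =
      (τ : ℂ) * ∑' m : ℤ, 1 / ((m : ℂ) * τ + n) ^ 2 := by
    have hterm (m : ℤ) : (τ : ℂ) / (n * L.ω₁ + m * L.ω₂) ^ 2 =
        (τ : ℂ) * (1 / ((m : ℂ) * τ + n) ^ 2) := by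
      simp [L, ofUpperHalfPlane]
      ring_nf
    have h1 := tsum_int_telescope_add (a := fun m : ℤ ↦ 1 / (u + (τ : ℂ) - (n * L.ω₁ + m * L.ω₂)))
      (b := fun m : ℤ ↦ (τ : ℂ) / (n * L.ω₁ + m * L.ω₂) ^ 2) ?_ ?_ ?_
    · rw [← tsum_mul_left, ← tsum_congr hterm, ← h1]
      refine tsum_congr fun m ↦ ?_
      simp [L, ofUpperHalfPlane]
      ring
    · have := (L.tendsto_one_div_sub_lattice (u + (τ : ℂ))).comp
        ((L.latticeEquivProd.symm.injective.comp
          (Prod.mk_right_injective n)).tendsto_cofinite)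
      refine this.congr fun m ↦ ?_
      simp [latticeEquiv_symm_apply]
    · have h2 := (EisensteinSeries.linear_left_summable τ.ne_zero n le_rfl).mul_left (τ : ℂ)
      refine h2.congr fun m ↦ ?_
      rw [hterm]
      simp
    · refine (hrow n).congr fun m ↦ ?_
      simp [L, ofUpperHalfPlane]
      ring
  have h2 : HasSum (fun n : ℤ ↦ (τ : ℂ) * ∑' m : ℤ, 1 / ((m : ℂ) * τ + n) ^ 2)
      (L.weierstrassZeta (u + (τ : ℂ)) - L.weierstrassZeta u) := by
    simpa only [hval] using hsum
  have hτ : (τ : ℂ) ≠ 0 := τ.ne_zero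
  have h3 : HasSum (fun n : ℤ ↦ ∑' m : ℤ, 1 / ((m : ℂ) * τ + n) ^ 2)
      ((L.weierstrassZeta (u + (τ : ℂ)) - L.weierstrassZeta u) / τ) := by
    simpa [hτ] using h2.div_const (τ : ℂ)
  have h4 := EisensteinSeries.tsum_symmetricIco_tsum_eq_S_act τ
  rw [tsum_eq_of_summable_unconditional h3.summable, h3.tsum_eq] at h4
  have h5 := EisensteinSeries.G2_S_transform τ
  rw [← h4] at h5
  rw [h5]
  field_simp
  ring

end PeriodPair

section Theta

variable {τ : ℂ}

theorem differentiable_jacobiTheta₂_fst (hτ : 0 < τ.im) :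
    Differentiable ℂ fun u ↦ jacobiTheta₂ u τ :=
  fun _ ↦ differentiableAt_jacobiTheta₂_fst _ hτ

theorem jacobiTheta₂_half_period (τ : ℂ) : jacobiTheta₂ ((1 + τ) / 2) τ = 0 := by
  have h1 : jacobiTheta₂ ((1 + τ) / 2) τ = jacobiTheta₂ ((1 - τ) / 2) τ := by
    rw [← jacobiTheta₂_neg_left, ← jacobiTheta₂_add_left]
    congr 1
    ring
  have h2 := jacobiTheta₂_add_left' ((1 - τ) / 2) τ
  rw [show (1 - τ) / 2 + τ = (1 + τ) / 2 by ring,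
    show -Real.pi * I * (τ + 2 * ((1 - τ) / 2)) = -(Real.pi * I) by ring, exp_neg,
    exp_pi_mul_I, ← h1] at h2
  linear_combination h2 / 2

theorem integral_jacobiTheta₂ (hτ : 0 < τ.im) : ∫ x in (0 : ℝ)..1, jacobiTheta₂ x τ = 1 := by
  have hint (n : ℤ) : ∫ x in (0 : ℝ)..1, jacobiTheta₂_term n x τ = if n = 0 then 1 else 0 := by
    split_ifs with hn
    · simp [hn, jacobiTheta₂_term]
    · have hc : (2 * Real.pi * I * n : ℂ) ≠ 0 := by simp [hn, Real.pi_ne_zero]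
      simp_rw [jacobiTheta₂_term, exp_add, intervalIntegral.integral_mul_const]
      rw [integral_exp_mul_complex hc, mul_comm (2 * Real.pi * I : ℂ)]
      simp [exp_int_mul_two_pi_mul_I n]
  have h1 : HasSum (fun n : ℤ ↦ ∫ x in (0 : ℝ)..1, jacobiTheta₂_term n x τ)
      (∫ x in (0 : ℝ)..1, jacobiTheta₂ x τ) := by
    refine intervalIntegral.hasSum_integral_of_dominated_convergence
      (fun n _ ↦ Real.exp (-Real.pi * (τ.im * n ^ 2))) ?_ ?_ ?_ ?_ ?_
    · intro n
      apply Continuous.aestronglyMeasurable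
      unfold jacobiTheta₂_term
      fun_prop
    · intro n
      refine Filter.Eventually.of_forall fun x _ ↦ ?_
      rw [norm_jacobiTheta₂_term]
      apply Real.exp_le_exp.mpr
      simp
      apply le_of_eq; ring
    · refine Filter.Eventually.of_forall fun x _ ↦ ?_
      have := ((summable_jacobiTheta₂_term_iff 0 τ).mpr hτ).norm
      refine this.congr fun n ↦ ?_
      rw [norm_jacobiTheta₂_term]
      simp
      ring
    · simp
    · exact Filter.Eventually.of_forall fun x _ ↦ hasSum_jacobiTheta₂_term x hτ
  simp_rw [hint] at h1
  exact h1.unique (hasSum_ite_eq 0 1)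

theorem exists_jacobiTheta₂_ne_zero (hτ : 0 < τ.im) : ∃ u, jacobiTheta₂ u τ ≠ 0 := by
  by_contra! h
  have := integral_jacobiTheta₂ hτ
  simp [h] at this

end Theta

section Growth

theorem le_exp_mul_of_quasiperiodic {N : ℂ → ℝ} {A : ℝ} {w : ℂ} (hA : 0 ≤ A) (h0 : ∀ u, 0 ≤ N u)
    (h : ∀ u, N (u + w) ≤ Real.exp (A * (1 + ‖u‖)) * N u) (n : ℕ) (u : ℂ) :
    N (u + n * w) ≤ Real.exp (n * (A * (1 + ‖u‖ + n * ‖w‖))) * N u := by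
  induction n with
  | zero => simp
  | succ n ih =>
    have h1 : ‖u + n * w‖ ≤ ‖u‖ + n * ‖w‖ := by
      simpa using norm_add_le u (n * w)
    calc N (u + (n + 1 : ℕ) * w) = N (u + n * w + w) := by push_cast; ring_nf
      _ ≤ _ := h _
      _ ≤ Real.exp (A * (1 + (‖u‖ + n * ‖w‖))) *
          (Real.exp (n * (A * (1 + ‖u‖ + n * ‖w‖))) * N u) := by
        have := h0 (u + n * w)
        gcongr
      _ = Real.exp ((n + 1) * (A * (1 + ‖u‖ + n * ‖w‖))) * N u := by
        rw [← mul_assoc, ← Real.exp_add]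
        ring_nf
      _ ≤ _ := by
        have := h0 u
        push_cast
        gcongr
        linarith

theorem le_exp_mul_of_quasiperiodic_int {N : ℂ → ℝ} {A : ℝ} {w : ℂ} (hA : 0 ≤ A)
    (h0 : ∀ u, 0 ≤ N u) (h : ∀ u, N (u + w) ≤ Real.exp (A * (1 + ‖u‖)) * N u)
    (h' : ∀ u, N (u - w) ≤ Real.exp (A * (1 + ‖u‖)) * N u) (n : ℤ) (u : ℂ) :
    N (u + n * w) ≤ Real.exp (|(n : ℝ)| * (A * (1 + ‖u‖ + |(n : ℝ)| * ‖w‖))) * N u := by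
  obtain ⟨k, rfl | rfl⟩ := n.eq_nat_or_neg
  · simpa using le_exp_mul_of_quasiperiodic hA h0 h k u
  · simpa using le_exp_mul_of_quasiperiodic (w := -w) hA h0 (by simpa [sub_eq_add_neg] using h') k u

theorem exists_le_exp_of_quasiperiodic {N : ℂ → ℝ} {A : ℝ} {τ : ℂ} (hτ : 0 < τ.im) (hA : 0 ≤ A)
    (hc : Continuous N) (h0 : ∀ u, 0 ≤ N u)
    (h1 : ∀ u, N (u + 1) ≤ Real.exp (A * (1 + ‖u‖)) * N u)
    (h1' : ∀ u, N (u - 1) ≤ Real.exp (A * (1 + ‖u‖)) * N u)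
    (h2 : ∀ u, N (u + τ) ≤ Real.exp (A * (1 + ‖u‖)) * N u)
    (h2' : ∀ u, N (u - τ) ≤ Real.exp (A * (1 + ‖u‖)) * N u) :
    ∃ C : ℝ, ∀ u, N u ≤ Real.exp (C * (1 + ‖u‖ ^ 2)) := by
  set R : ℝ := 1 + τ.im with hR
  obtain ⟨M, hM⟩ := (isCompact_closedBall (0 : ℂ) R).bddAbove_image hc.continuousOn
  have hM' (r : ℂ) (hr : ‖r‖ ≤ R) : N r ≤ Real.exp M := by
    refine (hM ⟨r, by simpa using hr, rfl⟩).trans ?_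
    linarith [Real.add_one_le_exp M]
  set K₁ : ℝ := 1 / τ.im + 1
  set K₂ : ℝ := 1 + K₁ * ‖τ‖ + 1
  set K : ℝ := 1 + R + K₂ + K₁ * ‖τ‖
  have hK₁ : 0 ≤ K₁ := by positivity
  have hK₂ : 0 ≤ K₂ := by positivity
  refine ⟨2 * A * K * K₁ + 2 * A * K * K₂ + |M|, fun u ↦ ?_⟩
  set X : ℝ := 1 + ‖u‖ with hX
  have hX1 : 1 ≤ X := by simp [hX]
  set n : ℤ := ⌊u.im / τ.im⌋ with hn
  set v : ℂ := u - n * τ with hv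
  set m : ℤ := ⌊v.re⌋ with hm
  set r : ℂ := v - m with hr
  have hn1 : |(n : ℝ)| ≤ K₁ * X := by
    have e1 := Int.floor_le (u.im / τ.im)
    have e2 := Int.lt_floor_add_one (u.im / τ.im)
    have e3 : |u.im / τ.im| ≤ ‖u‖ / τ.im := by
      rw [abs_div, abs_of_pos hτ]
      have := abs_im_le_norm u
      gcongr
    have e4 := abs_le.mp e3
    have e5 : K₁ * X = 1 / τ.im + 1 + ‖u‖ / τ.im + ‖u‖ := by simp only [K₁, hX]; ring
    have e6 : 0 < 1 / τ.im := by positivity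
    rw [e5, abs_le]
    constructor <;> linarith [norm_nonneg u]
  have hvX : ‖v‖ ≤ ‖u‖ + K₁ * ‖τ‖ * X := by
    refine (norm_sub_le _ _).trans ?_
    rw [norm_mul, norm_intCast]
    nlinarith [mul_le_mul_of_nonneg_right hn1 (norm_nonneg τ)]
  have hm1 : |(m : ℝ)| ≤ K₂ * X := by
    have e1 := Int.floor_le v.re
    have e2 := Int.lt_floor_add_one v.re
    have e4 := abs_le.mp ((abs_re_le_norm v).trans hvX)
    have e5 : K₂ * X = X + K₁ * ‖τ‖ * X + X := by simp only [K₂]; ring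
    rw [e5, abs_le]
    constructor <;> linarith [norm_nonneg u]
  have hrR : ‖r‖ ≤ R := by
    refine (norm_le_abs_re_add_abs_im r).trans ?_
    have e1 := Int.floor_le v.re
    have e2 := Int.lt_floor_add_one v.re
    have e3 := Int.floor_le (u.im / τ.im)
    have e4 := Int.lt_floor_add_one (u.im / τ.im)
    rw [le_div_iff₀ hτ] at e3
    rw [div_lt_iff₀ hτ] at e4
    have e5 : r.re = v.re - m := by simp [hr]
    have e6 : r.im = u.im - n * τ.im := by simp [hr, hv]
    rw [e5, e6, hR]
    refine add_le_add (abs_le.mpr ⟨?_, ?_⟩) (abs_le.mpr ⟨?_, ?_⟩) <;>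
    nlinarith
  have e1 := le_exp_mul_of_quasiperiodic_int hA h0 h2 h2' n (r + m)
  have e2 := le_exp_mul_of_quasiperiodic_int hA h0 h1 h1' m r
  rw [show r + m + n * τ = u by simp [hr, hv]] at e1
  have e3 : 1 + ‖r + m‖ + |(n : ℝ)| * ‖τ‖ ≤ K * X := by
    have := norm_add_le r m
    rw [norm_intCast] at this
    have f1 := mul_le_mul_of_nonneg_right hn1 (norm_nonneg τ)
    have f2 : K * X = X + R * X + K₂ * X + K₁ * X * ‖τ‖ := by simp only [K]; ring
    have f3 : R ≤ R * X := le_mul_of_one_le_right (by positivity) hX1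
    linarith
  have e4 : 1 + ‖r‖ + |(m : ℝ)| * ‖(1 : ℂ)‖ ≤ K * X := by
    have f1 : 0 ≤ K₁ * X * ‖τ‖ := by positivity
    have f2 : K * X = X + R * X + K₂ * X + K₁ * X * ‖τ‖ := by simp only [K]; ring
    have f3 : R ≤ R * X := le_mul_of_one_le_right (by positivity) hX1
    rw [norm_one, mul_one]
    linarith
  rw [mul_one] at e2
  have hN := h0 r
  calc N u ≤ Real.exp (K₁ * X * (A * (K * X))) * N (r + m) := by
        refine e1.trans ?_
        have := h0 (r + m)
        gcongr
    _ ≤ Real.exp (K₁ * X * (A * (K * X))) * (Real.exp (K₂ * X * (A * (K * X))) * Real.exp M) := by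
        gcongr
        refine e2.trans ?_
        gcongr
        exact hM' r hrR
    _ = Real.exp ((A * K * K₁ + A * K * K₂) * X ^ 2 + M) := by
        rw [← Real.exp_add, ← Real.exp_add]
        ring_nf
    _ ≤ _ := by
        apply Real.exp_le_exp.mpr
        have f1 : X ^ 2 ≤ 2 * (1 + ‖u‖ ^ 2) := by nlinarith [sq_nonneg (1 - ‖u‖)]
        have f2 : M ≤ |M| * (1 + ‖u‖ ^ 2) :=
          (le_abs_self M).trans (le_mul_of_one_le_right (abs_nonneg M) (by nlinarith))
        have f3 : 0 ≤ A * K * K₁ + A * K * K₂ := by positivity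
        nlinarith [mul_le_mul_of_nonneg_left f1 f3]

end Growth

/-- A function which agrees near every point, away from that point, with an analytic function
extends to an entire function. -/

theorem exists_differentiable_of_forall_eventuallyEq {f : ℂ → ℂ}
    (h : ∀ u, ∃ F : ℂ → ℂ, AnalyticAt ℂ F u ∧ f =ᶠ[𝓝[≠] u] F) :
    ∃ g : ℂ → ℂ, Differentiable ℂ g ∧ ∀ u, ContinuousAt f u → g u = f u := by
  choose F hF hfF using h
  have key (u : ℂ) : (fun v ↦ F v v) =ᶠ[𝓝 u] F u := by
    filter_upwards [eventually_nhds_nhdsWithin.mpr (hfF u), (hF u).eventually_analyticAt]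
      with v hv hFv
    by_cases hvu : v = u
    · rw [hvu]
    have h1 : ∀ᶠ w in 𝓝[≠] v, f w = F u w := by
      rw [isOpen_compl_singleton.nhdsWithin_eq hvu] at hv
      exact hv.filter_mono nhdsWithin_le_nhds
    exact tendsto_nhds_unique
      (((hF v).continuousAt.tendsto.mono_left nhdsWithin_le_nhds).congr' (hfF v).symm)
      ((hFv.continuousAt.tendsto.mono_left nhdsWithin_le_nhds).congr'
        (Filter.EventuallyEq.symm h1))
  refine ⟨fun v ↦ F v v, fun u ↦ ((hF u).congr (key u).symm).differentiableAt, fun u hu ↦ ?_⟩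
  have h1 : Filter.Tendsto f (𝓝[≠] u) (𝓝 (F u u)) :=
    ((hF u).continuousAt.tendsto.mono_left nhdsWithin_le_nhds).congr' (hfF u).symm
  exact tendsto_nhds_unique h1 (hu.tendsto.mono_left nhdsWithin_le_nhds)

namespace PeriodPair

variable (L : PeriodPair)

theorem dense_compl_lattice : Dense (L.lattice : Set ℂ)ᶜ := by
  have : Countable L.lattice := L.latticeEquivProd.toEquiv.countable_iff.mpr inferInstance
  exact Set.Countable.dense_compl ℂ (Set.to_countable _)

theorem exists_differentiable_eq_sq_mul_weierstrassP {θ : ℂ → ℂ}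
    (hθ : Differentiable ℂ θ) (h0 : ∀ l ∈ L.lattice, θ l = 0) :
    ∃ F : ℂ → ℂ, Differentiable ℂ F ∧ ∀ u ∉ L.lattice, F u = θ u ^ 2 * L.weierstrassP u := by
  have h (u : ℂ) : ∃ F : ℂ → ℂ, AnalyticAt ℂ F u ∧
      (fun u ↦ θ u ^ 2 * L.weierstrassP u) =ᶠ[𝓝[≠] u] F := by
    by_cases hu : u ∈ L.lattice
    · have hd : Differentiable ℂ (dslope θ u) := by
        rw [← differentiableOn_univ, differentiableOn_dslope Filter.univ_mem,
          differentiableOn_univ]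
        exact hθ
      refine ⟨fun v ↦ θ v ^ 2 * L.weierstrassPExcept u v + dslope θ u v ^ 2 - θ v ^ 2 / u ^ 2,
        ?_, ?_⟩
      · have h1 := L.analyticAt_weierstrassPExcept u
        have h2 := hθ.analyticAt u
        have h3 := hd.analyticAt u
        simp only [div_eq_mul_inv]
        fun_prop
      · filter_upwards [self_mem_nhdsWithin] with v hv
        have h4 : v - u ≠ 0 := sub_ne_zero.mpr hv
        have h5 := L.weierstrassPExcept_add ⟨u, hu⟩ v
        have h6 : dslope θ u v = θ v / (v - u) := by
          rw [dslope_of_ne _ hv, slope_def_field, h0 u hu, sub_zero]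
        simp only at h5
        rw [← h5, h6, div_pow]
        ring
    · refine ⟨_, ?_, Filter.EventuallyEq.rfl⟩
      have h1 := L.analyticOnNhd_weierstrassP u hu
      have h2 := hθ.analyticAt u
      fun_prop
  obtain ⟨g, hg, hgf⟩ := exists_differentiable_of_forall_eventuallyEq h
  refine ⟨g, hg, fun u hu ↦ hgf u ?_⟩
  have h1 := (L.analyticOnNhd_weierstrassP u hu).continuousAt
  have h2 := (hθ u).continuousAt
  fun_prop

theorem exists_differentiable_eq_sq_mul_weierstrassZeta {θ : ℂ → ℂ}
    (hθ : Differentiable ℂ θ) (h0 : ∀ l ∈ L.lattice, θ l = 0) :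
    ∃ F : ℂ → ℂ, Differentiable ℂ F ∧ ∀ u ∉ L.lattice, F u = θ u ^ 2 * L.weierstrassZeta u := by
  have hZ (u : ℂ) (hu : u ∉ L.lattice) : AnalyticAt ℂ L.weierstrassZeta u := by
    simpa only [L.weierstrassZetaExcept_of_notMem u hu] using L.analyticAt_weierstrassZetaExcept u
  have h (u : ℂ) : ∃ F : ℂ → ℂ, AnalyticAt ℂ F u ∧
      (fun u ↦ θ u ^ 2 * L.weierstrassZeta u) =ᶠ[𝓝[≠] u] F := by
    by_cases hu : u ∈ L.lattice
    · have hd : Differentiable ℂ (dslope θ u) := by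
        rw [← differentiableOn_univ, differentiableOn_dslope Filter.univ_mem,
          differentiableOn_univ]
        exact hθ
      refine ⟨fun v ↦ θ v ^ 2 * L.weierstrassZetaExcept u v + θ v * dslope θ u v +
        θ v ^ 2 * (1 / u + v / u ^ 2), ?_, ?_⟩
      · have h1 := L.analyticAt_weierstrassZetaExcept u
        have h2 := hθ.analyticAt u
        have h3 := hd.analyticAt u
        simp only [div_eq_mul_inv]
        fun_prop
      · filter_upwards [self_mem_nhdsWithin] with v hv
        have h4 : v - u ≠ 0 := sub_ne_zero.mpr hv
        have h5 := L.weierstrassZetaExcept_add ⟨u, hu⟩ v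
        have h6 : dslope θ u v = θ v / (v - u) := by
          rw [dslope_of_ne _ hv, slope_def_field, h0 u hu, sub_zero]
        simp only at h5
        rw [← h5, h6]
        ring
    · refine ⟨_, ?_, Filter.EventuallyEq.rfl⟩
      have h1 := hZ u hu
      have h2 := hθ.analyticAt u
      fun_prop
  obtain ⟨g, hg, hgf⟩ := exists_differentiable_of_forall_eventuallyEq h
  refine ⟨g, hg, fun u hu ↦ hgf u ?_⟩
  have h1 := (hZ u hu).continuousAt
  have h2 := (hθ u).continuousAt
  fun_prop

end PeriodPair

/-- Entire functions `F₁`, `F₂`, `F₃` with `F₂ / F₁ = ℘` and `F₃ / F₁ = ζ`, which are theta functions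
for the lattice `ℤ + ℤτ`. -/

theorem PeriodPair.exists_entire_triple (τ : UpperHalfPlane) :
    ∃ F₁ F₂ F₃ : ℂ → ℂ, Differentiable ℂ F₁ ∧ Differentiable ℂ F₂ ∧ Differentiable ℂ F₃ ∧
      (∃ u, F₁ u ≠ 0) ∧ (∀ l ∈ (ofUpperHalfPlane τ).lattice, F₁ l = 0) ∧
      (∀ u ∉ (ofUpperHalfPlane τ).lattice,
        F₂ u = F₁ u * (ofUpperHalfPlane τ).weierstrassP u ∧
        F₃ u = F₁ u * (ofUpperHalfPlane τ).weierstrassZeta u) ∧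
      (∀ i : Fin 2, ∃ a b : ℂ, ∀ u,
        F₁ (u + ![1, (τ : ℂ)] i) = exp (a * u + b) * F₁ u ∧
        F₂ (u + ![1, (τ : ℂ)] i) = exp (a * u + b) * F₂ u ∧
        F₃ (u + ![1, (τ : ℂ)] i) = exp (a * u + b) * (F₃ u +
          ![EisensteinSeries.G2 τ, τ * EisensteinSeries.G2 τ - 2 * Real.pi * I] i * F₁ u)) := by
  set L := ofUpperHalfPlane τ with hL
  set θ : ℂ → ℂ := fun u ↦ jacobiTheta₂ (u + (1 + τ) / 2) τ with hθdef
  have hθ : Differentiable ℂ θ :=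
    (differentiable_jacobiTheta₂_fst τ.im_pos).comp (differentiable_id.add_const _)
  have hθ1 (u : ℂ) : θ (u + 1) = θ u := by
    simp only [θ]
    rw [← jacobiTheta₂_add_left (u + (1 + τ) / 2)]
    ring_nf
  have hθ2 (u : ℂ) : θ (u + τ) = exp (-Real.pi * I * (τ + 2 * (u + (1 + τ) / 2))) * θ u := by
    simp only [θ]
    rw [← jacobiTheta₂_add_left']
    ring_nf
  have hmem (u : ℂ) : u ∈ L.lattice ↔ ∃ m n : ℤ, m + n * (τ : ℂ) = u := by
    rw [L.mem_lattice]
    simp [hL, ofUpperHalfPlane]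
  have hθint1 (m : ℤ) (u : ℂ) : θ (u + m) = θ u := by
    induction m using Int.induction_on with
    | zero => simp
    | succ n ih => rw [← ih, ← hθ1 (u + (n : ℤ))]; push_cast; ring_nf
    | pred n ih => rw [← ih, ← hθ1]; push_cast; ring_nf
  have hθint2 (n : ℤ) : θ (n * τ) = 0 := by
    induction n using Int.induction_on with
    | zero => simpa [θ] using jacobiTheta₂_half_period τ
    | succ n ih =>
      push_cast at ih ⊢
      rw [add_mul, one_mul, hθ2, ih, mul_zero]
    | pred n ih =>
      push_cast at ih ⊢
      have := hθ2 ((-n - 1) * τ)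
      rw [show (-n - 1 : ℂ) * τ + τ = -n * τ by ring, ih] at this
      simpa [exp_ne_zero] using this.symm
  have h0 : ∀ l ∈ L.lattice, θ l = 0 := by
    intro l hl
    obtain ⟨m, n, rfl⟩ := (hmem l).mp hl
    rw [add_comm, hθint1, hθint2]
  obtain ⟨F₂, hF₂, hF₂'⟩ := L.exists_differentiable_eq_sq_mul_weierstrassP hθ h0
  obtain ⟨F₃, hF₃, hF₃'⟩ := L.exists_differentiable_eq_sq_mul_weierstrassZeta hθ h0
  refine ⟨fun u ↦ θ u ^ 2, F₂, F₃, hθ.pow 2, hF₂, hF₃, ?_, ?_, fun u hu ↦ ⟨hF₂' u hu, hF₃' u hu⟩, ?_⟩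
  · obtain ⟨u, hu⟩ := exists_jacobiTheta₂_ne_zero τ.im_pos
    exact ⟨u - (1 + τ) / 2, by simpa [θ] using hu⟩
  · intro l hl
    simp [h0 l hl]
  have key (ϖ η a b : ℂ) (hϖ : ϖ ∈ L.lattice) (hθϖ : ∀ u, θ (u + ϖ) = exp (a * u + b) * θ u)
      (hζ : ∀ u, L.weierstrassZeta (u + ϖ) = L.weierstrassZeta u + η) (u : ℂ) :
      θ (u + ϖ) ^ 2 = exp (2 * a * u + 2 * b) * θ u ^ 2 ∧
      F₂ (u + ϖ) = exp (2 * a * u + 2 * b) * F₂ u ∧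
      F₃ (u + ϖ) = exp (2 * a * u + 2 * b) * (F₃ u + η * θ u ^ 2) := by
    have hexp (u : ℂ) : exp (2 * a * u + 2 * b) = exp (a * u + b) ^ 2 := by
      rw [← Complex.exp_nat_mul]
      push_cast
      ring_nf
    have hsub {u : ℂ} (hu : u ∉ L.lattice) : u + ϖ ∉ L.lattice := fun h ↦
      hu (by simpa using L.lattice.sub_mem h hϖ)
    have hcθ := hθ.continuous
    have hc₂ := hF₂.continuous
    have hc₃ := hF₃.continuous
    refine ⟨by rw [hθϖ, hexp]; ring, ?_, ?_⟩
    · refine congrFun (Continuous.ext_on L.dense_compl_lattice (f := fun u ↦ F₂ (u + ϖ))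
        (g := fun u ↦ exp (2 * a * u + 2 * b) * F₂ u) (by fun_prop) (by fun_prop) ?_) u
      intro u hu
      have := L.weierstrassP_add_coe u ⟨ϖ, hϖ⟩
      simp only at this
      simp only [hF₂' _ (hsub hu), hF₂' u hu, hexp, this, hθϖ]
      ring
    · refine congrFun (Continuous.ext_on L.dense_compl_lattice (f := fun u ↦ F₃ (u + ϖ))
        (g := fun u ↦ exp (2 * a * u + 2 * b) * (F₃ u + η * θ u ^ 2))
        (by fun_prop) (by fun_prop) ?_) u
      intro u hu
      simp only [hF₃' _ (hsub hu), hF₃' u hu, hexp, hζ, hθϖ]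
      ring
  intro i
  fin_cases i
  · exact ⟨_, _, key 1 _ 0 0 ((hmem 1).mpr ⟨1, 0, by simp⟩) (by simpa using hθ1)
      fun u ↦ weierstrassZeta_add_one τ⟩
  · refine ⟨_, _, key τ _ (-Real.pi * I * 2) (-Real.pi * I * (1 + 2 * τ))
      ((hmem τ).mpr ⟨0, 1, by simp⟩) (fun u ↦ ?_) fun u ↦ weierstrassZeta_add_tau τ⟩
    rw [hθ2]
    ring_nf

/-- Growth of order at most two. -/
def OrderLeTwo (f : ℂ → ℂ) : Prop := ∃ C : ℝ, ∀ s, ‖f s‖ ≤ Real.exp (C * (1 + ‖s‖ ^ 2))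

namespace OrderLeTwo

variable {f g : ℂ → ℂ}

theorem exists_nonneg (hf : OrderLeTwo f) :
    ∃ C : ℝ, 0 ≤ C ∧ ∀ s, ‖f s‖ ≤ Real.exp (C * (1 + ‖s‖ ^ 2)) := by
  obtain ⟨C, hC⟩ := hf
  refine ⟨|C|, abs_nonneg C, fun s ↦ (hC s).trans ?_⟩
  gcongr
  exact le_abs_self C

theorem mul (hf : OrderLeTwo f) (hg : OrderLeTwo g) : OrderLeTwo fun s ↦ f s * g s := by
  obtain ⟨C, hC⟩ := hf
  obtain ⟨D, hD⟩ := hg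
  refine ⟨C + D, fun s ↦ ?_⟩
  rw [norm_mul, add_mul, Real.exp_add]
  gcongr
  exacts [hC s, hD s]

theorem add (hf : OrderLeTwo f) (hg : OrderLeTwo g) : OrderLeTwo fun s ↦ f s + g s := by
  obtain ⟨C, hC0, hC⟩ := hf.exists_nonneg
  obtain ⟨D, hD0, hD⟩ := hg.exists_nonneg
  refine ⟨C + D + 1, fun s ↦ (norm_add_le _ _).trans ?_⟩
  set X := 1 + ‖s‖ ^ 2
  have hX : 1 ≤ X := by simp [X]
  have h1 : Real.exp (C * X) ≤ Real.exp ((C + D) * X) := by gcongr; linarith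
  have h2 : Real.exp (D * X) ≤ Real.exp ((C + D) * X) := by gcongr; linarith
  have h3 : 2 ≤ Real.exp X := by linarith [Real.add_one_le_exp X]
  calc ‖f s‖ + ‖g s‖ ≤ 2 * Real.exp ((C + D) * X) := by linarith [hC s, hD s]
    _ ≤ Real.exp X * Real.exp ((C + D) * X) := by gcongr
    _ = _ := by rw [← Real.exp_add]; ring_nf

theorem const (c : ℂ) : OrderLeTwo fun _ ↦ c := by
  refine ⟨‖c‖, fun s ↦ ?_⟩
  have h1 : ‖c‖ ≤ ‖c‖ * (1 + ‖s‖ ^ 2) := le_mul_of_one_le_right (norm_nonneg c) (by simp)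
  linarith [Real.add_one_le_exp (‖c‖ * (1 + ‖s‖ ^ 2))]

theorem id : OrderLeTwo fun s ↦ s := by
  refine ⟨1, fun s ↦ ?_⟩
  nlinarith [Real.add_one_le_exp (1 * (1 + ‖s‖ ^ 2)), sq_nonneg (1 - ‖s‖)]

theorem comp_affine (hf : OrderLeTwo f) (c b : ℂ) : OrderLeTwo fun s ↦ f (s / c + b) := by
  obtain ⟨C, hC0, hC⟩ := hf.exists_nonneg
  refine ⟨C * (1 + 2 * ‖c‖⁻¹ ^ 2 + 2 * ‖b‖ ^ 2), fun s ↦ (hC _).trans ?_⟩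
  have h1 : ‖s / c + b‖ ≤ ‖s‖ * ‖c‖⁻¹ + ‖b‖ := by
    refine (norm_add_le _ _).trans ?_
    rw [norm_div, div_eq_mul_inv]
  have h2 : ‖s / c + b‖ ^ 2 ≤ (‖s‖ * ‖c‖⁻¹ + ‖b‖) ^ 2 := by gcongr
  apply Real.exp_le_exp.mpr
  rw [mul_assoc]
  refine mul_le_mul_of_nonneg_left ?_ hC0
  have h3 : 0 ≤ ‖s‖ ^ 2 * ‖b‖ ^ 2 := by positivity
  nlinarith [sq_nonneg (‖s‖ * ‖c‖⁻¹ - ‖b‖), sq_nonneg ‖s‖, sq_nonneg ‖c‖⁻¹]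

end OrderLeTwo

theorem norm_exp_affine_le (a b u : ℂ) : ‖exp (a * u + b)‖ ≤ Real.exp ((‖a‖ + ‖b‖) * (1 + ‖u‖)) := by
  rw [norm_exp]
  apply Real.exp_le_exp.mpr
  refine (re_le_norm _).trans ((norm_add_le _ _).trans ?_)
  rw [norm_mul]
  nlinarith [norm_nonneg a, norm_nonneg b, norm_nonneg u, mul_nonneg (norm_nonneg b) (norm_nonneg u)]

/-- Theta functions for a lattice, and the quasi-theta functions built from them, have order at
most two. -/

theorem orderLeTwo_of_translate {F₁ F₂ F₃ : ℂ → ℂ} {τ : ℂ} (hτ : 0 < τ.im)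
    (h₁ : Continuous F₁) (h₂ : Continuous F₂) (h₃ : Continuous F₃) {η : Fin 2 → ℂ}
    (h : ∀ i : Fin 2, ∃ a b : ℂ, ∀ u,
        F₁ (u + ![1, τ] i) = exp (a * u + b) * F₁ u ∧
        F₂ (u + ![1, τ] i) = exp (a * u + b) * F₂ u ∧
        F₃ (u + ![1, τ] i) = exp (a * u + b) * (F₃ u + η i * F₁ u)) :
    OrderLeTwo F₁ ∧ OrderLeTwo F₂ ∧ OrderLeTwo F₃ := by
  set N : ℂ → ℝ := fun u ↦ ‖F₁ u‖ + ‖F₂ u‖ + ‖F₃ u‖ with hN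
  have step (i : Fin 2) : ∃ A : ℝ, 0 ≤ A ∧
      (∀ u, N (u + ![1, τ] i) ≤ Real.exp (A * (1 + ‖u‖)) * N u) ∧
      ∀ u, N (u - ![1, τ] i) ≤ Real.exp (A * (1 + ‖u‖)) * N u := by
    obtain ⟨a, b, hab⟩ := h i
    generalize ![1, τ] i = ϖ at hab ⊢
    have hE (a b c u v : ℂ) (h1 : F₁ v = exp (a * u + b) * F₁ u)
        (h2 : F₂ v = exp (a * u + b) * F₂ u)
        (h3 : F₃ v = exp (a * u + b) * (F₃ u + c * F₁ u)) :
        N v ≤ Real.exp ((‖a‖ + ‖b‖ + ‖c‖) * (1 + ‖u‖)) * N u := by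
      have h4 : 1 + ‖c‖ ≤ Real.exp (‖c‖ * (1 + ‖u‖)) := by
        have := Real.add_one_le_exp (‖c‖ * (1 + ‖u‖))
        nlinarith [mul_nonneg (norm_nonneg c) (norm_nonneg u)]
      have h5 : ‖F₃ u + c * F₁ u‖ ≤ ‖F₃ u‖ + ‖c‖ * ‖F₁ u‖ :=
        (norm_add_le _ _).trans (by rw [norm_mul])
      simp only [hN, h1, h2, h3, norm_mul]
      calc _ = ‖exp (a * u + b)‖ * (‖F₁ u‖ + ‖F₂ u‖ + ‖F₃ u + c * F₁ u‖) := by ring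
        _ ≤ Real.exp ((‖a‖ + ‖b‖) * (1 + ‖u‖)) *
            ((1 + ‖c‖) * (‖F₁ u‖ + ‖F₂ u‖ + ‖F₃ u‖)) := by
          refine mul_le_mul (norm_exp_affine_le a b u) ?_ (by positivity) (by positivity)
          nlinarith [mul_nonneg (norm_nonneg c) (norm_nonneg (F₂ u)),
            mul_nonneg (norm_nonneg c) (norm_nonneg (F₃ u))]
        _ ≤ Real.exp ((‖a‖ + ‖b‖) * (1 + ‖u‖)) *
            (Real.exp (‖c‖ * (1 + ‖u‖)) * (‖F₁ u‖ + ‖F₂ u‖ + ‖F₃ u‖)) := by gcongr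
        _ = _ := by
          rw [← mul_assoc, ← Real.exp_add]
          ring_nf
    refine ⟨‖a‖ + ‖b‖ + ‖η i‖ + ‖a * ϖ - b‖, by positivity, fun u ↦ ?_, fun u ↦ ?_⟩
    · refine (hE a b (η i) u _ (hab u).1 (hab u).2.1 (hab u).2.2).trans ?_
      refine mul_le_mul_of_nonneg_right (Real.exp_le_exp.mpr (mul_le_mul_of_nonneg_right ?_
        (by positivity))) (by positivity)
      linarith [norm_nonneg (a * ϖ - b)]
    · obtain ⟨h1, h2, h3⟩ := hab (u - ϖ)
      rw [sub_add_cancel] at h1 h2 h3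
      have h4 : exp (-a * u + (a * ϖ - b)) * exp (a * (u - ϖ) + b) = 1 := by
        rw [← exp_add, ← exp_zero]
        ring_nf
      refine (hE (-a) (a * ϖ - b) (-η i) u _ ?_ ?_ ?_).trans ?_
      · rw [h1, ← mul_assoc, h4, one_mul]
      · rw [h2, ← mul_assoc, h4, one_mul]
      · rw [h3, h1]
        linear_combination (-F₃ (u - ϖ)) * h4
      · rw [norm_neg, norm_neg]
        refine mul_le_mul_of_nonneg_right (Real.exp_le_exp.mpr (mul_le_mul_of_nonneg_right ?_
          (by positivity))) (by positivity)
        linarith [norm_nonneg b]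
  obtain ⟨A, hA, hA1, hA2⟩ := step 0
  obtain ⟨B, hB, hB1, hB2⟩ := step 1
  have h0 (u : ℂ) : 0 ≤ N u := by positivity
  have mono {A B : ℝ} (hB : 0 ≤ B) (u v : ℂ) (hu : N v ≤ Real.exp (A * (1 + ‖u‖)) * N u) :
      N v ≤ Real.exp ((A + B) * (1 + ‖u‖)) * N u := by
    refine hu.trans ?_
    have := h0 u
    gcongr
    linarith
  obtain ⟨C, hC⟩ := exists_le_exp_of_quasiperiodic (N := N) (A := A + B) hτ (add_nonneg hA hB)
    (by fun_prop) h0 (fun u ↦ mono hB u _ (hA1 u)) (fun u ↦ mono hB u _ (hA2 u))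
    (fun u ↦ add_comm B A ▸ mono hA u _ (hB1 u)) (fun u ↦ add_comm B A ▸ mono hA u _ (hB2 u))
  refine ⟨⟨C, fun s ↦ le_trans ?_ (hC s)⟩, ⟨C, fun s ↦ le_trans ?_ (hC s)⟩,
    ⟨C, fun s ↦ le_trans ?_ (hC s)⟩⟩ <;>
  · simp only [hN]
    linarith [norm_nonneg (F₁ s), norm_nonneg (F₂ s), norm_nonneg (F₃ s)]

theorem PeriodPair.hasDerivAt_derivWeierstrassP (L : PeriodPair) {z : ℂ} (hz : z ∉ L.lattice)
    (h : L.derivWeierstrassP z ≠ 0) :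
    HasDerivAt L.derivWeierstrassP (6 * L.weierstrassP z ^ 2 - L.g₂ / 2) z := by
  have h1 := (L.analyticOnNhd_derivWeierstrassP z hz).differentiableAt.hasDerivAt
  have h2 := (L.analyticOnNhd_weierstrassP z hz).differentiableAt.hasDerivAt
  rw [deriv_weierstrassP] at h2
  have h3 := h1.pow 2
  have h4 := (((h2.pow 3).const_mul 4).sub (h2.const_mul L.g₂)).sub_const L.g₃
  have h5 : (fun z ↦ L.derivWeierstrassP z ^ 2) =ᶠ[𝓝 z]
      fun z ↦ 4 * L.weierstrassP z ^ 3 - L.g₂ * L.weierstrassP z - L.g₃ := by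
    filter_upwards [L.isClosed_lattice.isOpen_compl.mem_nhds hz] with v hv
    exact L.derivWeierstrassP_sq v hv
  have h6 := h3.unique (h4.congr_of_eventuallyEq h5)
  rw [show 6 * L.weierstrassP z ^ 2 - L.g₂ / 2 = deriv L.derivWeierstrassP z from ?_]
  · exact h1
  · apply mul_left_cancel₀ (mul_ne_zero two_ne_zero h)
    simp only [Nat.cast_ofNat] at h6
    linear_combination -h6

theorem PeriodPair.exists_leafCurve (τ : UpperHalfPlane) :
    ∃ F : ℂ → ℂ, Differentiable ℂ F ∧ (∃ u, F u ≠ 0) ∧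
      (∀ l ∈ (ofUpperHalfPlane τ).lattice, F l = 0) ∧
      ∀ b ϖ t : ℂ, F b ≠ 0 → (ofUpperHalfPlane τ).derivWeierstrassP b ≠ 0 → ϖ ≠ 0 →
        ∃ T U V : ℂ → ℂ, LeafCurve T U V ![ϖ, τ * ϖ]
          ![t * ϖ + ϖ⁻¹ * EisensteinSeries.G2 τ,
            t * (τ * ϖ) + ϖ⁻¹ * (τ * EisensteinSeries.G2 τ - 2 * Real.pi * I)]
          (ϖ⁻¹ ^ 4 * ((ofUpperHalfPlane τ).g₂ / 2)) t
          (ϖ⁻¹ ^ 2 * (ofUpperHalfPlane τ).weierstrassP b)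
          (ϖ⁻¹ ^ 3 * (ofUpperHalfPlane τ).derivWeierstrassP b) := by
  set L := ofUpperHalfPlane τ
  obtain ⟨F₁, F₂, F₃, hF₁, hF₂, hF₃, hne, h0, hF, htr⟩ := exists_entire_triple τ
  obtain ⟨hg₁, hg₂, hg₃⟩ := orderLeTwo_of_translate τ.im_pos hF₁.continuous hF₂.continuous
    hF₃.continuous htr
  refine ⟨F₁, hF₁, hne, h0, fun b ϖ t hb hy hϖ ↦ ?_⟩
  have hbL : b ∉ L.lattice := fun h ↦ hb (h0 b h)
  refine ⟨fun s ↦ F₁ (s / ϖ + b), fun s ↦ ϖ⁻¹ ^ 2 * F₂ (s / ϖ + b),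
    fun s ↦ t * s * F₁ (s / ϖ + b) +
      ϖ⁻¹ * (F₃ (s / ϖ + b) + -L.weierstrassZeta b * F₁ (s / ϖ + b)), ?_⟩
  have haff (s : ℂ) : HasDerivAt (fun s ↦ s / ϖ + b) ϖ⁻¹ s := by
    simpa using ((hasDerivAt_id s).div_const ϖ).add_const b
  have hnear : ∀ᶠ s in 𝓝 (0 : ℂ), s / ϖ + b ∉ L.lattice ∧ F₁ (s / ϖ + b) ≠ 0 ∧
      L.derivWeierstrassP (s / ϖ + b) ≠ 0 := by
    have hc : Filter.Tendsto (fun s ↦ s / ϖ + b) (𝓝 0) (𝓝 b) := by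
      simpa using (haff 0).continuousAt.tendsto
    refine hc.eventually (p := fun v ↦ v ∉ L.lattice ∧ F₁ v ≠ 0 ∧ L.derivWeierstrassP v ≠ 0) ?_
    filter_upwards [L.isClosed_lattice.isOpen_compl.mem_nhds hbL,
      hF₁.continuous.continuousAt.eventually_ne hb,
      (L.analyticOnNhd_derivWeierstrassP b hbL).continuousAt.eventually_ne hy] with v h1 h2 h3
      using ⟨h1, h2, h3⟩
  have hX : (fun s ↦ ϖ⁻¹ ^ 2 * F₂ (s / ϖ + b) / F₁ (s / ϖ + b)) =ᶠ[𝓝 0]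
      fun s ↦ ϖ⁻¹ ^ 2 * L.weierstrassP (s / ϖ + b) := by
    filter_upwards [hnear] with s ⟨h1, h2, h3⟩
    rw [(hF _ h1).1, mul_left_comm, mul_div_cancel_left₀ _ h2]
  have hdX : deriv (fun s ↦ ϖ⁻¹ ^ 2 * F₂ (s / ϖ + b) / F₁ (s / ϖ + b)) =ᶠ[𝓝 0]
      fun s ↦ ϖ⁻¹ ^ 3 * L.derivWeierstrassP (s / ϖ + b) := by
    filter_upwards [hnear, hX.deriv] with s ⟨h1, h2, h3⟩ h4
    rw [h4]
    have h5 := (L.analyticOnNhd_weierstrassP _ h1).differentiableAt.hasDerivAt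
    rw [deriv_weierstrassP] at h5
    have h6 := (h5.comp s (haff s)).const_mul (ϖ⁻¹ ^ 2)
    rw [show (fun s ↦ ϖ⁻¹ ^ 2 * L.weierstrassP (s / ϖ + b)) =
      fun s ↦ ϖ⁻¹ ^ 2 * (L.weierstrassP ∘ fun s ↦ s / ϖ + b) s from rfl, h6.deriv]
    ring
  have hg₁' := hg₁.comp_affine ϖ b
  have hg₂' := (OrderLeTwo.const (ϖ⁻¹ ^ 2)).mul (hg₂.comp_affine ϖ b)
  have hg₃' := (((OrderLeTwo.const t).mul .id).mul hg₁').add ((OrderLeTwo.const ϖ⁻¹).mul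
    ((hg₃.comp_affine ϖ b).add ((OrderLeTwo.const (-L.weierstrassZeta b)).mul hg₁')))
  obtain ⟨C₁, hC₁0, hC₁⟩ := hg₁'.exists_nonneg
  obtain ⟨C₂, hC₂0, hC₂⟩ := hg₂'.exists_nonneg
  obtain ⟨C₃, hC₃0, hC₃⟩ := hg₃'.exists_nonneg
  have hdaff : Differentiable ℂ fun s : ℂ ↦ s / ϖ + b := fun s ↦ (haff s).differentiableAt
  have hd₁ := hF₁.comp hdaff
  have hd₂ := hF₂.comp hdaff
  have hd₃ := hF₃.comp hdaff
  simp only [Function.comp_def] at hd₁ hd₂ hd₃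
  exact
  { differentiable_T := hd₁
    differentiable_U := hd₂.const_mul _
    differentiable_V := by fun_prop
    T_zero := by simpa using hb
    translate := fun i ↦ by
      obtain ⟨a, c, hac⟩ := htr i
      refine ⟨a * ϖ⁻¹, a * b + c, fun s ↦ ?_⟩
      obtain ⟨h1, h2, h3⟩ := hac (s / ϖ + b)
      have e1 : (s + ![ϖ, τ * ϖ] i) / ϖ + b = s / ϖ + b + ![1, (τ : ℂ)] i := by
        fin_cases i <;> simp <;> field
      have e2 : a * ϖ⁻¹ * s + (a * b + c) = a * (s / ϖ + b) + c := by ring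
      rw [e1, e2, h1, h2, h3]
      refine ⟨rfl, by ring, ?_⟩
      fin_cases i <;> simp <;> ring
    growth := ⟨C₁ + C₂ + C₃, fun s ↦ ⟨(hC₁ s).trans (by gcongr; linarith),
      (hC₂ s).trans (by gcongr; linarith), (hC₃ s).trans (by gcongr; linarith)⟩⟩
    V_zero := by simp [(hF b hbL).2, mul_comm, L]
    X_zero := hX.eq_of_nhds.trans (by simp)
    deriv_X_zero := hdX.eq_of_nhds.trans (by simp)
    deriv_deriv_X := by
      filter_upwards [hnear, hX, hdX.deriv] with s ⟨h1, h2, h3⟩ h4 h5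
      rw [h4, h5]
      have h6 := ((L.hasDerivAt_derivWeierstrassP h1 h3).comp s (haff s)).const_mul (ϖ⁻¹ ^ 3)
      rw [show (fun s ↦ ϖ⁻¹ ^ 3 * L.derivWeierstrassP (s / ϖ + b)) =
        fun s ↦ ϖ⁻¹ ^ 3 * (L.derivWeierstrassP ∘ fun s ↦ s / ϖ + b) s from rfl, h6.deriv]
      ring
    deriv_Z := by
      have hZ : (fun s ↦ (t * s * F₁ (s / ϖ + b) + ϖ⁻¹ * (F₃ (s / ϖ + b) +
          -L.weierstrassZeta b * F₁ (s / ϖ + b))) / F₁ (s / ϖ + b)) =ᶠ[𝓝 0]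
          fun s ↦ t * s + ϖ⁻¹ * (L.weierstrassZeta (s / ϖ + b) - L.weierstrassZeta b) := by
        filter_upwards [hnear] with s ⟨h1, h2, h3⟩
        rw [(hF _ h1).2, div_eq_iff h2]
        ring
      filter_upwards [hnear, hX, hZ.deriv] with s ⟨h1, h2, h3⟩ h4 h5
      rw [h4, h5]
      have h6 := (((hasDerivAt_id s).const_mul t)).add
        (((L.hasDerivAt_weierstrassZeta h1).comp s (haff s)).sub_const
          (L.weierstrassZeta b) |>.const_mul ϖ⁻¹)
      refine h6.deriv.trans ?_
      ring }

theorem exists_isAlgebraic_mem_nhds {s : Set ℂ} {x : ℂ} (hs : s ∈ 𝓝 x) :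
    ∃ a ∈ s, IsAlgebraic ℚ a := by
  obtain ⟨ε, hε, hball⟩ := Metric.mem_nhds_iff.mp hs
  obtain ⟨p, hp⟩ := exists_rat_near x.re (half_pos hε)
  obtain ⟨q, hq⟩ := exists_rat_near x.im (half_pos hε)
  refine ⟨p + q * I, hball ?_, ?_⟩
  · rw [mem_ball_iff_norm']
    refine (Complex.norm_le_abs_re_add_abs_im _).trans_lt ?_
    simpa using (add_lt_add hp hq).trans_eq (add_halves ε)
  · exact (isAlgebraic_algebraMap p).add
      ((isAlgebraic_algebraMap q).mul Complex.isIntegral_rat_I.isAlgebraic)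

namespace PeriodPair

variable (L : PeriodPair)

theorem eventually_derivWeierstrassP_ne_zero : ∀ᶠ u in 𝓝[≠] (0 : ℂ), L.derivWeierstrassP u ≠ 0 := by
  have hord : meromorphicOrderAt L.weierstrassP 0 < 0 := by
    rw [L.order_weierstrassP 0 (zero_mem _)]
    decide
  have hlim := tendsto_cobounded_of_meromorphicOrderAt_neg hord
  have hroots : ∀ᶠ v in Bornology.cobounded ℂ, 4 * v ^ 3 - L.g₂ * v - L.g₃ ≠ 0 := by
    set p : Polynomial ℂ := .C 4 * .X ^ 3 - .C L.g₂ * .X - .C L.g₃ with hp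
    have hp0 : p ≠ 0 := by
      intro h0
      have := congrArg (fun q ↦ Polynomial.coeff q 3) h0
      simp [hp] at this
    have hfin := Polynomial.finite_setOfPred_isRoot hp0
    filter_upwards [Bornology.isBounded_def.mp hfin.isBounded] with v hv h0
    exact hv (by simp [hp, Polynomial.IsRoot.def, h0])
  have hlat : ∀ᶠ u in 𝓝[≠] (0 : ℂ), u ∉ L.lattice := by
    have := L.compl_lattice_sdiff_singleton_mem_nhds 0
    filter_upwards [nhdsWithin_le_nhds this, self_mem_nhdsWithin] with u hu hu0 hmem
    exact hu ⟨hmem, hu0⟩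
  filter_upwards [hlim.eventually hroots, hlat] with u hu hul h0
  have := L.derivWeierstrassP_sq u hul
  rw [h0] at this
  exact hu (by rw [← this]; simp)

/-- Near a lattice point the Weierstrass `℘`-function takes many algebraic values. -/

theorem exists_isAlgebraic_weierstrassP {F : ℂ → ℂ} (hF : Differentiable ℂ F)
    (hF0 : ∃ u, F u ≠ 0) (hlat : ∀ l ∈ L.lattice, F l = 0) {c : ℂ} (hc : c ≠ 0) :
    ∃ b, F b ≠ 0 ∧ L.derivWeierstrassP b ≠ 0 ∧ IsAlgebraic ℚ (c * L.weierstrassP b) := by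
  have hFev : ∀ᶠ u in 𝓝[≠] (0 : ℂ), F u ≠ 0 := by
    refine (hF.analyticAt 0).eventually_eq_zero_or_eventually_ne_zero.resolve_left fun h ↦ ?_
    obtain ⟨u, hu⟩ := hF0
    have := AnalyticOnNhd.eq_of_eventuallyEq (f := F) (g := fun _ ↦ 0)
      (fun z _ ↦ hF.analyticAt z) (fun z _ ↦ analyticAt_const) h
    exact hu (congrFun this u)
  obtain ⟨u, hu, hu'⟩ := (hFev.and L.eventually_derivWeierstrassP_ne_zero).exists
  have hul : u ∉ L.lattice := fun h ↦ hu (hlat u h)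
  have hS : ∀ᶠ v in 𝓝 u, F v ≠ 0 ∧ L.derivWeierstrassP v ≠ 0 :=
    (hF.continuous.continuousAt.eventually_ne hu).and
      ((L.analyticOnNhd_derivWeierstrassP u hul).continuousAt.eventually_ne hu')
  have hd : HasStrictDerivAt (fun v ↦ c * L.weierstrassP v) (c * L.derivWeierstrassP u) u := by
    have h := (L.analyticOnNhd_weierstrassP u hul).hasStrictDerivAt
    rw [L.deriv_weierstrassP] at h
    exact h.const_mul c
  have hmap := hd.map_nhds_eq (mul_ne_zero hc hu')
  obtain ⟨a, ⟨b, hb, rfl⟩, ha⟩ := exists_isAlgebraic_mem_nhds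
    (hmap ▸ Filter.image_mem_map hS)
  exact ⟨b, hb.1, hb.2, ha⟩

end PeriodPair

open ArithmeticFunction in
theorem sigmaC_eq (j : ℕ) (n : ℕ) : sigmaC j n = (sigma j n : ℂ) := by
  simp [sigmaC, sigma_apply]

theorem tsum_sigma_eq (τ : UpperHalfPlane) (j : ℕ) :
    ∑' n : ℕ+, (ArithmeticFunction.sigma j n : ℂ) * Complex.exp (2 * Real.pi * I * τ) ^ (n : ℕ) =
      ∑' n : ℕ+, sigmaC j n * Complex.exp (2 * Real.pi * I * n * τ) := by
  refine tsum_congr fun n ↦ ?_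
  rw [sigmaC_eq, ← Complex.exp_nat_mul]
  congr 2
  ring

theorem PeriodPair.G_ofUpperHalfPlane (τ : UpperHalfPlane) (k : ℕ) :
    (ofUpperHalfPlane τ).G k = ∑' v, EisensteinSeries.eisSummand k v τ := by
  rw [PeriodPair.G, ← (ofUpperHalfPlane τ).latticeEquivProd.symm.toEquiv.tsum_eq,
    ← (finTwoArrowEquiv ℤ).symm.tsum_eq, ← (Equiv.prodComm ℤ ℤ).tsum_eq]
  refine tsum_congr fun x ↦ ?_
  have h := (ofUpperHalfPlane τ).latticeEquiv_symm_apply x.swap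
  simp only [EisensteinSeries.eisSummand]
  simp at h ⊢
  rw [h]
  simp [ofUpperHalfPlane]
  ring

open EisensteinSeries in
theorem G2_eq_eisG₁ (τ : UpperHalfPlane) : G2 τ = -(2 * Real.pi * I) * eisG₁ τ := by
  rw [G2_eq_tsum_cexp, tsum_sigma_eq, riemannZeta_two, eisG₁]
  generalize ∑' n : ℕ+, sigmaC 1 n * Complex.exp (2 * Real.pi * I * n * τ) = S
  linear_combination ((Real.pi : ℂ) ^ 2 / 3 - 8 * Real.pi ^ 2 * S) * I_sq

theorem riemannZeta_six : riemannZeta 6 = Real.pi ^ 6 / 945 := by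
  have h := riemannZeta_two_mul_nat (k := 3) (by decide)
  rw [show bernoulli (2 * 3) = 1 / 42 by decide +kernel] at h
  norm_num [Nat.factorial] at h
  rw [h]
  ring

theorem PeriodPair.g₂_ofUpperHalfPlane (τ : UpperHalfPlane) :
    (ofUpperHalfPlane τ).g₂ = (2 * Real.pi * I) ^ 2 * eisG₂ τ := by
  have h := tsum_eisSummand_eq_tsum_sigma_mul_cexp_pow (k := 4) (by decide)
    (by decide) τ
  rw [PeriodPair.g₂, G_ofUpperHalfPlane, h, tsum_sigma_eq, eisG₂]
  norm_num [riemannZeta_four, Nat.factorial]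
  generalize ∑' n : ℕ+, sigmaC 3 n * Complex.exp (2 * Real.pi * I * n * τ) = S
  have hI : I ^ 4 = 1 := I_pow_four
  linear_combination (-(4 / 3 : ℂ) * Real.pi ^ 4) * hI

theorem PeriodPair.g₃_ofUpperHalfPlane (τ : UpperHalfPlane) :
    (ofUpperHalfPlane τ).g₃ = -(2 * Real.pi * I) ^ 3 * eisG₃ τ := by
  have h := tsum_eisSummand_eq_tsum_sigma_mul_cexp_pow (k := 6) (by decide)
    (by decide) τ
  rw [PeriodPair.g₃, G_ofUpperHalfPlane, h, tsum_sigma_eq, eisG₃]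
  norm_num [riemannZeta_six, Nat.factorial]
  generalize ∑' n : ℕ+, sigmaC 5 n * Complex.exp (2 * Real.pi * I * n * τ) = S
  have hI : I ^ 6 = -1 := by rw [show (6:ℕ) = 4 + 2 from rfl, pow_add, I_pow_four, I_sq]; ring
  linear_combination ((8 / 27 : ℂ) * Real.pi ^ 6) * hI

theorem exists_leafCurve_of_isAlgebraic {c₂ c₄ z κ : ℂ} (hz : 0 < z.im) (hw : c₄ * z - c₂ ≠ 0)
    (hκ : κ ^ 2 = 2 * Real.pi * I) (h1 : IsAlgebraic ℚ (leafParam c₂ c₄ z).1)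
    (h2 : IsAlgebraic ℚ (leafParam c₂ c₄ z).2.1) (h3 : IsAlgebraic ℚ (leafParam c₂ c₄ z).2.2) :
    ∃ g t e y : ℂ, IsAlgebraic ℚ g ∧ IsAlgebraic ℚ t ∧ IsAlgebraic ℚ e ∧ IsAlgebraic ℚ y ∧ y ≠ 0 ∧
      ∀ N : ℂ, N ≠ 0 → ∃ T U V : ℂ → ℂ,
        LeafCurve T U V ![κ / (c₄ * z - c₂) / N, z * (κ / (c₄ * z - c₂) / N)]
          ![N * (κ * c₄), N * (κ * c₂)] (N ^ 4 * g) (N ^ 2 * t) (N ^ 2 * e) (N ^ 3 * y) := by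
  set τ : UpperHalfPlane := ⟨z, hz⟩
  set w := c₄ * z - c₂ with hwdef
  set L := PeriodPair.ofUpperHalfPlane τ
  have hκ0 : κ ≠ 0 := by
    rintro rfl
    simp [Real.pi_ne_zero] at hκ
  set ϖ := κ / w with hϖdef
  have hϖ : ϖ ≠ 0 := div_ne_zero hκ0 hw
  have hG2 : EisensteinSeries.G2 τ = -κ ^ 2 * eisG₁ z := by rw [G2_eq_eisG₁, hκ]
  have hg₂ : ϖ⁻¹ ^ 4 * L.g₂ = (leafParam c₂ c₄ z).2.1 := by
    rw [PeriodPair.g₂_ofUpperHalfPlane, ← hκ]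
    simp only [leafParam, hϖdef, ← hwdef]
    field_simp
    rfl
  have hg₃ : ϖ⁻¹ ^ 6 * L.g₃ = -(leafParam c₂ c₄ z).2.2 := by
    rw [PeriodPair.g₃_ofUpperHalfPlane, ← hκ]
    simp only [leafParam, hϖdef, ← hwdef]
    field_simp
    rfl
  obtain ⟨F, hF, hF0, hFlat, hcurve⟩ := PeriodPair.exists_leafCurve τ
  obtain ⟨b, hb, hb', he⟩ := L.exists_isAlgebraic_weierstrassP hF hF0 hFlat
    (pow_ne_zero 2 (inv_ne_zero hϖ))
  have hbl : b ∉ L.lattice := fun h ↦ hb (hFlat b h)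
  have hy : IsAlgebraic ℚ (ϖ⁻¹ ^ 3 * L.derivWeierstrassP b) := by
    refine IsAlgebraic.of_pow (n := 2) two_pos ?_
    have hsq : (ϖ⁻¹ ^ 3 * L.derivWeierstrassP b) ^ 2 =
        4 * (ϖ⁻¹ ^ 2 * L.weierstrassP b) ^ 3 -
          (leafParam c₂ c₄ z).2.1 * (ϖ⁻¹ ^ 2 * L.weierstrassP b) + (leafParam c₂ c₄ z).2.2 := by
      rw [mul_pow, L.derivWeierstrassP_sq b hbl, ← hg₂, ← neg_eq_iff_eq_neg.mpr hg₃]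
      ring
    rw [hsq]
    exact (((isAlgebraic_natCast 4).mul (he.pow 3)).sub (h2.mul he)).add h3
  refine ⟨(leafParam c₂ c₄ z).2.1 / 2, (leafParam c₂ c₄ z).1, ϖ⁻¹ ^ 2 * L.weierstrassP b,
    ϖ⁻¹ ^ 3 * L.derivWeierstrassP b, ?_, h1, he, hy, mul_ne_zero (by positivity) hb',
    fun N hN ↦ ?_⟩
  · rw [div_eq_mul_inv]
    exact h2.mul (isAlgebraic_natCast 2).inv
  obtain ⟨T, U, V, h⟩ := hcurve b (ϖ / N) (N ^ 2 * (leafParam c₂ c₄ z).1) hb hb'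
    (div_ne_zero hϖ hN)
  refine ⟨T, U, V, ?_⟩
  convert h using 1
  · congr 1
    · rw [hG2]
      simp only [leafParam, hϖdef, ← hwdef]
      field_simp
      ring
    · congr 1
      rw [hG2, ← hκ]
      simp only [leafParam, hϖdef, ← hwdef]
      field_simp
      rw [hwdef, show (τ : ℂ) = z from rfl]
      ring
  · rw [← hg₂]
    field_simp
    rfl
  · field_simp
    rfl
  · field_simp
    rfl

theorem exists_nat_forall_isIntegral {ι : Type*} (s : Finset ι) (f : ι → ℂ)
    (hf : ∀ i ∈ s, IsAlgebraic ℚ (f i)) :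
    ∃ N : ℕ, N ≠ 0 ∧ ∀ i ∈ s, IsIntegral ℤ (N * f i) := by
  classical
  induction s using Finset.induction_on with
  | empty => exact ⟨1, one_ne_zero, by simp⟩
  | insert a s ha ih =>
    obtain ⟨N, hN, h⟩ := ih fun i hi ↦ hf i (Finset.mem_insert_of_mem hi)
    have halg : IsAlgebraic ℤ (f a) :=
      (IsFractionRing.isAlgebraic_iff ℤ ℚ ℂ).mpr (hf a (Finset.mem_insert_self a s))
    obtain ⟨M, hM, hMint⟩ := halg.exists_integral_multiple
    have hMint' : IsIntegral ℤ ((M.natAbs : ℂ) * f a) := by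
      rcases Int.natAbs_eq M with h | h
      · rw [h] at hMint
        simpa using hMint
      · rw [h] at hMint
        simpa using hMint.neg
    refine ⟨M.natAbs * N, mul_ne_zero (Int.natAbs_ne_zero.mpr hM) hN, fun i hi ↦ ?_⟩
    push_cast
    rcases Finset.mem_insert.mp hi with rfl | hi
    · rw [mul_comm (M.natAbs : ℂ), mul_assoc]
      exact (isIntegral_natCast _).mul hMint'
    · rw [mul_assoc]
      exact (isIntegral_natCast _).mul (h i hi)

/-- Finitely many algebraic numbers become algebraic integers of a common number field after
multiplication by a common positive integer. -/

theorem exists_numberField_forall_mem {ι : Type*} [Finite ι] (f : ι → ℂ)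
    (hf : ∀ i, IsAlgebraic ℚ (f i)) :
    ∃ (K : Type) (_ : Field K) (_ : NumberField K) (φ : K →+* ℂ) (N : ℕ), N ≠ 0 ∧
      ∀ i, ∃ a : 𝓞 K, φ a = N * f i := by
  have := Fintype.ofFinite ι
  obtain ⟨N, hN, h⟩ := exists_nat_forall_isIntegral Finset.univ f fun i _ ↦ hf i
  let K := IntermediateField.adjoin ℚ (Set.range f)
  have : FiniteDimensional ℚ K := by
    refine IntermediateField.finiteDimensional_adjoin ?_
    rintro _ ⟨i, rfl⟩
    exact (hf i).isIntegral
  refine ⟨K, inferInstance, { to_charZero := inferInstance, to_finiteDimensional := this },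
    algebraMap K ℂ, N, hN, fun i ↦ ?_⟩
  let a : K := N * ⟨f i, IntermediateField.subset_adjoin ℚ _ ⟨i, rfl⟩⟩
  have ha : IsIntegral ℤ a := by
    rw [← isIntegral_algebraMap_iff (B := ℂ) (algebraMap K ℂ).injective]
    simpa [a] using h i (Finset.mem_univ i)
  exact ⟨⟨a, ha⟩, by rfl⟩

/-- **Every transcendent leaf of the Ramanujan foliation contains at most one algebraic
point**: if two points `u(z)`, `u(z′)` of the leaf of `ℱ(Ra)` determined by
`(c₂,c₄) ≠ (0,0)` have all coordinates algebraic, then `u(z) = u(z′)`. -/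

theorem leaf_at_most_one_algebraic_point (c₂ c₄ : ℂ) (hv : (c₂, c₄) ≠ (0, 0))
    (z z' : ℂ) (hz : 0 < z.im) (hz' : 0 < z'.im)
    (hw : c₄ * z - c₂ ≠ 0) (hw' : c₄ * z' - c₂ ≠ 0)
    (h1 : IsAlgebraic ℚ (leafParam c₂ c₄ z).1)
    (h2 : IsAlgebraic ℚ (leafParam c₂ c₄ z).2.1)
    (h3 : IsAlgebraic ℚ (leafParam c₂ c₄ z).2.2)
    (h1' : IsAlgebraic ℚ (leafParam c₂ c₄ z').1)
    (h2' : IsAlgebraic ℚ (leafParam c₂ c₄ z').2.1)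
    (h3' : IsAlgebraic ℚ (leafParam c₂ c₄ z').2.2) :
    leafParam c₂ c₄ z = leafParam c₂ c₄ z' := by
  obtain ⟨κ, hκ⟩ := IsAlgClosed.exists_pow_nat_eq (2 * Real.pi * I) two_pos
  have hκ0 : κ ≠ 0 := by
    rintro rfl
    simp [Real.pi_ne_zero] at hκ
  obtain ⟨g, t, e, y, hg, ht, he, hy, hy0, hc⟩ :=
    exists_leafCurve_of_isAlgebraic hz hw hκ h1 h2 h3
  obtain ⟨g', t', e', y', hg', ht', he', hy', hy0', hc'⟩ :=
    exists_leafCurve_of_isAlgebraic hz' hw' hκ h1' h2' h3'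
  obtain ⟨K, _, _, φ, N, hN, hφ⟩ := exists_numberField_forall_mem ![g, t, e, y, g', t', e', y'] (by
    intro i
    fin_cases i <;> assumption)
  have hN' : (N : ℂ) ≠ 0 := Nat.cast_ne_zero.mpr hN
  choose a ha using hφ
  obtain ⟨T, U, V, h⟩ := hc N hN'
  obtain ⟨T', U', V', h'⟩ := hc' N hN'
  have hmul : ∀ (i : Fin 8) (k : ℕ), φ (N ^ k * a i : 𝓞 K) =
      N ^ (k + 1) * ![g, t, e, y, g', t', e', y'] i := by
    intro i k
    push_cast
    rw [map_mul, ha, map_pow, map_natCast]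
    ring
  have key := LeafCurve.periods_dependent (φ := φ)
    (g := N ^ 3 * a 0) (t := N ^ 1 * a 1) (e := N ^ 1 * a 2) (y := N ^ 2 * a 3)
    (g' := N ^ 3 * a 4) (t' := N ^ 1 * a 5) (e' := N ^ 1 * a 6) (y' := N ^ 2 * a 7)
    (by simp only [hmul]; exact h) (by simp only [hmul]; exact h') ?_ ?_ ?_
  · have : z' = z := by
      simp only [Matrix.cons_val_zero, Matrix.cons_val_one] at key
      field_simp at key
      exact key
    rw [this]
  · intro h0
    have h4 := congrFun h0 0
    have h2 := congrFun h0 1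
    simp [hN, hκ0] at h4 h2
    exact hv (by rw [h4, h2])
  · intro h0
    have := hmul 3 2
    rw [h0] at this
    simp [hN, hy0] at this
  · intro h0
    have := hmul 7 2
    rw [h0] at this
    simp [hN, hy0'] at this
end

section
/- The image of the Eisenstein triple avoids the discriminant locus: for every z in the upper half plane ℍ, 27·g₃(z)² − g₂(z)³ ≠ 0; equivalently, the point (g₁(z), g₂(z), g₃(z)) lies in T = ℂ³ ∖ {27t₃² = t₂³}, i.e. the elliptic curve y² − 4(x−g₁(z))³ + g₂(z)(x−g₁(z)) + g₃(z) = 0 is smooth. -/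
open Complex

/-- The Fourier expansion of the normalised Eisenstein series, written with `sigmaC`. -/
lemma eisensteinSeries_eq_tsum_sigmaC {k : ℕ} (hk : 3 ≤ k) (hk2 : Even k)
    (z : UpperHalfPlane) :
    ModularForm.E hk z = 1 - (2 * k / bernoulli k) *
      ∑' n : ℕ+, sigmaC (k - 1) n * Complex.exp (2 * Real.pi * I * n * z) := by
  rw [EisensteinSeries.q_expansion_bernoulli hk hk2 z]
  congr 2
  refine tsum_congr fun n => ?_
  congr 1
  · simp [sigmaC, ArithmeticFunction.sigma_apply]
  · rw [← Complex.exp_int_mul]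
    congr 1
    push_cast
    ring

lemma eisG₂_eq (z : UpperHalfPlane) :
    eisG₂ z = 12 * (2 * Real.pi * I / 12) ^ 2 * ModularForm.E₄ z := by
  rw [eisensteinSeries_eq_tsum_sigmaC _ ⟨2, rfl⟩, eisG₂,
    show bernoulli 4 = -1 / 30 by decide +kernel]
  push_cast
  ring

lemma eisG₃_eq (z : UpperHalfPlane) :
    eisG₃ z = 8 * (2 * Real.pi * I / 12) ^ 3 * ModularForm.E₆ z := by
  rw [eisensteinSeries_eq_tsum_sigmaC _ ⟨3, rfl⟩, eisG₃,
    show bernoulli 6 = 1 / 42 by decide +kernel]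
  push_cast
  ring

lemma discriminant_eisG (z : UpperHalfPlane) :
    27 * eisG₃ z ^ 2 - eisG₂ z ^ 3 =
      -(1728 ^ 2 * (2 * Real.pi * I / 12) ^ 6 * ModularForm.discriminant z) := by
  rw [eisG₂_eq, eisG₃_eq, ModularForm.discriminant_eq_E₄_cube_sub_E₆_sq]
  ring

/-- The image of the Eisenstein triple avoids the discriminant locus: for every `z` in the
upper half plane, `27·g₃(z)² − g₂(z)³ ≠ 0`, i.e. `(g₁(z),g₂(z),g₃(z))` lies in
`T = ℂ³ ∖ {27t₃² = t₂³}` and the corresponding elliptic curve is smooth. -/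
theorem eisenstein_avoids_discriminant (z : ℂ) (hz : 0 < z.im) :
    27 * eisG₃ z ^ 2 - eisG₂ z ^ 3 ≠ 0 := by
  have hc : (2 * Real.pi * I / 12 : ℂ) ≠ 0 := by simp [Real.pi_ne_zero]
  have h := discriminant_eisG ⟨z, hz⟩
  rw [show ((⟨z, hz⟩ : UpperHalfPlane) : ℂ) = z from rfl] at h
  rw [h, neg_ne_zero]
  exact mul_ne_zero (mul_ne_zero (by norm_num) (pow_ne_zero 6 hc))
    (ModularForm.discriminant_ne_zero _)
end
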